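/- arXiv:math/9907095 — 3 statements merged into one kernel-verified Lean document; each statement's English description precedes it below -/
import Mathlib

section
/- Let A and B be the explicit 7×7 nonnegative integer matrices given in the context. Then: (i) A = SR and B = RS for the explicit integer matrices S and R, so A and B are strong shift equivalent over ℤ; (ii) A and B are primitive, i.e. for each of them some positive power has all entries strictly positive; but (iii) A and B are NOT strong shift equivalent over ℕ, i.e. there is no finite chain A = A₀, A₁, …, A_k = B of square matrices over ℕ together with, for each 1 ≤ i ≤ k, rectangular matrices Rᵢ, Sᵢ over ℕ with A_{i−1} = RᵢSᵢ and A_i = SᵢRᵢ. -/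
/-- A strong shift equivalence (chain of elementary strong shift equivalences)
over a semiring `Λ`, consisting of `k` elementary steps. -/
structure SSEChain (Λ : Type) [Semiring Λ] (k : ℕ) where
  size : Fin (k + 1) → ℕ
  mat : ∀ i : Fin (k + 1), Matrix (Fin (size i)) (Fin (size i)) Λ
  R : ∀ i : Fin k, Matrix (Fin (size i.castSucc)) (Fin (size i.succ)) Λ
  S : ∀ i : Fin k, Matrix (Fin (size i.succ)) (Fin (size i.castSucc)) Λ
  hR : ∀ i : Fin k, mat i.castSucc = R i * S i
  hS : ∀ i : Fin k, mat i.succ = S i * R i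

/-- The chain `c` is a strong shift equivalence from `A` to `B`. -/
def SSEChain.From {Λ : Type} [Semiring Λ] {k n m : ℕ} (c : SSEChain Λ k)
    (A : Matrix (Fin n) (Fin n) Λ) (B : Matrix (Fin m) (Fin m) Λ) : Prop :=
  ∃ (h0 : c.size 0 = n) (h1 : c.size (Fin.last k) = m),
    Matrix.reindex (finCongr h0) (finCongr h0) (c.mat 0) = A ∧
    Matrix.reindex (finCongr h1) (finCongr h1) (c.mat (Fin.last k)) = B

def Smat : Matrix (Fin 7) (Fin 7) ℤ :=
  !![2,2,2,1,3,0,0; 1,2,2,1,3,0,0; 1,1,2,1,3,0,0; 1,1,1,1,3,0,0;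
     0,0,0,0,0,0,1; 4,5,6,3,10,0,0; 4,5,6,3,0,1,0]

def Rmat : Matrix (Fin 7) (Fin 7) ℤ :=
  !![-1,0,1,1,0,0,0; 1,-1,0,0,0,0,0; 0,1,-1,0,0,0,0; 0,0,1,-1,0,0,0;
     0,0,0,0,1,0,0; 0,0,0,0,0,1,0; 0,0,0,0,0,0,1]

def Amat : Matrix (Fin 7) (Fin 7) ℤ :=
  !![0,0,1,1,3,0,0; 1,0,0,0,3,0,0; 0,1,0,0,3,0,0; 0,0,1,0,3,0,0;
     0,0,0,0,0,0,1; 1,1,1,1,10,0,0; 1,1,1,1,0,1,0]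

def Bmat : Matrix (Fin 7) (Fin 7) ℤ :=
  !![0,0,1,1,3,0,0; 1,0,0,0,0,0,0; 0,1,0,0,0,0,0; 0,0,1,0,0,0,0;
     0,0,0,0,0,0,1; 4,5,6,3,10,0,0; 4,5,6,3,0,1,0]

/-- The nonnegative matrix `A`, as a matrix over `ℕ`. -/
def AmatN : Matrix (Fin 7) (Fin 7) ℕ :=
  !![0,0,1,1,3,0,0; 1,0,0,0,3,0,0; 0,1,0,0,3,0,0; 0,0,1,0,3,0,0;
     0,0,0,0,0,0,1; 1,1,1,1,10,0,0; 1,1,1,1,0,1,0]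

/-- The nonnegative matrix `B`, as a matrix over `ℕ`. -/
def BmatN : Matrix (Fin 7) (Fin 7) ℕ :=
  !![0,0,1,1,3,0,0; 1,0,0,0,0,0,0; 0,1,0,0,0,0,0; 0,0,1,0,0,0,0;
     0,0,0,0,0,0,1; 4,5,6,3,10,0,0; 4,5,6,3,0,1,0]

section

/-- The binomial coefficient `x choose 2` modulo two. -/
def binomTwo (x : ℤ) : ZMod 2 := ((x * (x - 1) / 2 : ℤ) : ZMod 2)

/-- The Kim–Roush sign-gyration number `sgc₂` of a pair of integer matrices. -/
def signGyration {m n : ℕ} (R : Matrix (Fin m) (Fin n) ℤ) (S : Matrix (Fin n) (Fin m) ℤ) :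
    ZMod 2 :=
  ∑ i, ∑ j, ∑ k, ∑ l,
    ((if i < j ∧ l < k then (R i k : ZMod 2) * S k i * (R j l * S l j) else 0) +
      (if i < j ∧ l ≤ k then (R i k : ZMod 2) * S k j * (R j l * S l i) else 0)) +
  ∑ i, ∑ k, binomTwo (R i k) * S k i

theorem ZMod.two_mul_self (x : ZMod 2) : x * x = x := by
  revert x; decide

theorem ZMod.two_add_self (x : ZMod 2) : x + x = 0 := by
  revert x; decide

theorem two_mul_choose_two (x : ℤ) : 2 * (x * (x - 1) / 2) = x * (x - 1) :=
  Int.mul_ediv_cancel' (Int.even_mul_pred_self x).two_dvd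

theorem binomTwo_zero : binomTwo 0 = 0 := by simp [binomTwo]

theorem binomTwo_one : binomTwo 1 = 0 := by simp [binomTwo]

theorem binomTwo_add (x y : ℤ) : binomTwo (x + y) = binomTwo x + binomTwo y + x * y := by
  have h : (x + y) * (x + y - 1) / 2 = x * (x - 1) / 2 + y * (y - 1) / 2 + x * y := by
    have h1 := two_mul_choose_two x
    have h2 := two_mul_choose_two y
    have h3 := two_mul_choose_two (x + y)
    linarith
  simp [binomTwo, h]

theorem binomTwo_mul (x y : ℤ) : binomTwo (x * y) = binomTwo x * y + x * binomTwo y := by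
  have h : (x * y) * (x * y - 1) / 2 = x * (x - 1) / 2 * (y * y) + x * (y * (y - 1) / 2) := by
    have h1 := two_mul_choose_two x
    have h2 := two_mul_choose_two y
    have h3 := two_mul_choose_two (x * y)
    refine mul_left_cancel₀ (two_ne_zero (α := ℤ)) ?_
    linear_combination h3 - y * y * h1 - x * h2
  simp [binomTwo, h, ZMod.two_mul_self]

theorem binomTwo_sum {n : ℕ} (x : Fin n → ℤ) :
    binomTwo (∑ i, x i) =
      ∑ i, binomTwo (x i) + ∑ i, ∑ j, if i < j then (x i : ZMod 2) * x j else 0 := by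
  induction n with
  | zero => simp [binomTwo_zero]
  | succ n ih =>
    simp only [Fin.sum_univ_castSucc, binomTwo_add, ih, Fin.castSucc_lt_castSucc_iff,
      Fin.castSucc_lt_last, if_true, lt_irrefl, if_false, Fin.not_lt.mpr (Fin.le_last _),
      Finset.sum_add_distrib, Finset.sum_const_zero, Int.cast_sum, Finset.sum_mul]
    ring

section Cocycle

variable {a b c : ℕ} (p : Fin a → Fin b → ZMod 2) (q : Fin b → Fin c → ZMod 2)
  (w : Fin c → Fin a → ZMod 2)

/-- The difference of the three orderings of the pairs of closed walks `i → m → k → i`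
and `j → n → l → j`. -/
def cyclicDefect (z : (Fin a × Fin b × Fin c) × Fin a × Fin b × Fin c) : ZMod 2 :=
  match z with
  | ((i, m, k), (j, n, l)) =>
    (if i < j ∧ l < k then p i m * q m k * w k i * (p j n * q n l * w l j) else 0) +
    (if i < j ∧ l ≤ k then p i m * q m k * w k j * (p j n * q n l * w l i) else 0) +
    ((if i < j ∧ n < m then p i m * q m k * w k i * (p j n * q n l * w l j) else 0) +
    (if i < j ∧ n ≤ m then p i m * q m k * w k j * (p j n * q n l * w l i) else 0)) +
    ((if m < n ∧ l < k then p i m * q m k * w k i * (p j n * q n l * w l j) else 0) +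
    (if m < n ∧ l ≤ k then p i m * q m k * w k j * (p j n * q n l * w l i) else 0)) +
    (if i = j ∧ k = l ∧ m < n then p i m * q m k * w k j * (p j n * q n l * w l i) else 0)

theorem sum_cyclicDefect : ∑ z, cyclicDefect p q w z = 0 := by
  refine Finset.sum_involution
    (fun z _ => if z.1.2.1 = z.2.2.1 then
      ((z.1.1, z.1.2.1, z.2.2.2), (z.2.1, z.2.2.1, z.1.2.2)) else (z.2, z.1)) ?_ ?_ ?_ ?_
  · rintro ⟨⟨i, m, k⟩, ⟨j, n, l⟩⟩ -
    have h2 : (2 : ZMod 2) = 0 := rfl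
    have h4 : (4 : ZMod 2) = 0 := rfl
    rcases eq_or_ne m n with rfl | hmn
    · simp only [cyclicDefect, if_true, lt_irrefl, le_refl, false_and, and_false, and_true, if_false]
      rcases lt_or_ge i j with h | h
      · rcases lt_trichotomy k l with h' | rfl | h'
        · simp only [h, h', h'.le, h'.not_gt, h'.not_ge, and_true, and_false, if_true, if_false]
          ring_nf; simp [h2]
        · simp only [h, lt_irrefl, le_refl, and_true, and_false, if_true, if_false]
          ring_nf; simp [h4]
        · simp only [h, h', h'.le, h'.not_gt, h'.not_ge, and_true, and_false, if_true, if_false]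
          ring_nf; simp [h2]
      · simp [h.not_gt]
    · simp only [hmn, if_false, cyclicDefect]
      rcases lt_trichotomy i j with h | rfl | h <;> rcases lt_trichotomy k l with h' | rfl | h' <;>
      rcases lt_or_gt_of_ne hmn with h'' | h'' <;>
      · try simp only [h, h.not_gt, h.ne, h.ne']
        try simp only [h', h'.le, h'.not_gt, h'.not_ge, h'.ne, h'.ne']
        simp only [h'', h''.le, h''.not_gt, h''.not_ge, lt_irrefl, le_refl, and_true, and_false,
          if_true, if_false]
        ring_nf
        try simp [h2, h4]
  · rintro ⟨⟨i, m, k⟩, ⟨j, n, l⟩⟩ - hz h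
    rcases eq_or_ne m n with rfl | hmn
    · simp only [if_true, Prod.mk.injEq, true_and] at h
      obtain ⟨rfl, -⟩ := h
      apply hz
      simp only [cyclicDefect, lt_irrefl, le_refl, and_false, and_true, if_false]
      simp [ZMod.two_add_self]
    · simp only [hmn, if_false, Prod.mk.injEq] at h
      exact h.2.2.1.elim
  · simp
  · rintro ⟨⟨i, m, k⟩, ⟨j, n, l⟩⟩ -
    rcases eq_or_ne m n with rfl | hmn
    · simp
    · simp [hmn, hmn.symm]

end Cocycle

end

section

theorem sum_sum_sum_eq_sum_prod {α β γ ζ M : Type*} [Fintype α] [Fintype β] [Fintype γ]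
    [Fintype ζ] [AddCommMonoid M] (e : α × α × β × β × γ × γ ≃ ζ) (g : ζ → M) :
    ∑ i, ∑ j, ∑ k, ∑ l, ∑ m, ∑ n, g (e (i, j, k, l, m, n)) = ∑ z, g z := by
  rw [← e.sum_comp]
  simp only [Fintype.sum_prod_type]

theorem sum_mul_mul_sum_mul {α β : Type*} [Fintype α] [Fintype β] (f : α → ZMod 2)
    (g : β → ZMod 2) (u v : ZMod 2) :
    (∑ m, f m) * u * ((∑ n, g n) * v) = ∑ m, ∑ n, f m * u * (g n * v) := by
  rw [Finset.sum_mul, Finset.sum_mul _ _ v, Finset.sum_mul_sum]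

theorem mul_sum_mul_mul_sum {α β : Type*} [Fintype α] [Fintype β] (f : α → ZMod 2)
    (g : β → ZMod 2) (u v : ZMod 2) :
    u * (∑ m, f m) * (v * ∑ n, g n) = ∑ m, ∑ n, u * f m * (v * g n) := by
  rw [Finset.mul_sum, Finset.mul_sum, Finset.sum_mul_sum]

/-- The Kim–Roush cocycle equation. -/
theorem signGyration_mul {a b c : ℕ} (P : Matrix (Fin a) (Fin b) ℤ) (Q : Matrix (Fin b) (Fin c) ℤ)
    (W : Matrix (Fin c) (Fin a) ℤ) :
    signGyration (P * Q) W = signGyration P (Q * W) + signGyration Q (W * P) := by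
  let p : Fin a → Fin b → ZMod 2 := fun i m => (P i m : ZMod 2)
  let q : Fin b → Fin c → ZMod 2 := fun i m => (Q i m : ZMod 2)
  let w : Fin c → Fin a → ZMod 2 := fun i m => (W i m : ZMod 2)
  let x : (Fin a × Fin b × Fin c) × Fin a × Fin b × Fin c → ZMod 2 := fun z => match z with
    | ((i, m, k), (j, n, l)) => p i m * q m k * w k i * (p j n * q n l * w l j)
  let y : (Fin a × Fin b × Fin c) × Fin a × Fin b × Fin c → ZMod 2 := fun z => match z with
    | ((i, m, k), (j, n, l)) => p i m * q m k * w k j * (p j n * q n l * w l i)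
  let g₁ : (Fin a × Fin b × Fin c) × Fin a × Fin b × Fin c → ZMod 2 := fun z =>
    (if z.1.1 < z.2.1 ∧ z.2.2.2 < z.1.2.2 then x z else 0) +
    (if z.1.1 < z.2.1 ∧ z.2.2.2 ≤ z.1.2.2 then y z else 0)
  let g₂ : (Fin a × Fin b × Fin c) × Fin a × Fin b × Fin c → ZMod 2 := fun z =>
    (if z.1.1 < z.2.1 ∧ z.2.2.1 < z.1.2.1 then x z else 0) +
    (if z.1.1 < z.2.1 ∧ z.2.2.1 ≤ z.1.2.1 then y z else 0)
  let g₃ : (Fin a × Fin b × Fin c) × Fin a × Fin b × Fin c → ZMod 2 := fun z =>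
    (if z.1.2.1 < z.2.2.1 ∧ z.2.2.2 < z.1.2.2 then x z else 0) +
    (if z.1.2.1 < z.2.2.1 ∧ z.2.2.2 ≤ z.1.2.2 then y z else 0)
  let g₄ : (Fin a × Fin b × Fin c) × Fin a × Fin b × Fin c → ZMod 2 := fun z =>
    if z.1.1 = z.2.1 ∧ z.1.2.2 = z.2.2.2 ∧ z.1.2.1 < z.2.2.1 then y z else 0
  have hsum : ∑ z, g₁ z + ∑ z, g₂ z + ∑ z, g₃ z + ∑ z, g₄ z = 0 := by
    rw [← Finset.sum_add_distrib, ← Finset.sum_add_distrib, ← Finset.sum_add_distrib]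
    exact sum_cyclicDefect p q w
  have h₁ : ∑ i, ∑ j, ∑ k, ∑ l,
    ((if i < j ∧ l < k then ((P * Q) i k : ZMod 2) * W k i * ((P * Q) j l * W l j) else 0) +
      (if i < j ∧ l ≤ k then ((P * Q) i k : ZMod 2) * W k j * ((P * Q) j l * W l i) else 0)) =
      ∑ z, g₁ z := by
    let e : Fin a × Fin a × Fin c × Fin c × Fin b × Fin b ≃
        (Fin a × Fin b × Fin c) × Fin a × Fin b × Fin c :=
      ⟨fun t => ((t.1, t.2.2.2.2.1, t.2.2.1), (t.2.1, t.2.2.2.2.2, t.2.2.2.1)),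
       fun z => (z.1.1, z.2.1, z.1.2.2, z.2.2.2, z.1.2.1, z.2.2.1), fun _ => rfl, fun _ => rfl⟩
    rw [← sum_sum_sum_eq_sum_prod e g₁]
    refine Fintype.sum_congr _ _ fun i => Fintype.sum_congr _ _ fun j => Fintype.sum_congr _ _
      fun k => Fintype.sum_congr _ _ fun l => ?_
    simp only [g₁, e, Equiv.coe_fn_mk, x, y, Finset.sum_add_distrib, Finset.sum_ite_irrel,
      Finset.sum_const_zero, Matrix.mul_apply, Int.cast_sum, Int.cast_mul,
      sum_mul_mul_sum_mul, p, q, w]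
  have h₂ : ∑ i, ∑ j, ∑ k, ∑ l,
    ((if i < j ∧ l < k then (P i k : ZMod 2) * (Q * W) k i * (P j l * (Q * W) l j) else 0) +
      (if i < j ∧ l ≤ k then (P i k : ZMod 2) * (Q * W) k j * (P j l * (Q * W) l i) else 0)) =
      ∑ z, g₂ z := by
    let e : Fin a × Fin a × Fin b × Fin b × Fin c × Fin c ≃
        (Fin a × Fin b × Fin c) × Fin a × Fin b × Fin c :=
      ⟨fun t => ((t.1, t.2.2.1, t.2.2.2.2.1), (t.2.1, t.2.2.2.1, t.2.2.2.2.2)),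
       fun z => (z.1.1, z.2.1, z.1.2.1, z.2.2.1, z.1.2.2, z.2.2.2), fun _ => rfl, fun _ => rfl⟩
    rw [← sum_sum_sum_eq_sum_prod e g₂]
    refine Fintype.sum_congr _ _ fun i => Fintype.sum_congr _ _ fun j => Fintype.sum_congr _ _
      fun k => Fintype.sum_congr _ _ fun l => ?_
    simp only [g₂, e, Equiv.coe_fn_mk, x, y, Finset.sum_add_distrib, Finset.sum_ite_irrel,
      Finset.sum_const_zero, Matrix.mul_apply, Int.cast_sum, Int.cast_mul,
      mul_sum_mul_mul_sum, p, q, w]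
    simp only [mul_assoc]

  have h₃ : ∑ i, ∑ j, ∑ k, ∑ l,
    ((if i < j ∧ l < k then (Q i k : ZMod 2) * (W * P) k i * (Q j l * (W * P) l j) else 0) +
      (if i < j ∧ l ≤ k then (Q i k : ZMod 2) * (W * P) k j * (Q j l * (W * P) l i) else 0)) =
      ∑ z, g₃ z := by
    let e : Fin b × Fin b × Fin c × Fin c × Fin a × Fin a ≃
        (Fin a × Fin b × Fin c) × Fin a × Fin b × Fin c :=
      ⟨fun t => ((t.2.2.2.2.1, t.1, t.2.2.1), (t.2.2.2.2.2, t.2.1, t.2.2.2.1)),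
       fun z => (z.1.2.1, z.2.2.1, z.1.2.2, z.2.2.2, z.1.1, z.2.1), fun _ => rfl, fun _ => rfl⟩
    rw [← sum_sum_sum_eq_sum_prod e g₃]
    refine Fintype.sum_congr _ _ fun i => Fintype.sum_congr _ _ fun j => Fintype.sum_congr _ _
      fun k => Fintype.sum_congr _ _ fun l => ?_
    simp only [g₃, e, Equiv.coe_fn_mk, x, y, Finset.sum_add_distrib, Finset.sum_ite_irrel,
      Finset.sum_const_zero, Matrix.mul_apply, Int.cast_sum, Int.cast_mul,
      mul_sum_mul_mul_sum, p, q, w]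
    congr 1 <;> split_ifs
    · exact Fintype.sum_congr _ _ fun _ => Fintype.sum_congr _ _ fun _ => by ring
    · rfl
    · rw [Finset.sum_comm]
      exact Fintype.sum_congr _ _ fun _ => Fintype.sum_congr _ _ fun _ => by ring
    · rfl

  have h₄ : ∑ i, ∑ k, (binomTwo ((P * Q) i k) : ZMod 2) * W k i =
      ∑ z, g₄ z + ∑ i, ∑ k, binomTwo (P i k) * ((Q * W) k i : ZMod 2) +
        ∑ i, ∑ k, binomTwo (Q i k) * ((W * P) k i : ZMod 2) := by
    have hg : ∑ z, g₄ z = ∑ i, ∑ k, ∑ m, ∑ n,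
        if m < n then p i m * q m k * (p i n * q n k) * w k i else 0 := by
      simp only [Fintype.sum_prod_type, g₄, y]
      refine Fintype.sum_congr _ _ fun i => ?_
      rw [Finset.sum_comm]
      refine Fintype.sum_congr _ _ fun k => Fintype.sum_congr _ _ fun m => ?_
      rw [Finset.sum_eq_single i (fun j _ hj => by simp [hj.symm]) (by simp)]
      refine Fintype.sum_congr _ _ fun n => ?_
      rw [Finset.sum_eq_single k (fun j _ hj => by simp [hj.symm]) (by simp)]
      simp only [true_and]
      split_ifs
      · linear_combination p i m * q m k * (p i n * q n k) * ZMod.two_mul_self (w k i)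
      · rfl
    have hp : ∑ i, ∑ k, binomTwo (P i k) * ((Q * W) k i : ZMod 2) =
        ∑ i, ∑ k, ∑ m, binomTwo (P i m) * (q m k * w k i) := by
      refine Fintype.sum_congr _ _ fun i => ?_
      rw [Finset.sum_comm]
      simp only [Matrix.mul_apply, Int.cast_sum, Int.cast_mul, Finset.mul_sum, q, w]
    have hq : ∑ i, ∑ k, binomTwo (Q i k) * ((W * P) k i : ZMod 2) =
        ∑ i, ∑ k, ∑ m, binomTwo (Q m k) * (w k i * p i m) := by
      simp only [Matrix.mul_apply, Int.cast_sum, Int.cast_mul, Finset.mul_sum, p, w]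
      rw [Finset.sum_congr rfl fun m _ => Finset.sum_comm, Finset.sum_comm]
      exact Fintype.sum_congr _ _ fun i => Finset.sum_comm
    rw [hg, hp, hq]
    simp only [← Finset.sum_add_distrib]
    refine Fintype.sum_congr _ _ fun i => Fintype.sum_congr _ _ fun k => ?_
    simp only [Matrix.mul_apply, binomTwo_sum, binomTwo_mul, Int.cast_mul, Finset.sum_add_distrib,
      add_mul, Finset.sum_mul, ite_mul, zero_mul, p, q, w]
    have h1 : ∀ m, binomTwo (P i m) * (Q m k : ZMod 2) * (W k i : ZMod 2) =
      binomTwo (P i m) * ((Q m k : ZMod 2) * (W k i : ZMod 2)) := fun m => by ring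
    have h2 : ∀ m, (P i m : ZMod 2) * binomTwo (Q m k) * (W k i : ZMod 2) =
      binomTwo (Q m k) * ((W k i : ZMod 2) * (P i m : ZMod 2)) := fun m => by ring
    simp only [h1, h2]
    ring
  simp only [signGyration]
  rw [h₁, h₂, h₃, h₄]
  have h := ZMod.two_add_self (∑ z, g₂ z + ∑ z, g₃ z)
  linear_combination hsum - h

end

section

theorem signGyration_one_left {n : ℕ} (C : Matrix (Fin n) (Fin n) ℤ) : signGyration 1 C = 0 := by
  have h0 : ∀ i k, binomTwo ((1 : Matrix (Fin n) (Fin n) ℤ) i k) = 0 := fun i k => by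
    rcases eq_or_ne i k with rfl | h
    · rw [Matrix.one_apply_eq, binomTwo_one]
    · rw [Matrix.one_apply_ne h, binomTwo_zero]
  have h1 : ∀ i j k l : Fin n, i < j → l ≤ k →
      (1 : Matrix (Fin n) (Fin n) ℤ) i k = 0 ∨ (1 : Matrix (Fin n) (Fin n) ℤ) j l = 0 := by
    intro i j k l hij hlk
    by_contra! h
    rcases eq_or_ne i k with rfl | hk
    · rcases eq_or_ne j l with rfl | hl
      · exact absurd hij (not_lt.mpr hlk)
      · exact h.2 (Matrix.one_apply_ne hl)
    · exact h.1 (Matrix.one_apply_ne hk)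
  simp only [signGyration, h0, zero_mul, Finset.sum_const_zero, add_zero]
  refine Finset.sum_eq_zero fun i _ => Finset.sum_eq_zero fun j _ => Finset.sum_eq_zero fun k _ =>
    Finset.sum_eq_zero fun l _ => ?_
  by_cases h : i < j ∧ l ≤ k
  · rcases h1 i j k l h.1 h.2 with h2 | h2 <;> simp [h2]
  · rw [if_neg h, if_neg fun h' => h ⟨h'.1, h'.2.le⟩, add_zero]

theorem signGyration_eq_zero_of_levels {c m n : ℕ} (P : Matrix (Fin (c + m)) (Fin (c + n)) ℤ)
    (Q : Matrix (Fin (c + n)) (Fin (c + m)) ℤ) (a : Fin m → ℕ) (b : Fin n → ℕ)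
    (h₁ : ∀ i k, P (Fin.castAdd m i) (Fin.castAdd n k) = if i = k then 1 else 0)
    (h₂ : ∀ i k, P (Fin.castAdd m i) (Fin.natAdd c k) = 0)
    (h₃ : ∀ i k, P (Fin.natAdd c i) (Fin.castAdd n k) = 0)
    (h₄ : ∀ i k, P (Fin.natAdd c i) (Fin.natAdd c k) ≠ 0 → a i ≤ b k)
    (h₅ : ∀ k i, Q (Fin.castAdd n k) (Fin.natAdd c i) = 0)
    (h₆ : ∀ k i, Q (Fin.natAdd c k) (Fin.castAdd m i) = 0)
    (h₇ : ∀ k i, Q (Fin.natAdd c k) (Fin.natAdd c i) ≠ 0 → b k < a i) :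
    signGyration P Q = 0 := by
  have hb : ∀ i k, binomTwo (P i k) * Q k i = 0 := by
    refine Fin.addCases (fun i => Fin.addCases (fun k => ?_) fun k => ?_)
      fun i => Fin.addCases (fun k => ?_) fun k => ?_
    · rw [h₁]; split_ifs <;> simp [binomTwo_zero, binomTwo_one]
    · simp [h₂, binomTwo_zero]
    · simp [h₃, binomTwo_zero]
    · by_cases hP : P (Fin.natAdd c i) (Fin.natAdd c k) = 0
      · simp [hP, binomTwo_zero]
      · by_cases hQ : Q (Fin.natAdd c k) (Fin.natAdd c i) = 0
        · simp [hQ]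
        · exact absurd ((h₄ i k hP).trans_lt (h₇ k i hQ)) (lt_irrefl _)
  have hx : ∀ i j k l, i < j → l < k → P i k * Q k i * (P j l * Q l j) = 0 := by
    intro i j k l hij hlk
    by_contra h
    simp only [mul_eq_zero, not_or] at h
    obtain ⟨⟨h1, h2⟩, h3, h4⟩ := h
    have key : ∀ i k, P i k ≠ 0 → Q k i ≠ 0 → (i : ℕ) = k := by
      refine Fin.addCases (fun i => Fin.addCases (fun k => ?_) fun k => ?_)
        fun i => Fin.addCases (fun k => ?_) fun k => ?_
      · rw [h₁]; intro h _; split_ifs at h with h5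
        · simp [h5]
        · simp at h
      · simp [h₂]
      · simp [h₃]
      · intro hP hQ
        exact absurd ((h₄ i k hP).trans_lt (h₇ k i hQ)) (lt_irrefl _)
    have e1 := key i k h1 h2
    have e2 := key j l h3 h4
    rw [Fin.lt_def] at hij hlk
    omega
  have hy : ∀ i j k l, i < j → l ≤ k → P i k * Q k j * (P j l * Q l i) = 0 := by
    intro i j k l hij hlk
    by_contra h
    simp only [mul_eq_zero, not_or] at h
    obtain ⟨⟨h1, h2⟩, h3, h4⟩ := h
    rw [Fin.lt_def] at hij
    rw [Fin.le_def] at hlk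
    have key : (∀ i k, P i k ≠ 0 → ∀ j, Q k j ≠ 0 →
        ((i : ℕ) = k ∧ (i : ℕ) < c ∧ (j : ℕ) < c) ∨
        ∃ i' j', i = Fin.natAdd c i' ∧ j = Fin.natAdd c j' ∧ a i' < a j') := by
      refine Fin.addCases (fun i => Fin.addCases (fun k => ?_) fun k => ?_)
        fun i => Fin.addCases (fun k => ?_) fun k => ?_
      · rw [h₁]; intro h; split_ifs at h with h5
        · refine Fin.addCases (fun j => ?_) fun j => ?_
          · exact fun _ => Or.inl ⟨by simp [h5], by simp, by simp⟩
          · simp [h₅]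
        · simp at h
      · simp [h₂]
      · simp [h₃]
      · intro h
        refine Fin.addCases (fun j => ?_) fun j => ?_
        · simp [h₆]
        · exact fun hQ => Or.inr ⟨i, j, rfl, rfl, (h₄ i k h).trans_lt (h₇ k j hQ)⟩
    rcases key i k h1 j h2 with ⟨e1, e2, e3⟩ | ⟨i', j', e1, e2, e3⟩ <;>
    rcases key j l h3 i h4 with ⟨e4, e5, e6⟩ | ⟨i'', j'', e4, e5, e6⟩
    · omega
    · simp [e4] at e3
    · simp [e2] at e5
    · rw [e2, Fin.natAdd_inj] at e4
      rw [e1, Fin.natAdd_inj] at e5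
      subst e4 e5
      omega
  have hcast : ∀ x y z w : ℤ, x * y * (z * w) = 0 → (x : ZMod 2) * y * (z * w) = 0 := by
    intro x y z w h
    exact_mod_cast congrArg (Int.cast : ℤ → ZMod 2) h
  simp only [signGyration, hb, Finset.sum_const_zero, add_zero]
  refine Finset.sum_eq_zero fun i _ => Finset.sum_eq_zero fun j _ => Finset.sum_eq_zero fun k _ =>
    Finset.sum_eq_zero fun l _ => ?_
  split_ifs with h h' h'
  · rw [hcast _ _ _ _ (hx i j k l h.1 h.2), hcast _ _ _ _ (hy i j k l h'.1 h'.2), add_zero]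
  · rw [hcast _ _ _ _ (hx i j k l h.1 h.2), add_zero]
  · rw [hcast _ _ _ _ (hy i j k l h'.1 h'.2), add_zero]
  · rw [add_zero]

/-- Nonnegative matrices without closed walks of length one or two have trivial
sign-gyration number. -/
theorem signGyration_natCast_eq_zero {m n : ℕ} (R : Matrix (Fin m) (Fin n) ℕ)
    (S : Matrix (Fin n) (Fin m) ℕ) (h₁ : (R * S).trace = 0) (h₂ : (R * S * (R * S)).trace = 0) :
    signGyration (R.map (Nat.cast : ℕ → ℤ)) (S.map (Nat.cast : ℕ → ℤ)) = 0 := by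
  have hx : ∀ i k, R i k * S k i = 0 := by
    simp only [Matrix.trace, Matrix.diag_apply, Matrix.mul_apply, Finset.sum_eq_zero_iff,
      Finset.mem_univ, true_imp_iff] at h₁
    exact h₁
  have hy : ∀ i j k l, R i k * S k j * (R j l * S l i) = 0 := by
    intro i j k l
    simp only [Matrix.trace, Matrix.diag_apply, Matrix.mul_apply, Finset.sum_eq_zero_iff,
      Finset.mem_univ, true_imp_iff, mul_eq_zero] at h₂
    rw [mul_eq_zero]
    exact (h₂ i j).imp (fun h => by simpa using h k) (fun h => by simpa using h l)
  have hcx : ∀ i k, ((R.map (Nat.cast : ℕ → ℤ) i k : ℤ) : ZMod 2) *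
      (S.map (Nat.cast : ℕ → ℤ) k i : ℤ) = 0 := fun i k => by
    simpa using congrArg (Nat.cast : ℕ → ZMod 2) (hx i k)
  have hcy : ∀ i j k l, ((R.map (Nat.cast : ℕ → ℤ) i k : ℤ) : ZMod 2) *
      (S.map (Nat.cast : ℕ → ℤ) k j : ℤ) * ((R.map (Nat.cast : ℕ → ℤ) j l : ℤ) *
      (S.map (Nat.cast : ℕ → ℤ) l i : ℤ)) = 0 := fun i j k l => by
    have := congrArg (Nat.cast : ℕ → ZMod 2) (hy i j k l)
    rw [Matrix.map_apply, Matrix.map_apply, Matrix.map_apply, Matrix.map_apply]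
    exact_mod_cast this
  have hb : ∀ i k, binomTwo (R.map (Nat.cast : ℕ → ℤ) i k) *
      (S.map (Nat.cast : ℕ → ℤ) k i : ℤ) = 0 := fun i k => by
    rcases mul_eq_zero.mp (hx i k) with h | h <;> simp [h, binomTwo_zero]
  simp only [signGyration, hcx, hcy, hb, zero_mul, ite_self, add_zero, Finset.sum_const_zero]

end

section

open Module in
/-- A finite chain of saturated submodules of a lattice admits an adapted basis. -/
theorem exists_basis_of_flag {M : Type*} [AddCommGroup M] [Module.Free ℤ M] [Module.Finite ℤ M]
    (n : ℕ) (H : ℕ → Submodule ℤ M) (hmono : Monotone H) (h0 : H 0 = ⊥) (hn : H n = ⊤)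
    (hsat : ∀ i (c : ℤ) x, c ≠ 0 → c • x ∈ H i → x ∈ H i) :
    ∃ (d : ℕ) (b : Basis (Fin d) ℤ M) (lev : Fin d → ℕ), (∀ k, lev k ≤ n) ∧
      (∀ k, b k ∈ H (lev k)) ∧ ∀ j x, x ∈ H j → ∀ k, j < lev k → b.repr x k = 0 := by
  induction n generalizing M with
  | zero =>
    have : Subsingleton M := (Submodule.subsingleton_iff ℤ).mp
      (subsingleton_of_bot_eq_top (h0.symm.trans hn))
    exact ⟨0, Basis.empty M, Fin.elim0, fun k => k.elim0, fun k => k.elim0, fun _ _ _ k => k.elim0⟩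
  | succ n ih =>
    obtain ⟨d, b, lev, hlev, hb, hrepr⟩ := ih (M := H n) (fun i => (H i).comap (H n).subtype)
      (fun i j hij => Submodule.comap_mono (hmono hij))
      (by simp [h0]) (by simp) (fun i c x hc hx => hsat i c x hc (by simpa using hx))
    have : IsTorsionFree ℤ (M ⧸ H n) := by
      refine IsTorsionFree.of_smul_eq_zero fun c x hcx => ?_
      induction x using Submodule.Quotient.induction_on with | _ x => ?_
      by_contra! h
      refine h.2 ?_
      rw [Submodule.Quotient.mk_eq_zero]
      refine hsat n c x h.1 ?_
      rwa [← Submodule.Quotient.mk_smul, Submodule.Quotient.mk_eq_zero] at hcx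
    let e := finBasis ℤ (M ⧸ H n)
    let B := b.sumQuot e
    let l : Fin d ⊕ Fin (finrank ℤ (M ⧸ H n)) → ℕ := Sum.elim lev fun _ => n + 1
    refine ⟨_, B.reindex finSumFinEquiv, l ∘ finSumFinEquiv.symm, fun k => ?_, fun k => ?_,
      fun j x hx k hk => ?_⟩
    · obtain ⟨k, rfl⟩ := finSumFinEquiv.surjective k
      rcases k with k | k
      · simpa [l] using (hlev k).trans n.le_succ
      · simp [l]
    · obtain ⟨k, rfl⟩ := finSumFinEquiv.surjective k
      rcases k with k | k
      · have := hb k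
        simp_all [l, B]
      · simp [l, hn]
    · obtain ⟨k, rfl⟩ := finSumFinEquiv.surjective k
      have hj : j ≤ n := by
        rcases k with k | k
        · have := hlev k
          simp [l] at hk
          omega
        · simp [l] at hk
          omega
      rcases k with k | k
      · rw [Basis.repr_reindex_apply, Equiv.symm_apply_apply, Basis.sumQuot_repr_inl_of_mem _ _ _ (hmono hj hx)]
        exact hrepr j _ hx k (by simpa [l] using hk)
      · rw [Basis.repr_reindex_apply, Equiv.symm_apply_apply, Basis.sumQuot_repr_inr_of_mem _ _ _ (hmono hj hx)]

end

section

open Matrix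

/-- A unimodular change of basis `W` splitting `B` into a summand equal to `A` and a summand with a
basis adapted to the kernels of the powers of `B`, the levels being those of the basis vectors. -/
structure IsFrame {c m d : ℕ} (A : Matrix (Fin c) (Fin c) ℤ) (B : Matrix (Fin m) (Fin m) ℤ)
    (W : Matrix (Fin m) (Fin (c + d)) ℤ) (W' : Matrix (Fin (c + d)) (Fin m) ℤ)
    (lev : Fin d → ℕ) : Prop where
  mul_inv : W * W' = 1
  inv_mul : W' * W = 1
  intertwine : B * W.submatrix id (Fin.castAdd d) = W.submatrix id (Fin.castAdd d) * A
  inv_intertwine : W'.submatrix (Fin.castAdd d) id * B = A * W'.submatrix (Fin.castAdd d) id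
  pow_mulVec_col : ∀ k, (B ^ lev k) *ᵥ W.col (Fin.natAdd c k) = 0
  inv_mulVec_eq_zero : ∀ j x, (B ^ j) *ᵥ x = 0 → ∀ k, j < lev k → (W' *ᵥ x) (Fin.natAdd c k) = 0

theorem mul_apply_eq_mulVec_col {l m n : ℕ} (M : Matrix (Fin l) (Fin m) ℤ)
    (N : Matrix (Fin m) (Fin n) ℤ) (i : Fin l) (j : Fin n) : (M * N) i j = (M *ᵥ N.col j) i := rfl

theorem mul_pow_mul_eq {m n : ℕ} (R : Matrix (Fin m) (Fin n) ℤ) (S : Matrix (Fin n) (Fin m) ℤ)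
    (j : ℕ) : R * (S * R) ^ j = (R * S) ^ j * R := by
  induction j with
  | zero => simp
  | succ j ih => rw [pow_succ, ← Matrix.mul_assoc, ih, pow_succ]; simp only [Matrix.mul_assoc]

/-- The chain of kernels of `1, R, C, R C, C², R C², …` for `C = S R`. -/
def kernelFlag {m n : ℕ} (R : Matrix (Fin m) (Fin n) ℤ) (C : Matrix (Fin n) (Fin n) ℤ) (t : ℕ) :
    Submodule ℤ (Fin n → ℤ) :=
  if Even t then LinearMap.ker (C ^ (t / 2)).mulVecLin
  else LinearMap.ker (R * C ^ (t / 2)).mulVecLin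

theorem mem_kernelFlag_two_mul {m n : ℕ} (R : Matrix (Fin m) (Fin n) ℤ)
    (C : Matrix (Fin n) (Fin n) ℤ) (j : ℕ) (x : Fin n → ℤ) :
    x ∈ kernelFlag R C (2 * j) ↔ (C ^ j) *ᵥ x = 0 := by
  simp [kernelFlag]

theorem mem_kernelFlag_two_mul_add_one {m n : ℕ} (R : Matrix (Fin m) (Fin n) ℤ)
    (C : Matrix (Fin n) (Fin n) ℤ) (j : ℕ) (x : Fin n → ℤ) :
    x ∈ kernelFlag R C (2 * j + 1) ↔ (R * C ^ j) *ᵥ x = 0 := by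
  have : (2 * j + 1) / 2 = j := by omega
  simp [kernelFlag, this]

theorem kernelFlag_mono {m n : ℕ} (R : Matrix (Fin m) (Fin n) ℤ) (S : Matrix (Fin n) (Fin m) ℤ) :
    Monotone (kernelFlag R (S * R)) := by
  refine monotone_nat_of_le_succ fun t x hx => ?_
  obtain ⟨j, rfl | rfl⟩ := t.even_or_odd'
  · rw [mem_kernelFlag_two_mul] at hx
    rw [mem_kernelFlag_two_mul_add_one, ← mulVec_mulVec, hx, mulVec_zero]
  · rw [mem_kernelFlag_two_mul_add_one] at hx
    rw [show 2 * j + 1 + 1 = 2 * (j + 1) by ring, mem_kernelFlag_two_mul, pow_succ',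
      Matrix.mul_assoc, ← mulVec_mulVec, hx, mulVec_zero]

theorem kernelFlag_saturated {m n : ℕ} (R : Matrix (Fin m) (Fin n) ℤ)
    (C : Matrix (Fin n) (Fin n) ℤ) (t : ℕ) (c : ℤ) (x : Fin n → ℤ) (hc : c ≠ 0)
    (h : c • x ∈ kernelFlag R C t) : x ∈ kernelFlag R C t := by
  obtain ⟨j, rfl | rfl⟩ := t.even_or_odd'
  · rw [mem_kernelFlag_two_mul, mulVec_smul] at h
    rw [mem_kernelFlag_two_mul]
    exact (smul_eq_zero.mp h).resolve_left hc
  · rw [mem_kernelFlag_two_mul_add_one, mulVec_smul] at h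
    rw [mem_kernelFlag_two_mul_add_one]
    exact (smul_eq_zero.mp h).resolve_left hc

/-- The complement of a split injection, with a basis adapted to the kernel flag. -/
theorem exists_adapted_complement {c m n : ℕ} (R : Matrix (Fin m) (Fin n) ℤ)
    (S : Matrix (Fin n) (Fin m) ℤ) (X : Matrix (Fin n) (Fin c) ℤ) (Y : Matrix (Fin c) (Fin n) ℤ)
    (hYX : Y * X = 1) (N : ℕ) (hN : ∀ x, Y *ᵥ x = 0 → ((S * R) ^ N) *ᵥ x = 0) :
    ∃ (d : ℕ) (U : Matrix (Fin n) (Fin d) ℤ) (V : Matrix (Fin d) (Fin n) ℤ) (h : Fin d → ℕ),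
      Y * U = 0 ∧ V * X = 0 ∧ V * U = 1 ∧ X * Y + U * V = 1 ∧
      (∀ k, U.col k ∈ kernelFlag R (S * R) (h k)) ∧
      ∀ t x, Y *ᵥ x = 0 → x ∈ kernelFlag R (S * R) t → ∀ k, t < h k → (V *ᵥ x) k = 0 := by
  let E : Submodule ℤ (Fin n → ℤ) := LinearMap.ker Y.mulVecLin
  have hE : ∀ x, x ∈ E ↔ Y *ᵥ x = 0 := fun x => by simp [E]
  obtain ⟨d, b, h, -, hb, hrepr⟩ := exists_basis_of_flag (M := E) (2 * N)
    (fun t => (kernelFlag R (S * R) t).comap E.subtype)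
    (fun i j hij => Submodule.comap_mono (kernelFlag_mono R S hij))
    (by
      rw [eq_bot_iff]
      intro x hx
      have : (x : Fin n → ℤ) ∈ kernelFlag R (S * R) (2 * 0) := hx
      rw [mem_kernelFlag_two_mul, pow_zero, one_mulVec] at this
      simpa using this)
    (by
      rw [eq_top_iff]
      intro x _
      change (x : Fin n → ℤ) ∈ kernelFlag R (S * R) (2 * N)
      rw [mem_kernelFlag_two_mul]
      exact hN x ((hE x).mp x.2))
    (fun i c x hc hx => kernelFlag_saturated R _ i c x hc hx)
  let proj : (Fin n → ℤ) →ₗ[ℤ] E :=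
    LinearMap.codRestrict E (1 - X * Y).mulVecLin (fun x => by
      rw [hE, mulVecLin_apply, mulVec_mulVec, Matrix.mul_sub, ← Matrix.mul_assoc, hYX,
        Matrix.one_mul, Matrix.mul_one, sub_self, zero_mulVec])
  have hproj : ∀ x (hx : x ∈ E), proj x = ⟨x, hx⟩ := fun x hx => by
    ext1
    change (1 - X * Y) *ᵥ x = x
    rw [sub_mulVec, one_mulVec, ← mulVec_mulVec, (hE x).mp hx, mulVec_zero, sub_zero]
  let V : Matrix (Fin d) (Fin n) ℤ := LinearMap.toMatrix' (b.equivFun.toLinearMap ∘ₗ proj)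
  have hV : ∀ x, V *ᵥ x = b.equivFun (proj x) := fun x => by
    rw [LinearMap.toMatrix'_mulVec]; rfl
  refine ⟨d, Matrix.of fun i k => (b k : Fin n → ℤ) i, V, h, ?_, ?_, ?_, ?_, hb, ?_⟩
  · ext i k
    exact congrFun ((hE _).mp (b k).2) i
  · ext k i
    rw [mul_apply_eq_mulVec_col, hV]
    have : proj (X.col i) = 0 := by
      ext1
      change (1 - X * Y) *ᵥ X.col i = 0
      ext r
      rw [← mul_apply_eq_mulVec_col, Matrix.sub_mul, Matrix.mul_assoc, hYX]
      simp
    simp [this]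
  · ext k l
    rw [mul_apply_eq_mulVec_col, hV]
    have : proj ((Matrix.of fun i k => (b k : Fin n → ℤ) i).col l) = b l := hproj _ (b l).2
    rw [this]
    simp [Matrix.one_apply, eq_comm]
  · have : ∀ x, (X * Y + (Matrix.of fun i k => (b k : Fin n → ℤ) i) * V) *ᵥ x = x := by
      intro x
      have h1 := congrArg Subtype.val (b.sum_equivFun (proj x))
      rw [add_mulVec, ← mulVec_mulVec (M := Matrix.of _), hV]
      have h2 : (Matrix.of fun i k => (b k : Fin n → ℤ) i) *ᵥ b.equivFun (proj x) =
          (1 - X * Y) *ᵥ x := by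
        refine Eq.trans ?_ h1
        ext i
        rw [AddSubmonoidClass.coe_finsetSum, Finset.sum_apply]
        simp only [mulVec, dotProduct]
        exact Finset.sum_congr rfl fun k _ => mul_comm ((b k : Fin n → ℤ) i) _
      rw [h2, sub_mulVec, one_mulVec, add_sub_cancel]
    ext i j
    have := congrFun (this (Pi.single j 1)) i
    rwa [mulVec_single_one, ← Matrix.one_mulVec (Pi.single j (1 : ℤ)), mulVec_single_one] at this
  · intro t x hx hxt k hk
    rw [hV, hproj x ((hE x).mpr hx)]
    exact hrepr t _ hxt k hk

end

section

open Matrix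

theorem one_apply_castAdd {m n : ℕ} (i j : Fin m) :
    (1 : Matrix (Fin (m + n)) (Fin (m + n)) ℤ) (Fin.castAdd n i) (Fin.castAdd n j) =
      (1 : Matrix (Fin m) (Fin m) ℤ) i j := by
  simp [one_apply]

theorem one_apply_natAdd {m n : ℕ} (i j : Fin n) :
    (1 : Matrix (Fin (m + n)) (Fin (m + n)) ℤ) (Fin.natAdd m i) (Fin.natAdd m j) =
      (1 : Matrix (Fin n) (Fin n) ℤ) i j := by
  simp [one_apply]

theorem one_apply_castAdd_natAdd {m n : ℕ} (i : Fin m) (j : Fin n) :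
    (1 : Matrix (Fin (m + n)) (Fin (m + n)) ℤ) (Fin.castAdd n i) (Fin.natAdd m j) = 0 :=
  one_apply_ne (by simp [Fin.ext_iff]; omega)

theorem one_apply_natAdd_castAdd {m n : ℕ} (i : Fin n) (j : Fin m) :
    (1 : Matrix (Fin (m + n)) (Fin (m + n)) ℤ) (Fin.natAdd m i) (Fin.castAdd n j) = 0 :=
  one_apply_ne (by simp [Fin.ext_iff]; omega)

theorem exists_joined_cols {c n e : ℕ} (X : Matrix (Fin n) (Fin c) ℤ)
    (U : Matrix (Fin n) (Fin e) ℤ) : ∃ W : Matrix (Fin n) (Fin (c + e)) ℤ,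
      (∀ i k, W i (Fin.castAdd e k) = X i k) ∧ ∀ i k, W i (Fin.natAdd c k) = U i k :=
  ⟨of fun i j => Fin.addCases (X i) (U i) j, by simp, by simp⟩

theorem exists_frame_of_elementary {c m n d : ℕ} {A A' : Matrix (Fin c) (Fin c) ℤ}
    (hA : A * A' = 1) (hA' : A' * A = 1) (R : Matrix (Fin m) (Fin n) ℤ)
    (S : Matrix (Fin n) (Fin m) ℤ) {W : Matrix (Fin m) (Fin (c + d)) ℤ}
    {W' : Matrix (Fin (c + d)) (Fin m) ℤ} {lev : Fin d → ℕ} (hW : IsFrame A (R * S) W W' lev) :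
    ∃ (e : ℕ) (W₂ : Matrix (Fin n) (Fin (c + e)) ℤ) (W₂' : Matrix (Fin (c + e)) (Fin n) ℤ)
      (lev₂ : Fin e → ℕ), IsFrame A (S * R) W₂ W₂' lev₂ ∧
        signGyration (W' * R * W₂) (W₂' * S * W) = 0 := by
  obtain ⟨hWW', hW'W, hX, hY, hF1, hF2⟩ := hW
  set X := W.submatrix id (Fin.castAdd d) with hXdef
  set Y := W'.submatrix (Fin.castAdd d) id with hYdef
  have hYX : Y * X = 1 := by
    ext i j
    exact (congrFun (congrFun hW'W (Fin.castAdd d i)) (Fin.castAdd d j)).trans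
      (one_apply_castAdd i j)
  have hYcol : ∀ k, Y *ᵥ W.col (Fin.natAdd c k) = 0 := fun k => by
    ext i
    exact (congrFun (congrFun hW'W (Fin.castAdd d i)) (Fin.natAdd c k)).trans
      (one_apply_castAdd_natAdd i k)
  have hcolX : ∀ k i, (W' *ᵥ X.col i) (Fin.natAdd c k) = 0 := fun k i =>
    (congrFun (congrFun hW'W (Fin.natAdd c k)) (Fin.castAdd d i)).trans
      (one_apply_natAdd_castAdd k i)
  have hYB : ∀ x, Y *ᵥ ((R * S) *ᵥ x) = A *ᵥ (Y *ᵥ x) := fun x => by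
    rw [mulVec_mulVec, hY, mulVec_mulVec]
  have hY₂pow : ∀ j, Y * R * (S * R) ^ j = A ^ j * (Y * R) := by
    intro j
    induction j with
    | zero => simp
    | succ j ih =>
      rw [pow_succ, ← Matrix.mul_assoc, ih, pow_succ]
      simp only [Matrix.mul_assoc]
      rw [← Matrix.mul_assoc R S R, ← Matrix.mul_assoc Y (R * S), hY, Matrix.mul_assoc]
  have hXA : (R * S) * X * A' = X := by rw [hX, Matrix.mul_assoc, hA, Matrix.mul_one]
  have hnil : ∀ y, Y *ᵥ y = 0 → ((R * S) ^ Finset.univ.sup lev) *ᵥ y = 0 := by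
    intro y hy
    rw [← one_mulVec y, ← hWW', ← mulVec_mulVec, mulVec_mulVec]
    ext i
    simp only [mulVec, dotProduct, Fin.sum_univ_add]
    refine (congrArg₂ _ (Finset.sum_eq_zero fun k _ => ?_)
      (Finset.sum_eq_zero fun k _ => ?_)).trans (add_zero 0)
    · rw [show ∑ j, W' (Fin.castAdd d k) j * y j = 0 from congrFun hy k, mul_zero]
    · obtain ⟨t, ht⟩ := Nat.exists_eq_add_of_le' (Finset.le_sup (f := lev) (Finset.mem_univ k))
      rw [mul_apply_eq_mulVec_col, ht, pow_add, ← mulVec_mulVec, hF1, mulVec_zero, Pi.zero_apply,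
        zero_mul]
  have hYX₂ : Y * R * (S * X * A') = 1 := calc
    Y * R * (S * X * A') = Y * ((R * S) * X * A') := by simp only [Matrix.mul_assoc]
    _ = 1 := by rw [hXA, hYX]
  obtain ⟨e, U, V, h, hYU, hVX, hVU, hXY, hU, hV⟩ := exists_adapted_complement R S
    (S * X * A') (Y * R) hYX₂ (Finset.univ.sup lev + 1) (by
      intro x hx
      rw [pow_succ, ← Matrix.mul_assoc, ← mul_pow_mul_eq S R, Matrix.mul_assoc,
        ← mulVec_mulVec, ← mulVec_mulVec, hnil _ (by rwa [mulVec_mulVec]), mulVec_zero])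
  obtain ⟨W₂, hW₂l, hW₂r⟩ := exists_joined_cols (S * X * A') U
  obtain ⟨T, hTl, hTr⟩ := exists_joined_cols (Y * R)ᵀ Vᵀ
  obtain ⟨W₂', rfl⟩ : ∃ W₂', T = W₂'ᵀ := ⟨Tᵀ, (transpose_transpose T).symm⟩
  simp only [transpose_apply] at hTl hTr
  have hcolX₂ : ∀ k, W₂.col (Fin.castAdd e k) = (S * X * A').col k := fun k =>
    funext fun i => hW₂l i k
  have hcolU : ∀ k, W₂.col (Fin.natAdd c k) = U.col k := fun k => funext fun i => hW₂r i k
  have hrowY : ∀ x k, (W₂' *ᵥ x) (Fin.castAdd e k) = ((Y * R) *ᵥ x) k := fun x k => by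
    simp only [mulVec, dotProduct, hTl]
  have hrowV : ∀ x k, (W₂' *ᵥ x) (Fin.natAdd c k) = (V *ᵥ x) k := fun x k => by
    simp only [mulVec, dotProduct, hTr]
  have hX₂sub : W₂.submatrix id (Fin.castAdd e) = S * X * A' := by
    ext i j; exact hW₂l i j
  have hY₂sub : W₂'.submatrix (Fin.castAdd e) id = Y * R := by
    ext i j; exact hTl j i
  have hYU' : ∀ k, (Y * R) *ᵥ U.col k = 0 := fun k => by
    ext i; rw [← mul_apply_eq_mulVec_col, hYU, Matrix.zero_apply, Pi.zero_apply]
  refine ⟨e, W₂, W₂', fun k => (h k + 1) / 2, ⟨?_, ?_, ?_, ?_, ?_, ?_⟩, ?_⟩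
  · ext i j
    rw [← hXY]
    rw [mul_apply, Fin.sum_univ_add, Matrix.add_apply, mul_apply (M := S * X * A'),
      mul_apply (M := U)]
    simp only [hW₂l, hW₂r, hTl, hTr]
  · ext i j
    rw [mul_apply_eq_mulVec_col]
    induction i using Fin.addCases with
    | left i =>
      rw [hrowY]
      induction j using Fin.addCases with
      | left j => rw [hcolX₂, ← mul_apply_eq_mulVec_col, hYX₂, one_apply_castAdd]
      | right j =>
        rw [hcolU, hYU', one_apply_castAdd_natAdd, Pi.zero_apply]
    | right i =>
      rw [hrowV]
      induction j using Fin.addCases with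
      | left j =>
        rw [hcolX₂, ← mul_apply_eq_mulVec_col, hVX, one_apply_natAdd_castAdd, Matrix.zero_apply]
      | right j =>
        rw [hcolU, ← mul_apply_eq_mulVec_col, hVU, one_apply_natAdd]
  · rw [hX₂sub]
    calc S * R * (S * X * A') = S * ((R * S) * X * A') := by simp only [Matrix.mul_assoc]
      _ = S * X * A' * A := by
        rw [hXA, Matrix.mul_assoc (S * X), hA', Matrix.mul_one]
  · rw [hY₂sub]
    have := hY₂pow 1
    rwa [pow_one, pow_one] at this
  · intro k
    rw [hcolU]
    have hk := hU k
    obtain ⟨j, hj | hj⟩ := (h k).even_or_odd'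
    · rw [hj, mem_kernelFlag_two_mul] at hk
      rwa [hj, show (2 * j + 1) / 2 = j by omega]
    · rw [hj, mem_kernelFlag_two_mul_add_one] at hk
      rw [hj, show (2 * j + 1 + 1) / 2 = j + 1 by omega, pow_succ', Matrix.mul_assoc,
        ← mulVec_mulVec, hk, mulVec_zero]
  · intro j x hx k hk
    rw [hrowV]
    refine hV (2 * j) x ?_ ((mem_kernelFlag_two_mul _ _ _ _).mpr hx) k (by omega)
    have h1 : (A ^ j) *ᵥ ((Y * R) *ᵥ x) = 0 := by
      rw [mulVec_mulVec, ← hY₂pow, ← mulVec_mulVec, hx, mulVec_zero]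
    have h2 : A' ^ j * A ^ j = 1 := by
      rw [← (show Commute A' A from hA'.trans hA.symm).mul_pow, hA', one_pow]
    rw [← one_mulVec ((Y * R) *ᵥ x), ← h2, ← mulVec_mulVec, h1, mulVec_zero]
  · have hRX : R * (S * X * A') = X := by
      rw [← Matrix.mul_assoc, ← Matrix.mul_assoc]; exact hXA
    have hSX : S * X = S * X * A' * A := by rw [Matrix.mul_assoc (S * X), hA', Matrix.mul_one]
    have hYRS : ∀ k, (Y * R) *ᵥ (S *ᵥ W.col (Fin.natAdd c k)) = 0 := fun k => by
      rw [← mulVec_mulVec, mulVec_mulVec (M := R), hYB, hYcol, mulVec_zero]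
    have hP : ∀ i k, (W' * R * W₂) i k = (W' *ᵥ (R *ᵥ W₂.col k)) i := fun i k => by
      rw [mul_apply_eq_mulVec_col, mulVec_mulVec]
    have hQ : ∀ i k, (W₂' * S * W) i k = (W₂' *ᵥ (S *ᵥ W.col k)) i := fun i k => by
      rw [mul_apply_eq_mulVec_col, mulVec_mulVec]
    have hRcol : ∀ k, R *ᵥ (S * X * A').col k = X.col k := fun k => by
      ext i; rw [← mul_apply_eq_mulVec_col, hRX, col_apply]
    have hrowW' : ∀ x k, (W' *ᵥ x) (Fin.castAdd d k) = (Y *ᵥ x) k := fun _ _ => rfl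
    refine signGyration_eq_zero_of_levels _ _ lev (fun k => h k / 2) ?_ ?_ ?_ ?_ ?_ ?_ ?_
    · intro i k
      rw [hP, hcolX₂, hRcol, hrowW', ← mul_apply_eq_mulVec_col, hYX, one_apply]
    · intro i k
      rw [hP, hcolU, hrowW', mulVec_mulVec, hYU', Pi.zero_apply]
    · intro i k
      rw [hP, hcolX₂, hRcol, hcolX]
    · intro i k hne
      by_contra! hlt
      refine hne ?_
      rw [hP, hcolU]
      refine hF2 (h k / 2) _ ?_ i hlt
      have hk := hU k
      rw [mulVec_mulVec, ← mul_pow_mul_eq]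
      obtain ⟨j, hj | hj⟩ := (h k).even_or_odd'
      · rw [hj, mem_kernelFlag_two_mul] at hk
        rw [hj, show (2 * j) / 2 = j by omega, ← mulVec_mulVec, hk, mulVec_zero]
      · rw [hj, mem_kernelFlag_two_mul_add_one] at hk
        rwa [hj, show (2 * j + 1) / 2 = j by omega]
    · intro k i
      rw [hQ, hrowY, hYRS, Pi.zero_apply]
    · intro k i
      rw [hQ, hrowV]
      have : S *ᵥ W.col (Fin.castAdd d i) = (S * X * A' * A).col i := by
        rw [← hSX]; rfl
      rw [this, ← mul_apply_eq_mulVec_col, ← Matrix.mul_assoc, hVX, Matrix.zero_mul, Matrix.zero_apply]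
    · intro k i hne
      by_contra! hle
      refine hne ?_
      rw [hQ, hrowV]
      have hi := hF1 i
      rcases hl : lev i with _ | l
      · rw [hl, pow_zero, one_mulVec] at hi
        rw [hi, mulVec_zero, mulVec_zero, Pi.zero_apply]
      · refine hV (2 * l + 1) _ (hYRS i) ?_ k (by omega)
        rw [mem_kernelFlag_two_mul_add_one, mulVec_mulVec, mul_pow_mul_eq, Matrix.mul_assoc,
          ← pow_succ, ← hl, hi]

/-- The sign-gyration number of a framed matrix is unchanged by an elementary strong shift
equivalence of trivial sign-gyration number. -/
theorem signGyration_frame_step {p q m n : ℕ} (R : Matrix (Fin m) (Fin n) ℤ)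
    (S : Matrix (Fin n) (Fin m) ℤ) {W : Matrix (Fin m) (Fin p) ℤ} {W' : Matrix (Fin p) (Fin m) ℤ}
    {W₂ : Matrix (Fin n) (Fin q) ℤ} {W₂' : Matrix (Fin q) (Fin n) ℤ}
    (hW : W * W' = 1) (hW₂ : W₂ * W₂' = 1)
    (hRS : signGyration R S = 0) (hPQ : signGyration (W' * R * W₂) (W₂' * S * W) = 0)
    (h : signGyration W (W' * (R * S)) = 0) : signGyration W₂ (W₂' * (S * R)) = 0 := by
  have h1 : signGyration R S = signGyration W (W' * (R * S)) +
      (signGyration (W' * R * W₂) (W₂' * S * W) + signGyration W₂' (S * R * W₂)) := by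
    have hR : R = W * ((W' * R * W₂) * W₂') := by
      rw [Matrix.mul_assoc (W' * R), hW₂, Matrix.mul_one, ← Matrix.mul_assoc, hW, Matrix.one_mul]
    have e1 : W' * R * W₂ * W₂' * S = W' * (R * S) := by
      rw [Matrix.mul_assoc (W' * R), hW₂, Matrix.mul_one, Matrix.mul_assoc]
    have e2 : W₂' * (S * W) = W₂' * S * W := (Matrix.mul_assoc _ _ _).symm
    have e3 : S * W * (W' * R * W₂) = S * R * W₂ := by
      rw [← Matrix.mul_assoc, ← Matrix.mul_assoc, Matrix.mul_assoc S, hW, Matrix.mul_one]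
    calc signGyration R S = signGyration (W * ((W' * R * W₂) * W₂')) S := by rw [← hR]
      _ = _ := by rw [signGyration_mul, signGyration_mul, e1, e2, e3]
  have h2 := signGyration_one_left (S * R)
  rw [← hW₂, signGyration_mul] at h2
  rw [hRS, hPQ, h, zero_add, zero_add] at h1
  rwa [← h1, add_zero] at h2

end

section

open Matrix

/-- The matrix `B` over `ℕ` has no cycles of length at most two, and its invertible part is framed
by `A` with trivial sign-gyration number. -/
def IsTriviallyFramed {c m : ℕ} (A : Matrix (Fin c) (Fin c) ℤ) (B : Matrix (Fin m) (Fin m) ℕ) :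
    Prop :=
  B.trace = 0 ∧ (B * B).trace = 0 ∧
    ∃ (d : ℕ) (W : Matrix (Fin m) (Fin (c + d)) ℤ) (W' : Matrix (Fin (c + d)) (Fin m) ℤ)
      (lev : Fin d → ℕ), IsFrame A (B.map (Nat.cast : ℕ → ℤ)) W W' lev ∧
        signGyration W (W' * B.map (Nat.cast : ℕ → ℤ)) = 0

theorem map_natCast_mul {l m n : ℕ} (R : Matrix (Fin l) (Fin m) ℕ) (S : Matrix (Fin m) (Fin n) ℕ) :
    (R * S).map (Nat.cast : ℕ → ℤ) = R.map (Nat.cast : ℕ → ℤ) * S.map (Nat.cast : ℕ → ℤ) :=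
  Matrix.map_mul (f := Nat.castRingHom ℤ)

theorem IsTriviallyFramed.step {c m n : ℕ} {A A' : Matrix (Fin c) (Fin c) ℤ} (hA : A * A' = 1)
    (hA' : A' * A = 1) (R : Matrix (Fin m) (Fin n) ℕ) (S : Matrix (Fin n) (Fin m) ℕ)
    (h : IsTriviallyFramed A (R * S)) : IsTriviallyFramed A (S * R) := by
  obtain ⟨h1, h2, d, W, W', lev, hW, hs⟩ := h
  rw [map_natCast_mul] at hW hs
  obtain ⟨e, W₂, W₂', lev₂, hW₂, hs₂⟩ := exists_frame_of_elementary hA hA' _ _ hW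
  refine ⟨by rwa [trace_mul_comm], ?_, e, W₂, W₂', lev₂, ?_, ?_⟩
  · rwa [Matrix.mul_assoc, trace_mul_comm, Matrix.mul_assoc, Matrix.mul_assoc, ← Matrix.mul_assoc]
  · rwa [map_natCast_mul]
  · rw [map_natCast_mul]
    exact signGyration_frame_step _ _ hW.mul_inv hW₂.mul_inv
      (signGyration_natCast_eq_zero R S h1 h2) hs₂ hs

theorem isTriviallyFramed_self {c : ℕ} (B : Matrix (Fin c) (Fin c) ℕ) (h1 : B.trace = 0)
    (h2 : (B * B).trace = 0) : IsTriviallyFramed (B.map (Nat.cast : ℕ → ℤ)) B := by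
  refine ⟨h1, h2, 0, 1, 1, Fin.elim0, ⟨Matrix.one_mul _, Matrix.one_mul _, ?_, ?_, fun k => k.elim0,
    fun _ _ _ k => k.elim0⟩, signGyration_one_left _⟩
  · rw [show (1 : Matrix (Fin c) (Fin c) ℤ).submatrix id (Fin.castAdd 0) = 1 from rfl,
      Matrix.mul_one, Matrix.one_mul]
  · rw [show (1 : Matrix (Fin c) (Fin c) ℤ).submatrix (Fin.castAdd 0) id = 1 from rfl,
      Matrix.mul_one, Matrix.one_mul]

theorem isTriviallyFramed_reindex {c m n : ℕ} (A : Matrix (Fin c) (Fin c) ℤ) (h : m = n)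
    (B : Matrix (Fin m) (Fin m) ℕ) :
    IsTriviallyFramed A (Matrix.reindex (finCongr h) (finCongr h) B) ↔ IsTriviallyFramed A B := by
  subst h
  rfl

theorem IsTriviallyFramed.of_chain {c k m n : ℕ} {A A' : Matrix (Fin c) (Fin c) ℤ}
    (hA : A * A' = 1) (hA' : A' * A = 1) (C : SSEChain ℕ k) {B₀ : Matrix (Fin m) (Fin m) ℕ}
    {B₁ : Matrix (Fin n) (Fin n) ℕ} (hC : C.From B₀ B₁) (h : IsTriviallyFramed A B₀) :
    IsTriviallyFramed A B₁ := by
  obtain ⟨h0, h1, rfl, rfl⟩ := hC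
  rw [isTriviallyFramed_reindex] at h ⊢
  have : ∀ i, IsTriviallyFramed A (C.mat i) := by
    intro i
    induction i using Fin.induction with
    | zero => exact h
    | succ i ih =>
      rw [C.hS i]
      rw [C.hR i] at ih
      exact ih.step hA hA'
  exact this _

/-- An invertible matrix framed by `A` is conjugate to `A` over `ℤ`. -/
theorem IsTriviallyFramed.exists_conj {c m : ℕ} {A : Matrix (Fin c) (Fin c) ℤ}
    {B : Matrix (Fin m) (Fin m) ℕ} {B' : Matrix (Fin m) (Fin m) ℤ}
    (hB : B' * B.map (Nat.cast : ℕ → ℤ) = 1) (h : IsTriviallyFramed A B) :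
    ∃ (W : Matrix (Fin m) (Fin c) ℤ) (W' : Matrix (Fin c) (Fin m) ℤ), W * W' = 1 ∧ W' * W = 1 ∧
      B.map (Nat.cast : ℕ → ℤ) * W = W * A ∧
      signGyration W (W' * B.map (Nat.cast : ℕ → ℤ)) = 0 := by
  obtain ⟨-, -, d, W, W', lev, hW, hs⟩ := h
  rcases d with _ | d
  · exact ⟨W, W', hW.mul_inv, hW.inv_mul, hW.intertwine, hs⟩
  · have h1 : W.col (Fin.natAdd c 0) = 0 := by
      have h2 : ∀ k x, (B.map (Nat.cast : ℕ → ℤ) ^ k) *ᵥ x = 0 → x = 0 := by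
        intro k
        induction k with
        | zero => intro x hx; rwa [pow_zero, one_mulVec] at hx
        | succ k ih =>
          intro x hx
          refine ih x ?_
          rw [← one_mulVec ((_ ^ k) *ᵥ x), ← hB, ← mulVec_mulVec,
            show B.map _ *ᵥ (_ ^ k *ᵥ x) = 0 by rw [mulVec_mulVec, ← pow_succ', hx], mulVec_zero]
      exact h2 _ _ (hW.pow_mulVec_col 0)
    have h3 := congrFun (congrFun hW.inv_mul (Fin.natAdd c 0)) (Fin.natAdd c 0)
    rw [mul_apply_eq_mulVec_col, h1, mulVec_zero, one_apply_eq] at h3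
    exact absurd h3 zero_ne_one

end

section

open Matrix

theorem Amat_eq_mul : Amat = Smat * Rmat := by decide +kernel

theorem Bmat_eq_mul : Bmat = Rmat * Smat := by decide +kernel

theorem map_AmatN : AmatN.map (Nat.cast : ℕ → ℤ) = Amat := by decide +kernel

theorem map_BmatN : BmatN.map (Nat.cast : ℕ → ℤ) = Bmat := by decide +kernel

theorem signGyration_Rmat_Smat : signGyration Rmat Smat = 1 := by decide +kernel

/-- The inverse of `Amat`. -/
def AmatInv : Matrix (Fin 7) (Fin 7) ℤ :=
  !![3, 4, 3, 0, 0, -3, 0;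
     3, 3, 4, 0, 0, -3, 0;
     3, 3, 3, 1, 0, -3, 0;
     1, 0, 0, -1, 0, 0, 0;
     -1, -1, -1, 0, 0, 1, 0;
     -10, -10, -10, 0, 0, 9, 1;
     0, 0, 0, 0, 1, 0, 0]

/-- The inverse of `Bmat`. -/
def BmatInv : Matrix (Fin 7) (Fin 7) ℤ :=
  !![0, 1, 0, 0, 0, 0, 0;
     0, 0, 1, 0, 0, 0, 0;
     0, 0, 0, 1, 0, 0, 0;
     10, 12, 15, 8, 0, -3, 0;
     -3, -4, -5, -3, 0, 1, 0;
     -30, -40, -50, -30, 0, 9, 1;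
     0, 0, 0, 0, 1, 0, 0]

/-- The inverse of `Rmat`. -/
def RmatInv : Matrix (Fin 7) (Fin 7) ℤ :=
  !![1, 2, 2, 1, 0, 0, 0;
     1, 1, 2, 1, 0, 0, 0;
     1, 1, 1, 1, 0, 0, 0;
     1, 1, 1, 0, 0, 0, 0;
     0, 0, 0, 0, 1, 0, 0;
     0, 0, 0, 0, 0, 1, 0;
     0, 0, 0, 0, 0, 0, 1]

theorem Amat_mul_inv : Amat * AmatInv = 1 := by decide +kernel

theorem Amat_inv_mul : AmatInv * Amat = 1 := by decide +kernel

theorem Bmat_inv_mul : BmatInv * Bmat = 1 := by decide +kernel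

theorem Rmat_mul_inv : Rmat * RmatInv = 1 := by decide +kernel

theorem Rmat_inv_mul : RmatInv * Rmat = 1 := by decide +kernel

/-- The square of `Amat`. -/
def AmatSq : Matrix (Fin 7) (Fin 7) ℤ :=
  !![0, 1, 1, 0, 6, 0, 3;
     0, 0, 1, 1, 3, 0, 3;
     1, 0, 0, 0, 3, 0, 3;
     0, 1, 0, 0, 3, 0, 3;
     1, 1, 1, 1, 0, 1, 0;
     1, 1, 2, 1, 12, 0, 10;
     2, 2, 3, 2, 22, 0, 0]

/-- The cube of `Bmat`. -/
def BmatCube : Matrix (Fin 7) (Fin 7) ℤ :=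
  !![13, 16, 18, 9, 0, 3, 0;
     0, 1, 1, 0, 0, 0, 3;
     0, 0, 1, 1, 3, 0, 0;
     1, 0, 0, 0, 0, 0, 0;
     9, 11, 13, 7, 22, 0, 0;
     46, 57, 69, 35, 15, 10, 12;
     11, 13, 16, 9, 27, 0, 22]

theorem exists_pos_Amat_pow : ∃ k > 0, ∀ i j, 0 < (Amat ^ k) i j := by
  have h : Amat ^ 2 = AmatSq := by decide +kernel
  refine ⟨6, by norm_num, ?_⟩
  have h' : ∀ i j, 0 < (AmatSq ^ 3) i j + 0 := by decide +kernel
  simpa only [← h, ← pow_mul, add_zero] using h'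

theorem exists_pos_Bmat_pow : ∃ k > 0, ∀ i j, 0 < (Bmat ^ k) i j := by
  have h : Bmat ^ 3 = BmatCube := by decide +kernel
  refine ⟨9, by norm_num, ?_⟩
  have h' : ∀ i j, 0 < (BmatCube ^ 3) i j + 0 := by decide +kernel
  simpa only [← h, ← pow_mul, add_zero] using h'

/-- The matrix with rows `e₄ Aⁱ`. -/
def krylovMat : Matrix (Fin 7) (Fin 7) ℤ :=
  !![0, 0, 0, 0, 1, 0, 0;
     0, 0, 0, 0, 0, 0, 1;
     1, 1, 1, 1, 0, 1, 0;
     2, 2, 3, 2, 22, 0, 0;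
     2, 3, 4, 2, 27, 0, 22;
     25, 26, 26, 24, 33, 22, 27;
     75, 75, 98, 74, 523, 27, 33]

/-- The inverse of `krylovMat`. -/
def krylovInv : Matrix (Fin 7) (Fin 7) ℤ :=
  !![-1, -39, -32, -46, 0, -1, 2;
     -5, 34, 10, 46, -1, 2, -2;
     0, -56, -10, -47, 2, -2, 2;
     -5, 89, 37, 71, -2, 2, -3;
     1, 0, 0, 0, 0, 0, 0;
     11, -28, -4, -24, 1, -1, 1;
     0, 1, 0, 0, 0, 0, 0]

theorem krylovMat_mul_inv : krylovMat * krylovInv = 1 := by decide +kernel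

theorem krylovInv_mul : krylovInv * krylovMat = 1 := by decide +kernel

/-- A unit of `ℤ[A]`. -/
def unitThree : Matrix (Fin 7) (Fin 7) ℤ :=
  !![219661, 232591, 278375, 213896, 1210500, 113004, 369489;
     181256, 194818, 232591, 177483, 1007781, 94203, 307926;
     169686, 181256, 219661, 168112, 946218, 88161, 289125;
     168112, 177483, 213896, 164553, 927417, 86406, 283083;
     125762, 134043, 160831, 123163, 696658, 64974, 212764;
     609276, 649937, 780180, 597159, 3377263, 314884, 1031514;
     411781, 438569, 526663, 403500, 2281137, 212764, 696658]

/-- The inverse of `unitThree`. -/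
def unitThreeInv : Matrix (Fin 7) (Fin 7) ℤ :=
  !![4353526, 2905497, 6545581, 4455429, 66992679, -2346087, -25106457;
     -674190, -1420877, 2905497, -255935, 77405184, -7863030, -12113808;
     388849, -674190, 4353526, 815345, 90397833, -8120490, -17630751;
     815345, -255935, 4455429, 1192094, 84880890, -7218246, -17888211;
     -8583747, -6658946, -9150848, -8368819, -47986498, -3255907, 34170547;
     3064311, -408372, 14510603, 4232810, 268966243, -22438645, -58106923;
     24255694, 21763792, 13962074, 22330893, -130846150, 34170547, -47986498]

theorem unitThree_mul_inv : unitThree * unitThreeInv = 1 := by decide +kernel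

theorem unitThree_inv_mul : unitThreeInv * unitThree = 1 := by decide +kernel

theorem unitThree_mul_Amat : unitThree * Amat = Amat * unitThree := by decide +kernel

theorem signGyration_unitThree : signGyration unitThree (unitThreeInv * Amat) = 0 := by decide +kernel

/-- A unit of `ℤ[A]`. -/
def unitFour : Matrix (Fin 7) (Fin 7) ℤ :=
  !![-1051, 864, -5630, -1968, -115476, 9198, 32742;
     6861, 7409, 864, 5536, -113673, 16149, 7764;
     5905, 6861, -1051, 4526, -138651, 17658, 14715;
     4526, 5536, -1968, 3621, -131700, 16518, 16224;
     10791, 7971, 13980, 10914, 112992, -478, -48805;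
     12643, 15939, -7832, 11160, -416605, 53469, 54743;
     -41312, -35303, -27578, -38492, 126188, -48805, 112992]

/-- The inverse of `unitFour`. -/
def unitFourInv : Matrix (Fin 7) (Fin 7) ℤ :=
  !![-2144722685719, 1688377352462, -1122010696786, 3083258520452, -233492752908, -434351307612, 318461744244;
     3227332164209, -2540633607871, 1688377352462, -4639620524850, 351354828579, 653602423677, -479214323190;
     -4099635958941, 3227332164209, -2144722685719, 5893646569700, -446321238855, -830262229764, 608739408099;
     5893646569700, -4639620524850, 3083258520452, -8472720563031, 641632492434, 1193586989586, -875125245342;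
     -73840940555, 58129366829, -38629854456, 106153914748, -8038952824, -14954338526, 10964361445;
     -2916314512165, 2295793021783, -1525668609676, 4192500796098, -317494801739, -590614828711, 433032490627;
     54139389748, -42619831537, 28322997112, -77830917636, 5894074438, 10964361445, -8038952824]

theorem unitFour_mul_inv : unitFour * unitFourInv = 1 := by decide +kernel

theorem unitFour_inv_mul : unitFourInv * unitFour = 1 := by decide +kernel

theorem unitFour_mul_Amat : unitFour * Amat = Amat * unitFour := by decide +kernel

theorem signGyration_unitFour : signGyration unitFour (unitFourInv * Amat) = 0 := by decide +kernel

/-- A unit of `ℤ[A]`. -/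
def unitFive : Matrix (Fin 7) (Fin 7) ℤ :=
  !![-6728538, -7141718, -8464365, -6581680, -34937109, -3672858, -10784556;
     -5678281, -6002265, -7141718, -5555543, -29804655, -3059769, -8628186;
     -5378417, -5678281, -6728538, -5259033, -27648285, -2946585, -8015097;
     -5259033, -5555543, -6581680, -5142363, -27035196, -2882643, -7901913;
     -3653894, -3895985, -4819138, -3594852, -22931334, -1651776, -6340033;
     -19038045, -20134115, -23888563, -18620542, -98730082, -10369479, -29079615;
     -11887794, -12810947, -15240555, -11645703, -64409367, -6340033, -22931334]

/-- The inverse of `unitFive`. -/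
def unitFiveInv : Matrix (Fin 7) (Fin 7) ℤ :=
  !![806426719, -68642591, -671147665, -120099731, 34531566, 28570110, -123241887;
     -378637490, 688810015, -68642591, -522477824, -127623285, 85491966, 49803906;
     -663398879, -378637490, 806426719, 482405343, 45422508, -89046594, 106725762;
     482405343, -522477824, -120099731, 352591486, 102344364, -55429089, -67812798;
     5893056, 45098624, -31557259, -41080629, -7485192, 7077932, -1460466;
     -281681144, 242432125, 106744222, -150648842, -49129677, 22928415, 40365713;
     50716090, -25939793, -29570107, 11510522, 5840696, -1460466, -7485192]

theorem unitFive_mul_inv : unitFive * unitFiveInv = 1 := by decide +kernel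

theorem unitFive_inv_mul : unitFiveInv * unitFive = 1 := by decide +kernel

theorem unitFive_mul_Amat : unitFive * Amat = Amat * unitFive := by decide +kernel

theorem signGyration_unitFive : signGyration unitFive (unitFiveInv * Amat) = 0 := by decide +kernel

theorem signGyration_Amat : signGyration Amat (AmatInv * Amat) = 0 := by decide +kernel

theorem signGyration_neg_one : signGyration (-1) (-1 * Amat) = 0 := by decide +kernel

end

section

open Matrix Polynomial

/-- The characteristic polynomial of `Amat`. -/
noncomputable def kimRoushPoly : ℤ[X] := X ^ 7 - 23 * X ^ 4 - 28 * X ^ 3 - 33 * X ^ 2 - 17 * X + 1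

theorem kimRoushPoly_natDegree : kimRoushPoly.natDegree = 7 := by
  rw [kimRoushPoly]; compute_degree!

theorem kimRoushPoly_monic : kimRoushPoly.Monic := by
  rw [kimRoushPoly]; monicity!

theorem Amat_pow_row : ∀ i : Fin 7, (Amat ^ (i : ℕ)) 4 = krylovMat i := by
  intro i
  fin_cases i <;> decide +kernel

theorem eq_zero_of_row_eq_zero {M : Matrix (Fin 7) (Fin 7) ℤ} (hM : Commute Amat M)
    (h : M 4 = 0) : M = 0 := by
  have h1 : krylovMat * M = 0 := by
    ext1 i
    rw [mul_apply_eq_vecMul, ← Amat_pow_row, ← mul_apply_eq_vecMul, (hM.pow_left _).eq,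
      mul_apply_eq_vecMul, h, zero_vecMul]
    exact fun _ => rfl
  rw [← Matrix.one_mul M, ← krylovInv_mul, Matrix.mul_assoc, h1, Matrix.mul_zero]

theorem aeval_Amat_kimRoushPoly : aeval Amat kimRoushPoly = 0 := by
  refine eq_zero_of_row_eq_zero ?_ ?_
  · simpa using (Commute.all X kimRoushPoly).map (aeval Amat)
  · have h : (Amat ^ 7 - 23 * Amat ^ 4 - 28 * Amat ^ 3 - 33 * Amat ^ 2 - 17 * Amat + 1 :
        Matrix (Fin 7) (Fin 7) ℤ) 4 = 0 := by
      decide +kernel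
    simpa [kimRoushPoly, map_ofNat] using h

/-- The polynomial with coefficients `q`. -/
noncomputable def polyOfCoeffs (q : Fin 7 → ℤ) : ℤ[X] := ∑ i, C (q i) * X ^ (i : ℕ)

theorem aeval_Amat_polyOfCoeffs_row (q : Fin 7 → ℤ) :
    aeval Amat (polyOfCoeffs q) 4 = q ᵥ* krylovMat := by
  ext j
  simp only [polyOfCoeffs, map_sum, map_mul, aeval_C, map_pow, aeval_X, vecMul, dotProduct,
    Matrix.sum_apply, ← Amat_pow_row]
  refine Finset.sum_congr rfl fun i _ => ?_
  rw [← Algebra.smul_def]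
  rfl

theorem exists_aeval_Amat_eq {M : Matrix (Fin 7) (Fin 7) ℤ} (hM : Commute Amat M) :
    aeval Amat (polyOfCoeffs (M 4 ᵥ* krylovInv)) = M := by
  refine sub_eq_zero.mp (eq_zero_of_row_eq_zero (Commute.sub_right ?_ hM) ?_)
  · simpa using (Commute.all X (polyOfCoeffs _)).map (aeval Amat)
  · rw [show ∀ N : Matrix (Fin 7) (Fin 7) ℤ, (N - M) 4 = N 4 - M 4 from fun _ => rfl,
      aeval_Amat_polyOfCoeffs_row, vecMul_vecMul, krylovInv_mul, vecMul_one, sub_self]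

theorem polyOfCoeffs_eq_of_natDegree_lt {r : ℤ[X]} (h : r.natDegree < 7) :
    polyOfCoeffs (fun i => r.coeff i) = r := by
  rw [polyOfCoeffs, Fin.sum_univ_eq_sum_range (fun i => C (r.coeff i) * X ^ i)]
  exact (r.as_sum_range_C_mul_X_pow' h).symm

theorem kimRoushPoly_dvd_iff (h : ℤ[X]) : kimRoushPoly ∣ h ↔ aeval Amat h = 0 := by
  constructor
  · rintro ⟨k, rfl⟩
    rw [map_mul, aeval_Amat_kimRoushPoly, zero_mul]
  · intro hh
    rw [← modByMonic_eq_zero_iff_dvd kimRoushPoly_monic]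
    have hdeg : (h %ₘ kimRoushPoly).natDegree < 7 := by
      rw [← kimRoushPoly_natDegree]
      refine natDegree_modByMonic_lt _ kimRoushPoly_monic fun h1 => ?_
      have := kimRoushPoly_natDegree
      rw [h1, natDegree_one] at this
      omega
    have h2 : aeval Amat (h %ₘ kimRoushPoly) = 0 := by
      rw [modByMonic_eq_sub_mul_div, map_sub, map_mul, hh, aeval_Amat_kimRoushPoly, zero_mul,
        sub_zero]
    have h3 := aeval_Amat_polyOfCoeffs_row fun i => (h %ₘ kimRoushPoly).coeff i
    rw [polyOfCoeffs_eq_of_natDegree_lt hdeg, h2] at h3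
    have h4 : (fun i : Fin 7 => (h %ₘ kimRoushPoly).coeff i) = 0 := by
      rw [← vecMul_one (fun i : Fin 7 => (h %ₘ kimRoushPoly).coeff i), ← krylovMat_mul_inv,
        ← vecMul_vecMul, ← h3]
      exact zero_vecMul _
    rw [← polyOfCoeffs_eq_of_natDegree_lt hdeg, h4]
    simp [polyOfCoeffs]

/-- The isomorphism of `ℤ[X] / (kimRoushPoly)` with `ℤ[A]`. -/
noncomputable def toMatrix : AdjoinRoot kimRoushPoly →+* Matrix (Fin 7) (Fin 7) ℤ :=
  Ideal.Quotient.lift (Ideal.span {kimRoushPoly}) (aeval Amat).toRingHom fun a ha =>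
    (kimRoushPoly_dvd_iff a).mp (Ideal.mem_span_singleton.mp ha)

theorem toMatrix_mk (h : ℤ[X]) : toMatrix (AdjoinRoot.mk kimRoushPoly h) = aeval Amat h := rfl

theorem toMatrix_injective : Function.Injective toMatrix := by
  rw [injective_iff_map_eq_zero]
  intro x hx
  obtain ⟨h, rfl⟩ := AdjoinRoot.mk_surjective x
  rwa [AdjoinRoot.mk_eq_zero, kimRoushPoly_dvd_iff]

end

section

theorem zpow_sum_eq_prod {H ι : Type*} [CommGroup H] (a : H) (s : Finset ι) (f : ι → ℤ) :
    a ^ (∑ i ∈ s, f i) = ∏ i ∈ s, a ^ f i := by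
  classical
  induction s using Finset.induction_on with
  | empty => simp
  | insert i s hi ih => rw [Finset.sum_insert hi, Finset.prod_insert hi, zpow_add, ih]

open Module in
/-- In a group embedding in an abelian group with `r` generators, any `r + 1` elements have a
nonempty subproduct which is a square. -/
theorem exists_prod_eq_sq {G H : Type*} [CommGroup G] [CommGroup H] (φ : G →* H)
    (hφ : Function.Injective φ) {r : ℕ} (γ : Fin r → H)
    (hγ : ∀ h, ∃ n : Fin r → ℤ, h = ∏ i, γ i ^ n i) (g : Fin (r + 1) → G) :
    ∃ ε : Fin (r + 1) → ZMod 2, ε ≠ 0 ∧ ∃ v, ∏ i, g i ^ (ε i).val = v ^ 2 := by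
  let N : AddSubgroup (Fin r → ℤ) :=
    { carrier := {n | ∃ g, φ g = ∏ i, γ i ^ n i}
      zero_mem' := ⟨1, by simp⟩
      add_mem' := by
        rintro m n ⟨g, hg⟩ ⟨h, hh⟩
        exact ⟨g * h, by simp [hg, hh, zpow_add, Finset.prod_mul_distrib]⟩
      neg_mem' := by
        rintro m ⟨g, hg⟩
        exact ⟨g⁻¹, by simp [hg]⟩ }
  let N' : Submodule ℤ (Fin r → ℤ) := AddSubgroup.toIntSubmodule N
  choose n hn using fun i => hγ (φ (g i))
  have hnN : ∀ i, n i ∈ N' := fun i => ⟨g i, hn i⟩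
  let b := finBasis ℤ N'
  have hrank : finrank ℤ N' ≤ r := by simpa using N'.finrank_le
  have hdep : ¬ LinearIndependent (ZMod 2) fun i : Fin (r + 1) =>
      fun j => ((b.repr ⟨n i, hnN i⟩ j : ℤ) : ZMod 2) := by
    intro h
    have := h.fintype_card_le_finrank
    simp at this
    omega
  obtain ⟨c, hc, i₀, hi₀⟩ := Fintype.not_linearIndependent_iff.mp hdep
  refine ⟨c, fun h => hi₀ (congrFun h i₀), ?_⟩
  let y : N' := ∑ i, ((c i).val : ℤ) • ⟨n i, hnN i⟩
  have hy : ∀ j, (2 : ℤ) ∣ b.repr y j := by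
    intro j
    refine (ZMod.intCast_zmod_eq_zero_iff_dvd _ 2).mp ?_
    have hyj : b.repr y j = ∑ i, ((c i).val : ℤ) * b.repr ⟨n i, hnN i⟩ j := by
      simp only [y, map_sum, map_smul, Finsupp.finsetSum_apply, Finsupp.smul_apply, smul_eq_mul]
    have := congrFun hc j
    rw [hyj]
    simpa only [Int.cast_sum, Int.cast_mul, Int.cast_natCast, ZMod.natCast_zmod_val,
      Finset.sum_apply, Pi.smul_apply, smul_eq_mul, Pi.zero_apply] using this
  choose z hz using hy
  obtain ⟨v, hv⟩ : ((∑ j, z j • b j : N') : Fin r → ℤ) ∈ N := (∑ j, z j • b j : N').2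
  refine ⟨v, hφ ?_⟩
  have hyz : y = (2 : ℤ) • ∑ j, z j • b j := by
    rw [← b.sum_repr y, Finset.smul_sum]
    exact Finset.sum_congr rfl fun j _ => by rw [hz, mul_smul]
  have hy' : ∏ i, γ i ^ (y : Fin r → ℤ) i = φ (∏ i, g i ^ (c i).val) := by
    have : ∀ i, (y : Fin r → ℤ) i = ∑ k, ((c k).val : ℤ) * n k i := by
      intro i
      simp only [y, Submodule.coe_sum, Submodule.coe_smul, Finset.sum_apply, Pi.smul_apply,
        smul_eq_mul]
    rw [map_prod]
    simp only [this, map_pow, hn, ← Finset.prod_pow]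
    rw [Finset.prod_comm]
    refine Finset.prod_congr rfl fun i _ => ?_
    rw [zpow_sum_eq_prod]
    refine Finset.prod_congr rfl fun k _ => ?_
    rw [mul_comm, zpow_mul, zpow_natCast]
  rw [← hy', hyz, map_pow, hv, ← Finset.prod_pow]
  refine Finset.prod_congr rfl fun i _ => ?_
  rw [← zpow_natCast, ← zpow_mul, Submodule.coe_smul]
  simp [mul_comm]

end

section

open Matrix Polynomial

/-- The sign-gyration number of multiplication by a unit, as a self-conjugacy of `Amat`. -/
noncomputable def unitGyration : (AdjoinRoot kimRoushPoly)ˣ →* Multiplicative (ZMod 2) where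
  toFun x := Multiplicative.ofAdd (signGyration (toMatrix x) (toMatrix ↑x⁻¹ * Amat))
  map_one' := by
    simp only [inv_one, Units.val_one, map_one, signGyration_one_left]
    rfl
  map_mul' x y := by
    have hA : Amat = toMatrix (AdjoinRoot.root kimRoushPoly) := (aeval_X Amat).symm
    have e₁ : toMatrix y * (toMatrix ↑(x * y)⁻¹ * Amat) = toMatrix ↑x⁻¹ * Amat := by
      rw [← Matrix.mul_assoc, ← map_mul, mul_inv, Units.val_mul, mul_left_comm, Units.mul_inv,
        mul_one]
    have e₂ : toMatrix ↑(x * y)⁻¹ * Amat * toMatrix x = toMatrix ↑y⁻¹ * Amat := by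
      rw [hA, ← map_mul, ← map_mul, ← map_mul, mul_right_comm, mul_inv, Units.val_mul,
        mul_right_comm _ _ (x : AdjoinRoot kimRoushPoly), Units.inv_mul, one_mul]
    rw [← ofAdd_add, Units.val_mul, map_mul, signGyration_mul, e₁, e₂]

theorem exists_unit_of_matrix {M M' : Matrix (Fin 7) (Fin 7) ℤ} (hM : M * Amat = Amat * M)
    (h₁ : M * M' = 1) (h₂ : M' * M = 1) :
    ∃ x : (AdjoinRoot kimRoushPoly)ˣ,
      (x : AdjoinRoot kimRoushPoly) = AdjoinRoot.mk _ (polyOfCoeffs (M 4 ᵥ* krylovInv)) ∧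
      toMatrix x = M ∧ toMatrix ↑x⁻¹ = M' := by
  have hM' : Commute Amat M' := by
    show Amat * M' = M' * Amat
    calc Amat * M' = M' * (M * Amat) * M' := by
          rw [← Matrix.mul_assoc, h₂, Matrix.one_mul]
      _ = M' * Amat := by
          rw [hM, Matrix.mul_assoc, Matrix.mul_assoc, h₁, Matrix.mul_one]
  have e₁ := exists_aeval_Amat_eq hM.symm
  have e₂ := exists_aeval_Amat_eq hM'
  rw [← toMatrix_mk] at e₁ e₂
  exact ⟨⟨_, _, toMatrix_injective (by rw [map_mul, e₁, e₂, h₁, map_one]),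
    toMatrix_injective (by rw [map_mul, e₁, e₂, h₂, map_one])⟩, rfl, e₁, e₂⟩

/-- The quadratic character of a unit at the prime `(q, α - s)`. -/
noncomputable def unitCharacter (q : ℕ) (s : ZMod q)
    (h : s ^ 7 - 23 * s ^ 4 - 28 * s ^ 3 - 33 * s ^ 2 - 17 * s + 1 = 0) :
    (AdjoinRoot kimRoushPoly)ˣ →* ZMod q :=
  ((powMonoidHom ((q - 1) / 2)).comp (AdjoinRoot.lift (Int.castRingHom (ZMod q)) s (by
    simpa [kimRoushPoly] using h) : AdjoinRoot kimRoushPoly →+* ZMod q).toMonoidHom).comp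
    (Units.coeHom _)

theorem unitCharacter_apply {q : ℕ} {s : ZMod q}
    (h : s ^ 7 - 23 * s ^ 4 - 28 * s ^ 3 - 33 * s ^ 2 - 17 * s + 1 = 0)
    {x : (AdjoinRoot kimRoushPoly)ˣ} {c : Fin 7 → ℤ}
    (hx : (x : AdjoinRoot kimRoushPoly) = AdjoinRoot.mk _ (polyOfCoeffs c)) :
    unitCharacter q s h x = (∑ i : Fin 7, (c i : ZMod q) * s ^ (i : ℕ)) ^ ((q - 1) / 2) := by
  simp [unitCharacter, hx, polyOfCoeffs]

theorem unitCharacter_sq {q : ℕ} (hp : q.Prime) (hq : Odd q) {s : ZMod q}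
    (h : s ^ 7 - 23 * s ^ 4 - 28 * s ^ 3 - 33 * s ^ 2 - 17 * s + 1 = 0)
    (x : (AdjoinRoot kimRoushPoly)ˣ) : unitCharacter q s h (x ^ 2) = 1 := by
  have := Fact.mk hp
  have h2 : (q - 1) / 2 * 2 = q - 1 := by
    obtain ⟨k, rfl⟩ := hq
    omega
  have : unitCharacter q s h x = (AdjoinRoot.lift (Int.castRingHom (ZMod q)) s (by
    simpa [kimRoushPoly] using h) (x : AdjoinRoot kimRoushPoly)) ^ ((q - 1) / 2) := rfl
  rw [map_pow, this, ← pow_mul, h2, ZMod.pow_card_sub_one_eq_one]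
  exact (x.isUnit.map _).ne_zero

end

section

open Matrix Polynomial

theorem unitCharacter_eq_of_matrix {q : ℕ} {s : ZMod q}
    (h : s ^ 7 - 23 * s ^ 4 - 28 * s ^ 3 - 33 * s ^ 2 - 17 * s + 1 = 0)
    {x : (AdjoinRoot kimRoushPoly)ˣ} {M : Matrix (Fin 7) (Fin 7) ℤ} (a : ZMod q)
    (hx : (x : AdjoinRoot kimRoushPoly) = AdjoinRoot.mk _ (polyOfCoeffs (M 4 ᵥ* krylovInv)))
    (ha : (∑ i : Fin 7, (((M 4 ᵥ* krylovInv) i : ℤ) : ZMod q) * s ^ (i : ℕ)) ^ ((q - 1) / 2) = a) :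
    unitCharacter q s h x = a :=
  (unitCharacter_apply h hx).trans ha

theorem exists_unit_of_signGyration {M M' : Matrix (Fin 7) (Fin 7) ℤ} (hM : M * Amat = Amat * M)
    (h₁ : M * M' = 1) (h₂ : M' * M = 1) (h : signGyration M (M' * Amat) = 0) :
    ∃ x : (AdjoinRoot kimRoushPoly)ˣ,
      (x : AdjoinRoot kimRoushPoly) = AdjoinRoot.mk _ (polyOfCoeffs (M 4 ᵥ* krylovInv)) ∧
      unitGyration x = 1 := by
  obtain ⟨x, hx, hx₁, hx₂⟩ := exists_unit_of_matrix hM h₁ h₂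
  refine ⟨x, hx, ?_⟩
  show Multiplicative.ofAdd _ = _
  rw [hx₁, hx₂, h, ofAdd_zero]

/-- Five units which are independent modulo squares and have trivial sign-gyration number. -/
theorem exists_independent_units : ∃ u : Fin 5 → (AdjoinRoot kimRoushPoly)ˣ,
    (∀ i, unitGyration (u i) = 1) ∧
    ∀ (ε : Fin 5 → ZMod 2) (v : (AdjoinRoot kimRoushPoly)ˣ), ∏ i, u i ^ (ε i).val = v ^ 2 →
      ε = 0 := by
  obtain ⟨u₁, h₁, f₁⟩ := exists_unit_of_signGyration (M := -1) (M' := -1) (by simp) (by simp)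
    (by simp) signGyration_neg_one
  obtain ⟨u₂, h₂, f₂⟩ := exists_unit_of_signGyration rfl Amat_mul_inv Amat_inv_mul
    signGyration_Amat
  obtain ⟨u₃, h₃, f₃⟩ := exists_unit_of_signGyration unitThree_mul_Amat unitThree_mul_inv
    unitThree_inv_mul signGyration_unitThree
  obtain ⟨u₄, h₄, f₄⟩ := exists_unit_of_signGyration unitFour_mul_Amat unitFour_mul_inv
    unitFour_inv_mul signGyration_unitFour
  obtain ⟨u₅, h₅, f₅⟩ := exists_unit_of_signGyration unitFive_mul_Amat unitFive_mul_inv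
    unitFive_inv_mul signGyration_unitFive
  refine ⟨![u₁, u₂, u₃, u₄, u₅], ?_, ?_⟩
  · intro i
    fin_cases i
    exacts [f₁, f₂, f₃, f₄, f₅]
  intro ε v h
  have c107 : ((100 : ZMod 107) ^ 7 - 23 * 100 ^ 4 - 28 * 100 ^ 3 - 33 * 100 ^ 2 - 17 * 100 + 1 = 0) := by
    decide +kernel
  have e107 := congrArg (unitCharacter 107 100 c107) h
  rw [unitCharacter_sq (by norm_num) (by decide), map_prod, Fin.prod_univ_five] at e107
  simp only [map_pow, cons_val] at e107
  rw [unitCharacter_eq_of_matrix c107 (-1) h₁ (by decide +kernel),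
    unitCharacter_eq_of_matrix c107 1 h₂ (by decide +kernel),
    unitCharacter_eq_of_matrix c107 1 h₃ (by decide +kernel),
    unitCharacter_eq_of_matrix c107 1 h₄ (by decide +kernel),
    unitCharacter_eq_of_matrix c107 1 h₅ (by decide +kernel)] at e107
  have c17 : ((4 : ZMod 17) ^ 7 - 23 * 4 ^ 4 - 28 * 4 ^ 3 - 33 * 4 ^ 2 - 17 * 4 + 1 = 0) := by
    decide +kernel
  have e17 := congrArg (unitCharacter 17 4 c17) h
  rw [unitCharacter_sq (by norm_num) (by decide), map_prod, Fin.prod_univ_five] at e17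
  simp only [map_pow, cons_val] at e17
  rw [unitCharacter_eq_of_matrix c17 1 h₁ (by decide +kernel),
    unitCharacter_eq_of_matrix c17 1 h₂ (by decide +kernel),
    unitCharacter_eq_of_matrix c17 (-1) h₃ (by decide +kernel),
    unitCharacter_eq_of_matrix c17 1 h₄ (by decide +kernel),
    unitCharacter_eq_of_matrix c17 1 h₅ (by decide +kernel)] at e17
  have c97 : ((6 : ZMod 97) ^ 7 - 23 * 6 ^ 4 - 28 * 6 ^ 3 - 33 * 6 ^ 2 - 17 * 6 + 1 = 0) := by
    decide +kernel
  have e97 := congrArg (unitCharacter 97 6 c97) h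
  rw [unitCharacter_sq (by norm_num) (by decide), map_prod, Fin.prod_univ_five] at e97
  simp only [map_pow, cons_val] at e97
  rw [unitCharacter_eq_of_matrix c97 1 h₁ (by decide +kernel),
    unitCharacter_eq_of_matrix c97 1 h₂ (by decide +kernel),
    unitCharacter_eq_of_matrix c97 1 h₃ (by decide +kernel),
    unitCharacter_eq_of_matrix c97 (-1) h₄ (by decide +kernel),
    unitCharacter_eq_of_matrix c97 1 h₅ (by decide +kernel)] at e97
  have c101 : ((69 : ZMod 101) ^ 7 - 23 * 69 ^ 4 - 28 * 69 ^ 3 - 33 * 69 ^ 2 - 17 * 69 + 1 = 0) := by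
    decide +kernel
  have e101 := congrArg (unitCharacter 101 69 c101) h
  rw [unitCharacter_sq (by norm_num) (by decide), map_prod, Fin.prod_univ_five] at e101
  simp only [map_pow, cons_val] at e101
  rw [unitCharacter_eq_of_matrix c101 1 h₁ (by decide +kernel),
    unitCharacter_eq_of_matrix c101 (-1) h₂ (by decide +kernel),
    unitCharacter_eq_of_matrix c101 (-1) h₃ (by decide +kernel),
    unitCharacter_eq_of_matrix c101 1 h₄ (by decide +kernel),
    unitCharacter_eq_of_matrix c101 1 h₅ (by decide +kernel)] at e101
  have c41 : ((3 : ZMod 41) ^ 7 - 23 * 3 ^ 4 - 28 * 3 ^ 3 - 33 * 3 ^ 2 - 17 * 3 + 1 = 0) := by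
    decide +kernel
  have e41 := congrArg (unitCharacter 41 3 c41) h
  rw [unitCharacter_sq (by norm_num) (by decide), map_prod, Fin.prod_univ_five] at e41
  simp only [map_pow, cons_val] at e41
  rw [unitCharacter_eq_of_matrix c41 1 h₁ (by decide +kernel),
    unitCharacter_eq_of_matrix c41 (-1) h₂ (by decide +kernel),
    unitCharacter_eq_of_matrix c41 1 h₃ (by decide +kernel),
    unitCharacter_eq_of_matrix c41 1 h₄ (by decide +kernel),
    unitCharacter_eq_of_matrix c41 (-1) h₅ (by decide +kernel)] at e41
  have key : ∀ a b c d e : ZMod 2,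
      (-1 : ZMod 107) ^ a.val * (1 : ZMod 107) ^ b.val * (1 : ZMod 107) ^ c.val * (1 : ZMod 107) ^ d.val * (1 : ZMod 107) ^ e.val = 1 →
      (1 : ZMod 17) ^ a.val * (1 : ZMod 17) ^ b.val * (-1 : ZMod 17) ^ c.val * (1 : ZMod 17) ^ d.val * (1 : ZMod 17) ^ e.val = 1 →
      (1 : ZMod 97) ^ a.val * (1 : ZMod 97) ^ b.val * (1 : ZMod 97) ^ c.val * (-1 : ZMod 97) ^ d.val * (1 : ZMod 97) ^ e.val = 1 →
      (1 : ZMod 101) ^ a.val * (-1 : ZMod 101) ^ b.val * (-1 : ZMod 101) ^ c.val * (1 : ZMod 101) ^ d.val * (1 : ZMod 101) ^ e.val = 1 →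
      (1 : ZMod 41) ^ a.val * (-1 : ZMod 41) ^ b.val * (1 : ZMod 41) ^ c.val * (1 : ZMod 41) ^ d.val * (-1 : ZMod 41) ^ e.val = 1 →
      a = 0 ∧ b = 0 ∧ c = 0 ∧ d = 0 ∧ e = 0 := by
    decide +kernel
  obtain ⟨a, b, c, d, e⟩ := key _ _ _ _ _ e107 e17 e97 e101 e41
  refine _root_.funext fun i => ?_
  fin_cases i
  exacts [a, b, c, d, e]

/-- If the unit group has rank at most four then all units have trivial sign-gyration number. -/
theorem unitGyration_eq_one {H : Type*} [CommGroup H] (φ : (AdjoinRoot kimRoushPoly)ˣ →* H)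
    (hφ : Function.Injective φ) (γ : Fin 5 → H)
    (hγ : ∀ h, ∃ n : Fin 5 → ℤ, h = ∏ i, γ i ^ n i) (x : (AdjoinRoot kimRoushPoly)ˣ) :
    unitGyration x = 1 := by
  obtain ⟨u, hu, hind⟩ := exists_independent_units
  obtain ⟨ε, hε, v, hv⟩ := exists_prod_eq_sq φ hφ γ hγ (Fin.cons x u)
  rw [Fin.prod_univ_succ] at hv
  simp only [Fin.cons_zero, Fin.cons_succ] at hv
  have h01 : ∀ a : ZMod 2, a = 0 ∨ a = 1 := by decide
  rcases h01 (ε 0) with h0 | h0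
  · rw [h0, ZMod.val_zero, pow_zero, one_mul] at hv
    have h1 := hind (fun i => ε i.succ) v hv
    refine absurd (_root_.funext fun i => ?_) hε
    refine Fin.cases h0 (fun j => congrFun h1 j) i
  · rw [h0, ZMod.val_one, pow_one] at hv
    have h1 := congrArg unitGyration hv
    have h2 : ∀ y : Multiplicative (ZMod 2), y ^ 2 = 1 := by decide
    rw [map_mul, map_prod, map_pow, h2] at h1
    simpa only [map_pow, hu, one_pow, Finset.prod_const_one, mul_one] using h1

end

section

open Matrix Polynomial

theorem derivative_root_unique {s t : ℝ} (hs : 0 < s) (hst : s < t)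
    (h₁ : 7 * s ^ 6 - 92 * s ^ 3 - 84 * s ^ 2 - 66 * s - 17 = 0)
    (h₂ : 7 * t ^ 6 - 92 * t ^ 3 - 84 * t ^ 2 - 66 * t - 17 = 0) : False := by
  have ht : 0 < t := hs.trans hst
  have h : ∀ n ≠ 0, 0 < t ^ n - s ^ n := fun n hn => sub_pos.mpr (pow_lt_pow_left₀ hst hs.le hn)
  have h3 : 0 < 92 * (s ^ 3 * t ^ 3 * (t ^ 3 - s ^ 3)) + 84 * (s ^ 2 * t ^ 2 * (t ^ 4 - s ^ 4)) +
      66 * (s * t * (t ^ 5 - s ^ 5)) + 17 * (t ^ 6 - s ^ 6) := by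
    have := h 3 (by norm_num)
    have := h 4 (by norm_num)
    have := h 5 (by norm_num)
    have := h 6 (by norm_num)
    positivity
  refine h3.ne' ?_
  linear_combination s ^ 6 * h₂ - t ^ 6 * h₁

theorem negative_root_unique {s t : ℝ} (hs : s < 0) (hst : t < s)
    (h₁ : s ^ 7 - 23 * s ^ 4 - 28 * s ^ 3 - 33 * s ^ 2 - 17 * s + 1 = 0)
    (h₂ : t ^ 7 - 23 * t ^ 4 - 28 * t ^ 3 - 33 * t ^ 2 - 17 * t + 1 = 0) : False := by
  obtain ⟨s, rfl⟩ : ∃ a, s = -a := ⟨-s, by ring⟩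
  obtain ⟨t, rfl⟩ : ∃ a, t = -a := ⟨-t, by ring⟩
  have hs : 0 < s := by linarith
  have hst : s < t := by linarith
  have ht : 0 < t := hs.trans hst
  have h6 : 0 < t ^ 6 - s ^ 6 := sub_pos.mpr (pow_lt_pow_left₀ hst hs.le (by norm_num))
  have hq : 0 < 23 * (s ^ 2 + s * t + t ^ 2) - 28 * (s + t) + 33 := by
    nlinarith [sq_nonneg (s - t), sq_nonneg (s + t - 28 / 23 * (2 / 3))]
  have h3 : 0 < s * t * (t ^ 6 - s ^ 6) +
      s * t * ((t - s) * (23 * (s ^ 2 + s * t + t ^ 2) - 28 * (s + t) + 33)) + (t - s) := by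
    have := sub_pos.mpr hst
    positivity
  refine h3.ne' ?_
  linear_combination t * h₁ - s * h₂

theorem not_three_positive_roots {a b c : ℝ} (ha : 0 < a) (hab : a < b) (hbc : b < c)
    (h₁ : a ^ 7 - 23 * a ^ 4 - 28 * a ^ 3 - 33 * a ^ 2 - 17 * a + 1 = 0)
    (h₂ : b ^ 7 - 23 * b ^ 4 - 28 * b ^ 3 - 33 * b ^ 2 - 17 * b + 1 = 0)
    (h₃ : c ^ 7 - 23 * c ^ 4 - 28 * c ^ 3 - 33 * c ^ 2 - 17 * c + 1 = 0) : False := by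
  have hd : ∀ x : ℝ, HasDerivAt
      (fun x : ℝ => x ^ 7 - 23 * x ^ 4 - 28 * x ^ 3 - 33 * x ^ 2 - 17 * x + 1)
      (7 * x ^ 6 - 92 * x ^ 3 - 84 * x ^ 2 - 66 * x - 17) x := by
    intro x
    have := ((((((hasDerivAt_pow 7 x).sub ((hasDerivAt_pow 4 x).const_mul 23)).sub
      ((hasDerivAt_pow 3 x).const_mul 28)).sub ((hasDerivAt_pow 2 x).const_mul 33)).sub
      ((hasDerivAt_id x).const_mul 17)).add_const 1)
    refine this.congr_deriv ?_
    norm_num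
    ring
  have hc : Continuous
      (fun x : ℝ => x ^ 7 - 23 * x ^ 4 - 28 * x ^ 3 - 33 * x ^ 2 - 17 * x + 1) := by
    fun_prop
  obtain ⟨s, hs, hs'⟩ := exists_hasDerivAt_eq_zero hab hc.continuousOn (h₁.trans h₂.symm)
    fun x _ => hd x
  obtain ⟨t, ht, ht'⟩ := exists_hasDerivAt_eq_zero hbc hc.continuousOn (h₂.trans h₃.symm)
    fun x _ => hd x
  exact derivative_root_unique (ha.trans hs.1) (hs.2.trans ht.1) hs' ht'

theorem card_real_roots_le (S : Finset ℝ)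
    (hS : ∀ x ∈ S, x ^ 7 - 23 * x ^ 4 - 28 * x ^ 3 - 33 * x ^ 2 - 17 * x + 1 = 0) :
    S.card ≤ 3 := by
  have hneg : (S.filter fun x => ¬ 0 < x).card ≤ 1 := by
    have h0 : ∀ x ∈ S, ¬ 0 < x → x < 0 := by
      intro x hx h
      refine lt_of_le_of_ne (not_lt.mp h) ?_
      rintro rfl
      simpa using hS _ hx
    refine Finset.card_le_one.mpr fun x hx y hy => ?_
    obtain ⟨hx, hx0⟩ := Finset.mem_filter.mp hx
    obtain ⟨hy, hy0⟩ := Finset.mem_filter.mp hy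
    rcases lt_trichotomy x y with h | h | h
    · exact (negative_root_unique (h0 y hy hy0) h (hS y hy) (hS x hx)).elim
    · exact h
    · exact (negative_root_unique (h0 x hx hx0) h (hS x hx) (hS y hy)).elim
  have hpos : (S.filter fun x => 0 < x).card ≤ 2 := by
    by_contra! h
    obtain ⟨a, b, c, ha, hb, hc, hab, hac, hbc⟩ := Finset.two_lt_card_iff.mp h
    obtain ⟨ha, ha0⟩ := Finset.mem_filter.mp ha
    obtain ⟨hb, hb0⟩ := Finset.mem_filter.mp hb
    obtain ⟨hc, hc0⟩ := Finset.mem_filter.mp hc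
    replace ha := hS a ha
    replace hb := hS b hb
    replace hc := hS c hc
    rcases hab.lt_or_gt with h1 | h1 <;> rcases hac.lt_or_gt with h2 | h2 <;>
      rcases hbc.lt_or_gt with h3 | h3
    · exact not_three_positive_roots ha0 h1 h3 ha hb hc
    · exact not_three_positive_roots ha0 h2 h3 ha hc hb
    · linarith
    · exact not_three_positive_roots hc0 h2 h1 hc ha hb
    · exact not_three_positive_roots hb0 h1 h2 hb ha hc
    · linarith
    · exact not_three_positive_roots hb0 h3 h2 hb hc ha
    · exact not_three_positive_roots hc0 h3 h1 hc hb ha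
  have := S.card_filter_add_card_filter_not (fun x => 0 < x)
  omega

end

section

open Matrix Polynomial

/-- The companion matrix of `X ^ 3 + a X ^ 2 + b X + c`. -/
def cubicCompanion (a b c : ZMod 5) : Matrix (Fin 3) (Fin 3) (ZMod 5) :=
  !![0, 0, -c; 1, 0, -b; 0, 1, -a]

theorem cubicCompanion_root : ∀ a b c : ZMod 5, c • 1 + b • cubicCompanion a b c +
    a • cubicCompanion a b c ^ 2 + cubicCompanion a b c ^ 3 = 0 := by
  decide +kernel

theorem cubicCompanion_ne_zero : ∀ a b c : ZMod 5,
    cubicCompanion a b c ^ 2 * (cubicCompanion a b c ^ 7 - 23 * cubicCompanion a b c ^ 4 -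
      28 * cubicCompanion a b c ^ 3 - 33 * cubicCompanion a b c ^ 2 -
      17 * cubicCompanion a b c + 1) ≠ 0 := by
  decide +kernel

theorem irreducible_map_zmod_five :
    Irreducible (kimRoushPoly.map (Int.castRingHom (ZMod 5))) := by
  have : Fact (Nat.Prime 5) := ⟨Nat.prime_five⟩
  have hm := kimRoushPoly_monic.map (Int.castRingHom (ZMod 5))
  have hn : (kimRoushPoly.map (Int.castRingHom (ZMod 5))).natDegree = 7 := by
    rw [kimRoushPoly_monic.natDegree_map, kimRoushPoly_natDegree]
  rw [hm.irreducible_iff_lt_natDegree_lt (fun h => by rw [h] at hn; simp at hn)]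
  intro q hq hd hdvd
  rw [hn, Finset.mem_Ioc] at hd
  set Q := X ^ (3 - q.natDegree) * q with hQ
  have hQm : Q.Monic := (monic_X_pow _).mul hq
  have hQd : Q.natDegree = 3 := by
    rw [hQ, (monic_X_pow _).natDegree_mul hq, natDegree_X_pow]
    omega
  have hQdvd : Q ∣ X ^ 2 * kimRoushPoly.map (Int.castRingHom (ZMod 5)) :=
    mul_dvd_mul (pow_dvd_pow _ (by omega)) hdvd
  have h0 : aeval (cubicCompanion (Q.coeff 2) (Q.coeff 1) (Q.coeff 0)) Q = 0 := by
    rw [aeval_eq_sum_range, hQd, ← cubicCompanion_root (Q.coeff 2) (Q.coeff 1) (Q.coeff 0)]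
    have h3 : Q.coeff 3 = 1 := by rw [← hQd]; exact hQm
    simp [Finset.sum_range_succ, h3]
  obtain ⟨k, hk⟩ := hQdvd
  refine cubicCompanion_ne_zero (Q.coeff 2) (Q.coeff 1) (Q.coeff 0) ?_
  have h1 := congrArg (aeval (cubicCompanion (Q.coeff 2) (Q.coeff 1) (Q.coeff 0))) hk
  rw [map_mul, map_mul, h0, zero_mul] at h1
  simpa [kimRoushPoly, map_ofNat, aeval_map_algebraMap] using h1

theorem kimRoushPoly_irreducible : Irreducible kimRoushPoly := by
  have : Fact (Nat.Prime 5) := ⟨Nat.prime_five⟩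
  exact kimRoushPoly_monic.irreducible_of_irreducible_map (Int.castRingHom (ZMod 5)) _
    irreducible_map_zmod_five

theorem kimRoushPoly_map_rat_irreducible : Irreducible (kimRoushPoly.map (algebraMap ℤ ℚ)) :=
  (kimRoushPoly_monic.irreducible_iff_irreducible_map_fraction_map).mp kimRoushPoly_irreducible

end

section

open Polynomial NumberField

instance fact_irreducible : Fact (Irreducible (kimRoushPoly.map (algebraMap ℤ ℚ))) :=
  ⟨kimRoushPoly_map_rat_irreducible⟩

/-- The number field generated by a root of `kimRoushPoly`. -/
abbrev KimRoushField := AdjoinRoot (kimRoushPoly.map (algebraMap ℤ ℚ))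

theorem map_kimRoushPoly_monic : (kimRoushPoly.map (algebraMap ℤ ℚ)).Monic :=
  kimRoushPoly_monic.map _

noncomputable instance : Module.Finite ℚ KimRoushField :=
  map_kimRoushPoly_monic.finite_adjoinRoot

instance : NumberField KimRoushField where

theorem finrank_kimRoushField : Module.finrank ℚ KimRoushField = 7 := by
  rw [(AdjoinRoot.powerBasis map_kimRoushPoly_monic.ne_zero).finrank, AdjoinRoot.powerBasis_dim,
    kimRoushPoly_monic.natDegree_map, kimRoushPoly_natDegree]

theorem eval₂_kimRoushPoly {L : Type*} [CommRing L] (f : ℤ →+* L) (x : L) :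
    eval₂ f x kimRoushPoly = x ^ 7 - 23 * x ^ 4 - 28 * x ^ 3 - 33 * x ^ 2 - 17 * x + 1 := by
  simp only [kimRoushPoly, eval₂_add, eval₂_sub, eval₂_mul, eval₂_pow, eval₂_X, eval₂_ofNat,
    eval₂_one]

/-- The generator of `KimRoushField`. -/
noncomputable def kimRoushRoot : KimRoushField := AdjoinRoot.root _

theorem eval₂_kimRoushRoot (h : ℤ[X]) : eval₂ (Int.castRingHom _) kimRoushRoot h =
    AdjoinRoot.mk (kimRoushPoly.map (algebraMap ℤ ℚ)) (h.map (algebraMap ℤ ℚ)) := by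
  rw [← AdjoinRoot.aeval_eq, aeval_def, eval₂_map]
  exact congrArg (fun f => eval₂ f kimRoushRoot h) (RingHom.ext_int _ _)

theorem eval₂_kimRoushRoot_eq_zero :
    eval₂ (Int.castRingHom _) kimRoushRoot kimRoushPoly = 0 := by
  rw [eval₂_kimRoushRoot, AdjoinRoot.mk_self]

theorem rank_kimRoushField_le : Units.rank KimRoushField ≤ 4 := by
  classical
  have h7 := InfinitePlace.card_add_two_mul_card_eq_rank KimRoushField
  have hc := InfinitePlace.card_eq_nrRealPlaces_add_nrComplexPlaces KimRoushField
  have h3 : InfinitePlace.nrRealPlaces KimRoushField ≤ 3 := by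
    rw [← InfinitePlace.card_real_embeddings]
    let f : { φ : KimRoushField →+* ℂ // ComplexEmbedding.IsReal φ } → ℝ :=
      fun φ => φ.2.embedding kimRoushRoot
    have hf : Function.Injective f := by
      intro φ ψ h
      have h' := congrArg (fun x : ℝ => (x : ℂ)) h
      simp only [f, ComplexEmbedding.IsReal.coe_embedding_apply] at h'
      exact Subtype.ext (AdjoinRoot.ringHom_ext (RingHom.ext_rat _ _) h')
    rw [← Finset.card_univ, ← Finset.card_image_of_injective _ hf]
    refine card_real_roots_le _ fun x hx => ?_
    obtain ⟨φ, -, rfl⟩ := Finset.mem_image.mp hx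
    have h := congrArg φ.2.embedding eval₂_kimRoushRoot_eq_zero
    rwa [hom_eval₂, map_zero, eval₂_kimRoushPoly] at h
  rw [finrank_kimRoushField] at h7
  rw [Units.rank, hc]
  omega

/-- The generator of `KimRoushField`, as an algebraic integer. -/
noncomputable def kimRoushInteger : 𝓞 KimRoushField :=
  ⟨kimRoushRoot, kimRoushPoly, kimRoushPoly_monic, eval₂_kimRoushRoot_eq_zero⟩

theorem coe_eval₂_kimRoushInteger (h : ℤ[X]) :
    algebraMap (𝓞 KimRoushField) KimRoushField (eval₂ (Int.castRingHom _) kimRoushInteger h) =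
      eval₂ (Int.castRingHom _) kimRoushRoot h := by
  rw [hom_eval₂]
  exact congrArg (fun f => eval₂ f kimRoushRoot h) (RingHom.ext_int _ _)

/-- The embedding of `ℤ[X] / (kimRoushPoly)` in the ring of integers. -/
noncomputable def toIntegers : AdjoinRoot kimRoushPoly →+* 𝓞 KimRoushField :=
  AdjoinRoot.lift (Int.castRingHom _) kimRoushInteger <| by
    refine RingOfIntegers.coe_injective ?_
    rw [coe_eval₂_kimRoushInteger, map_zero, eval₂_kimRoushRoot_eq_zero]

theorem coe_toIntegers_mk (h : ℤ[X]) :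
    algebraMap (𝓞 KimRoushField) KimRoushField (toIntegers (AdjoinRoot.mk _ h)) =
      eval₂ (Int.castRingHom _) kimRoushRoot h := by
  rw [toIntegers, AdjoinRoot.lift_mk, coe_eval₂_kimRoushInteger]

theorem toIntegers_injective : Function.Injective toIntegers := by
  rw [injective_iff_map_eq_zero]
  intro x hx
  obtain ⟨h, rfl⟩ := AdjoinRoot.mk_surjective x
  have h1 := coe_toIntegers_mk h
  rw [hx, eval₂_kimRoushRoot, map_zero, eq_comm, AdjoinRoot.mk_eq_zero,
    map_dvd_map _ (algebraMap ℤ ℚ).injective_int kimRoushPoly_monic] at h1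
  exact AdjoinRoot.mk_eq_zero.mpr h1

theorem exists_units_generators : ∃ γ : Fin 5 → (𝓞 KimRoushField)ˣ,
    ∀ h, ∃ n : Fin 5 → ℤ, h = ∏ i, γ i ^ n i := by
  obtain ⟨ζ, hζ⟩ := IsCyclic.exists_generator (α := Units.torsion KimRoushField)
  let γ : ℕ → (𝓞 KimRoushField)ˣ := fun i =>
    if h : i < Units.rank KimRoushField then Units.fundSystem _ ⟨i, h⟩ else 1
  refine ⟨Fin.cons (ζ : (𝓞 KimRoushField)ˣ) fun i : Fin 4 => γ i, fun h => ?_⟩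
  obtain ⟨⟨ξ, e⟩, hξ, -⟩ := Units.exist_unique_eq_mul_prod KimRoushField h
  obtain ⟨m, hm⟩ := Subgroup.mem_zpowers_iff.mp (hζ ξ)
  let e' : ℕ → ℤ := fun i => if h : i < Units.rank KimRoushField then e ⟨i, h⟩ else 0
  refine ⟨Fin.cons m fun i : Fin 4 => e' i, ?_⟩
  rw [Fin.prod_univ_succ]
  simp only [Fin.cons_zero, Fin.cons_succ]
  rw [hξ, ← hm, Fin.prod_univ_eq_prod_range (fun i => γ i ^ e' i),
    ← Finset.prod_subset (Finset.range_subset_range.mpr rank_kimRoushField_le),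
    ← Fin.prod_univ_eq_prod_range (fun i => γ i ^ e' i)]
  · simp [γ, e']
  · intro i _ hi
    simp only [Finset.mem_range] at hi
    simp [γ, hi]

theorem unitGyration_trivial (x : (AdjoinRoot kimRoushPoly)ˣ) : unitGyration x = 1 := by
  obtain ⟨γ, hγ⟩ := exists_units_generators
  exact unitGyration_eq_one (Units.map toIntegers.toMonoidHom)
    (Units.map_injective toIntegers_injective) γ hγ x

end

theorem signGyration_eq_zero_of_commute {M M' : Matrix (Fin 7) (Fin 7) ℤ}
    (hM : M * Amat = Amat * M) (h₁ : M * M' = 1) (h₂ : M' * M = 1) :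
    signGyration M (M' * Amat) = 0 := by
  obtain ⟨x, -, rfl, rfl⟩ := exists_unit_of_matrix hM h₁ h₂
  exact unitGyration_trivial x

theorem not_isTriviallyFramed_Bmat : ¬ IsTriviallyFramed Amat BmatN := by
  intro h
  obtain ⟨W, W', h₁, h₂, hW, hs⟩ := h.exists_conj (B' := BmatInv)
    (by rw [map_BmatN]; exact Bmat_inv_mul)
  rw [map_BmatN] at hW hs
  have hR : Rmat * Amat = Bmat * Rmat := by
    rw [Amat_eq_mul, Bmat_eq_mul, Matrix.mul_assoc]
  have hu₁ : RmatInv * W * (W' * Rmat) = 1 := by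
    rw [Matrix.mul_assoc, ← Matrix.mul_assoc W, h₁, Matrix.one_mul, Rmat_inv_mul]
  have hu₂ : W' * Rmat * (RmatInv * W) = 1 := by
    rw [Matrix.mul_assoc, ← Matrix.mul_assoc Rmat, Rmat_mul_inv, Matrix.one_mul, h₂]
  have hRB : RmatInv * Bmat = Smat := by
    rw [Bmat_eq_mul, ← Matrix.mul_assoc, Rmat_inv_mul, Matrix.one_mul]
  have hu : RmatInv * W * Amat = Amat * (RmatInv * W) := by
    rw [Matrix.mul_assoc, ← hW, ← Matrix.mul_assoc, hRB, Amat_eq_mul, Matrix.mul_assoc,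
      ← Matrix.mul_assoc Rmat, Rmat_mul_inv, Matrix.one_mul]
  have key := signGyration_mul Rmat (RmatInv * W) (W' * Bmat)
  rw [← Matrix.mul_assoc Rmat, Rmat_mul_inv, Matrix.one_mul, hs, Matrix.mul_assoc RmatInv,
    ← Matrix.mul_assoc W, h₁, Matrix.one_mul, hRB, signGyration_Rmat_Smat, Matrix.mul_assoc W',
    ← hR, ← Matrix.mul_assoc W', signGyration_eq_zero_of_commute hu hu₁ hu₂] at key
  exact absurd key (by decide)

/-- The elementary strong shift equivalence over `ℤ` from `Amat` to `Bmat`. -/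
def intChain : SSEChain ℤ 1 where
  size _ := 7
  mat := ![Amat, Bmat]
  R _ := Smat
  S _ := Rmat
  hR i := by
    fin_cases i
    exact Amat_eq_mul
  hS i := by
    fin_cases i
    exact Bmat_eq_mul

/-- The Kim–Roush counterexample to the irreducible Williams conjecture:
(i) `A = SR`, `B = RS`, so `A` and `B` are strong shift equivalent over `ℤ`;
(ii) `A` and `B` are primitive; but
(iii) `A` and `B` are not strong shift equivalent over `ℕ`. -/
theorem williams_conjecture_false_irreducible :
    (Amat = Smat * Rmat ∧ Bmat = Rmat * Smat ∧
      ∃ (k : ℕ) (c : SSEChain ℤ k), c.From Amat Bmat) ∧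
    (∃ k > 0, ∀ i j, 0 < (Amat ^ k) i j) ∧
    (∃ k > 0, ∀ i j, 0 < (Bmat ^ k) i j) ∧
    (AmatN.map (Nat.cast : ℕ → ℤ) = Amat ∧ BmatN.map (Nat.cast : ℕ → ℤ) = Bmat) ∧
    ¬ ∃ (k : ℕ) (c : SSEChain ℕ k), c.From AmatN BmatN := by
  refine ⟨⟨Amat_eq_mul, Bmat_eq_mul, 1, intChain, rfl, rfl, rfl, rfl⟩, exists_pos_Amat_pow,
    exists_pos_Bmat_pow, ⟨map_AmatN, map_BmatN⟩, ?_⟩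
  rintro ⟨k, c, hc⟩
  have h := isTriviallyFramed_self AmatN (by decide +kernel) (by decide +kernel)
  rw [map_AmatN] at h
  exact not_isTriviallyFramed_Bmat (h.of_chain Amat_mul_inv Amat_inv_mul c hc)
end

section
/- Let A and B be the explicit 7×7 nonnegative integer matrices given in the context. Then A and B are shift equivalent over ℕ: there exist rectangular matrices U and V with entries in ℕ and a positive integer n such that UA = BU, AV = VB, UV = Bⁿ and VU = Aⁿ. -/
/-- The matrices `A` and `B` of the Kim–Roush counterexample are shift
equivalent over `ℕ`: there are matrices `U`, `V` over `ℕ` and `n ≥ 1` with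
`UA = BU`, `AV = VB`, `UV = Bⁿ` and `VU = Aⁿ`. -/
theorem A_B_shift_equivalent_over_N :
    ∃ (U V : Matrix (Fin 7) (Fin 7) ℕ) (n : ℕ), 0 < n ∧
      U * AmatN = BmatN * U ∧ AmatN * V = V * BmatN ∧
      U * V = BmatN ^ n ∧ V * U = AmatN ^ n := by
  refine ⟨
    !![79, 80, 81, 76, 99, 69, 84;
     7, 10, 11, 5, 84, 0, 69;
     5, 7, 10, 6, 69, 0, 0;
     3, 2, 4, 4, 0, 3, 0;
     75, 75, 98, 74, 523, 27, 33;
     324, 347, 375, 314, 1011, 238, 555;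
     135, 158, 209, 135, 1236, 33, 523],
    !![2, 2, 2, 1, 3, 0, 0;
     1, 2, 2, 1, 3, 0, 0;
     1, 1, 2, 1, 3, 0, 0;
     1, 1, 1, 1, 3, 0, 0;
     0, 0, 0, 0, 0, 0, 1;
     4, 5, 6, 3, 10, 0, 0;
     4, 5, 6, 3, 0, 1, 0],
    7, by norm_num, ?_, ?_, ?_, ?_⟩ <;> decide +kernel
end

section
/- Let A be the explicit 7×7 integer matrix given in the context. For every strong shift equivalence over ℤ from A to A, given by elementary strong shift equivalences (R₁,S₁), …, (R_k,S_k), the sum Σ_{i=1}^{k} sgc₂(Rᵢ,Sᵢ) equals 0 in ℤ/2ℤ. -/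
/-- The sign-gyration polynomial `sgc₂` of a pair `(R, S)` of rectangular
integer matrices, with values in `ℤ/2ℤ`. -/
def sgc2 {n p : ℕ} (R : Matrix (Fin n) (Fin p) ℤ) (S : Matrix (Fin p) (Fin n) ℤ) : ZMod 2 :=
  (((∑ i : Fin n, ∑ j : Fin n, ∑ k : Fin p, ∑ l : Fin p,
      if i < j ∧ l < k then R i k * S k i * R j l * S l j else 0)
    + (∑ i : Fin n, ∑ j : Fin n, ∑ k : Fin p, ∑ l : Fin p,
      if i < j ∧ l ≤ k then R i k * S k j * R j l * S l i else 0)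
    + (∑ i : Fin n, ∑ k : Fin p, (R i k * (R i k - 1)) / 2 * (S k i) ^ 2) : ℤ) : ZMod 2)

namespace SgcTwo

open Finset Matrix

/-- The reduction mod 2 of the binomial coefficient `x.choose 2`. -/
def binomTwo (x : ℤ) : ZMod 2 := ((x * (x - 1) / 2 : ℤ) : ZMod 2)

theorem two_mul_half_mul_pred (x : ℤ) : 2 * (x * (x - 1) / 2) = x * (x - 1) :=
  Int.mul_ediv_cancel' (Int.even_mul_pred_self x).two_dvd

theorem zmod_two_sq (x : ZMod 2) : x ^ 2 = x := by
  revert x; decide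

theorem binomTwo_add (x y : ℤ) :
    binomTwo (x + y) = binomTwo x + binomTwo y + (x : ZMod 2) * y := by
  have h : (x + y) * (x + y - 1) / 2 = x * (x - 1) / 2 + y * (y - 1) / 2 + x * y := by
    have h1 := two_mul_half_mul_pred x
    have h2 := two_mul_half_mul_pred y
    have h3 := two_mul_half_mul_pred (x + y)
    linarith
  simp [binomTwo, h]

theorem binomTwo_mul (x y : ℤ) :
    binomTwo (x * y) = (y : ZMod 2) * binomTwo x + (x : ZMod 2) * binomTwo y := by
  have h : x * y * (x * y - 1) / 2 = y ^ 2 * (x * (x - 1) / 2) + x * (y * (y - 1) / 2) := by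
    have h1 := two_mul_half_mul_pred x
    have h2 := two_mul_half_mul_pred y
    have h3 := two_mul_half_mul_pred (x * y)
    refine mul_left_cancel₀ (two_ne_zero' ℤ) ?_
    linear_combination h3 - y ^ 2 * h1 - x * h2
  simp [binomTwo, h]

theorem binomTwo_sum {p : ℕ} (x : Fin p → ℤ) :
    binomTwo (∑ k, x k) = ∑ k, binomTwo (x k) +
      ∑ k, ∑ k', if k < k' then (x k : ZMod 2) * x k' else 0 := by
  induction p with
  | zero => simp [binomTwo]
  | succ p ih =>
    simp only [Fin.sum_univ_succ, binomTwo_add, ih]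
    simp [Fin.succ_pos, mul_sum]
    ring

theorem sum_sum_eq_zero_of_symm {p : ℕ} {f : Fin p → Fin p → ZMod 2} (h : ∀ i, f i i = 0)
    (h' : ∀ i j, i < j → f i j + f j i = 0) : ∑ i, ∑ j, f i j = 0 := by
  have e : ∀ i j, f i j = f j i := by
    intro i j
    rcases lt_trichotomy i j with hij | hij | hij
    · exact CharTwo.add_eq_zero.1 (h' i j hij)
    · rw [hij]
    · exact (CharTwo.add_eq_zero.1 (h' j i hij)).symm
  induction p with
  | zero => simp
  | succ p ih =>
    rw [Fin.sum_univ_succ]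
    simp only [Fin.sum_univ_succ (f := fun j => f _ j), h, sum_add_distrib]
    rw [ih (f := fun i j => f i.succ j.succ) (fun i => h _)
      (fun i j hij => h' _ _ (Fin.succ_lt_succ_iff.2 hij)) (fun i j => e _ _)]
    simp only [e _ 0]
    simp [CharTwo.add_self_eq_zero]

theorem sgc2_eq {n p : ℕ} (R : Matrix (Fin n) (Fin p) ℤ) (S : Matrix (Fin p) (Fin n) ℤ) :
    sgc2 R S = (∑ i, ∑ j, ∑ k, ∑ l,
        if i < j ∧ l < k then (R i k : ZMod 2) * S k i * R j l * S l j else 0)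
      + (∑ i, ∑ j, ∑ k, ∑ l,
        if i < j ∧ l ≤ k then (R i k : ZMod 2) * S k j * R j l * S l i else 0)
      + ∑ i, ∑ k, binomTwo (R i k) * (S k i : ZMod 2) := by
  simp only [sgc2, binomTwo, Int.cast_add, Int.cast_sum, Int.cast_mul, Int.cast_pow, zmod_two_sq,
    apply_ite (Int.cast : ℤ → ZMod 2), Int.cast_zero]

section Triangle

variable {n p q : ℕ} (a : Fin n → Fin p → ZMod 2) (b : Fin p → Fin q → ZMod 2)
  (s : Fin q → Fin n → ZMod 2)

set_option linter.unusedSimpArgs false in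
theorem triangle_combinatorial :
    ∑ i, ∑ j, ∑ k, ∑ k', ∑ m, ∑ m',
      ((if i < j ∧ m' < m then a i k * b k m * s m i * (a j k' * b k' m') * s m' j else 0)
      + (if i < j ∧ m' ≤ m then a i k * b k m * s m j * (a j k' * b k' m') * s m' i else 0)
      + (if i = j ∧ m = m' ∧ k < k' then
          a i k * b k m * s m i * (a j k' * b k' m') * s m' j else 0)
      + (if i < j ∧ k' < k then a i k * (b k m * s m i) * a j k' * (b k' m' * s m' j) else 0)
      + (if i < j ∧ k' ≤ k then a i k * (b k m * s m j) * a j k' * (b k' m' * s m' i) else 0)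
      + (if k < k' ∧ m' < m then b k m * (s m i * a i k) * b k' m' * (s m' j * a j k') else 0)
      + (if k < k' ∧ m' ≤ m then b k m * (s m j * a j k') * b k' m' * (s m' i * a i k) else 0))
      = 0 := by
  have two : (2 : ZMod 2) = 0 := rfl
  have four : (4 : ZMod 2) = 0 := rfl
  refine sum_sum_eq_zero_of_symm (fun i => ?_) (fun i j hij => ?_)
  · refine sum_sum_eq_zero_of_symm (fun k => ?_) (fun k k' hk => ?_)
    · refine sum_sum_eq_zero_of_symm (fun m => ?_) (fun m m' hm => ?_)
      · simp
      · simp [hm.ne, hm.ne', hm.le, hm.not_gt, hm.not_ge, hm]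
    · simp only [← sum_add_distrib]
      refine sum_sum_eq_zero_of_symm (fun m => ?_) (fun m m' hm => ?_)
      · simp [hk.ne, hk.ne', hk.le, hk.not_gt, hk.not_ge, hk]
        linear_combination (a i k * b k m * s m i * a i k' * b k' m * s m i) * two
      · simp [hk.ne, hk.ne', hk.le, hk.not_gt, hk.not_ge, hk,
          hm.ne, hm.ne', hm.le, hm.not_gt, hm.not_ge, hm]
        ring_nf
        simp [two, four]
  · simp only [← sum_add_distrib]
    refine sum_sum_eq_zero_of_symm (fun k => ?_) (fun k k' hk => ?_)
    · refine sum_sum_eq_zero_of_symm (fun m => ?_) (fun m m' hm => ?_)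
      · simp [hij.ne, hij.ne', hij.le, hij.not_gt, hij.not_ge, hij]
        ring_nf
        simp [two, four]
      · simp [hij.ne, hij.ne', hij.le, hij.not_gt, hij.not_ge, hij,
          hm.ne, hm.ne', hm.le, hm.not_gt, hm.not_ge, hm]
        ring_nf
        simp [two, four]
    · simp only [← sum_add_distrib]
      refine sum_sum_eq_zero_of_symm (fun m => ?_) (fun m m' hm => ?_)
      · simp [hij.ne, hij.ne', hij.le, hij.not_gt, hij.not_ge, hij,
          hk.ne, hk.ne', hk.le, hk.not_gt, hk.not_ge, hk]
        ring_nf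
        simp [two, four]
      · simp [hij.ne, hij.ne', hij.le, hij.not_gt, hij.not_ge, hij,
          hk.ne, hk.ne', hk.le, hk.not_gt, hk.not_ge, hk,
          hm.ne, hm.ne', hm.le, hm.not_gt, hm.not_ge, hm]
        ring_nf
        simp [two, four]

end Triangle

section Expand

variable {α β γ : Type*} [Fintype α] [Fintype β] [Fintype γ] {M : Type*} [CommSemiring M]

theorem sum_comm_four (f : γ → α → α → β → β → M) :
    ∑ x, ∑ k, ∑ k', ∑ m, ∑ m', f x k k' m m' = ∑ k, ∑ k', ∑ m, ∑ m', ∑ x, f x k k' m m' := by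
  rw [sum_comm]
  refine sum_congr rfl fun k _ => ?_
  rw [sum_comm]
  refine sum_congr rfl fun k' _ => ?_
  rw [sum_comm]
  exact sum_congr rfl fun m _ => sum_comm

theorem sum_ite_left_expand (P : β → β → Prop) [∀ m m', Decidable (P m m')] (u v : α → β → M)
    (c d : β → M) :
    ∑ m, ∑ m', (if P m m' then (∑ k, u k m) * c m * (∑ k', v k' m') * d m' else 0) =
      ∑ k, ∑ k', ∑ m, ∑ m', if P m m' then u k m * c m * v k' m' * d m' else 0 := by
  have h : ∀ m m', (if P m m' then (∑ k, u k m) * c m * (∑ k', v k' m') * d m' else 0) =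
      ∑ k, ∑ k', if P m m' then u k m * c m * v k' m' * d m' else 0 := by
    intro m m'
    split_ifs
    · simp only [sum_mul, mul_sum]
      exact sum_comm
    · simp
  simp only [h]
  calc _ = ∑ m, ∑ k, ∑ m', ∑ k', _ := sum_congr rfl fun m _ => sum_comm
    _ = ∑ k, ∑ m, ∑ m', ∑ k', _ := sum_comm
    _ = ∑ k, ∑ m, ∑ k', ∑ m', _ :=
        sum_congr rfl fun k _ => sum_congr rfl fun m _ => sum_comm
    _ = _ := sum_congr rfl fun k _ => sum_comm

theorem sum_ite_right_expand (P : α → α → Prop) [∀ k k', Decidable (P k k')] (u v : α → β → M)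
    (c d : α → M) :
    ∑ k, ∑ k', (if P k k' then c k * (∑ m, u k m) * d k' * (∑ m', v k' m') else 0) =
      ∑ k, ∑ k', ∑ m, ∑ m', if P k k' then c k * u k m * d k' * v k' m' else 0 := by
  refine sum_congr rfl fun k _ => sum_congr rfl fun k' _ => ?_
  split_ifs
  · simp only [sum_mul, mul_sum]
    exact sum_comm
  · simp

theorem sum_ite_outer_expand (P : α → α → β → β → Prop)
    [∀ k k' m m', Decidable (P k k' m m')] (c : α → β → M)
    (u v : γ → α → α → β → β → M) :
    ∑ k, ∑ k', ∑ m, ∑ m', (if P k k' m m' then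
      c k m * (∑ i, u i k k' m m') * c k' m' * (∑ j, v j k k' m m') else 0) =
      ∑ i, ∑ j, ∑ k, ∑ k', ∑ m, ∑ m', if P k k' m m' then
        c k m * u i k k' m m' * c k' m' * v j k k' m m' else 0 := by
  rw [sum_congr rfl fun i _ => sum_comm_four _, sum_comm_four]
  refine sum_congr rfl fun k _ => sum_congr rfl fun k' _ => sum_congr rfl fun m _ =>
    sum_congr rfl fun m' _ => ?_
  split_ifs
  · simp only [sum_mul, mul_sum]
    exact sum_comm
  · simp

end Expand

/-- The triangle identity: `sgc2` is additive along factorizations through an intermediate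
matrix. -/
theorem sgc2_triangle {n p q : ℕ} (R₁ : Matrix (Fin n) (Fin p) ℤ) (R₂ : Matrix (Fin p) (Fin q) ℤ)
    (S : Matrix (Fin q) (Fin n) ℤ) :
    sgc2 (R₁ * R₂) S = sgc2 R₁ (R₂ * S) + sgc2 R₂ (S * R₁) := by
  have key := triangle_combinatorial (fun i k => (R₁ i k : ZMod 2)) (fun k m => (R₂ k m : ZMod 2))
    (fun m i => (S m i : ZMod 2))
  simp only [sum_add_distrib] at key
  have hbin : ∑ i, ∑ m, binomTwo ((R₁ * R₂) i m) * (S m i : ZMod 2) =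
      ∑ i, ∑ k, binomTwo (R₁ i k) * ((R₂ * S) k i : ZMod 2) +
      ∑ k, ∑ m, binomTwo (R₂ k m) * ((S * R₁) m k : ZMod 2) +
      ∑ i, ∑ j, ∑ k, ∑ k', ∑ m, ∑ m', if i = j ∧ m = m' ∧ k < k' then
        (R₁ i k : ZMod 2) * R₂ k m * S m i * (R₁ j k' * R₂ k' m') * S m' j else 0 := by
    have e1 : ∑ i, ∑ k, binomTwo (R₁ i k) * ((R₂ * S) k i : ZMod 2) =
        ∑ i, ∑ m, ∑ k, (R₂ k m : ZMod 2) * binomTwo (R₁ i k) * S m i := by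
      refine sum_congr rfl fun i _ => ?_
      rw [sum_comm]
      refine sum_congr rfl fun k _ => ?_
      simp only [mul_apply, Int.cast_sum, Int.cast_mul, mul_sum]
      exact sum_congr rfl fun m _ => by ring
    have e2 : ∑ k, ∑ m, binomTwo (R₂ k m) * ((S * R₁) m k : ZMod 2) =
        ∑ i, ∑ m, ∑ k, (R₁ i k : ZMod 2) * binomTwo (R₂ k m) * S m i := by
      calc _ = ∑ k, ∑ m, ∑ i, (R₁ i k : ZMod 2) * binomTwo (R₂ k m) * S m i := by
            refine sum_congr rfl fun k _ => sum_congr rfl fun m _ => ?_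
            simp only [mul_apply, Int.cast_sum, Int.cast_mul, mul_sum]
            exact sum_congr rfl fun i _ => by ring
        _ = ∑ m, ∑ k, ∑ i, _ := sum_comm
        _ = ∑ m, ∑ i, ∑ k, _ := sum_congr rfl fun m _ => sum_comm
        _ = _ := sum_comm
    have e3 : (∑ i, ∑ j, ∑ k, ∑ k', ∑ m, ∑ m', if i = j ∧ m = m' ∧ k < k' then
        (R₁ i k : ZMod 2) * R₂ k m * S m i * (R₁ j k' * R₂ k' m') * S m' j else 0) =
        ∑ i, ∑ m, ∑ k, ∑ k', (if k < k' then
          ((R₁ i k * R₂ k m : ℤ) : ZMod 2) * ((R₁ i k' * R₂ k' m : ℤ) : ZMod 2) else 0) *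
            S m i := by
      refine sum_congr rfl fun i _ => ?_
      rw [Fintype.sum_eq_single i (fun j hj => by simp [hj.symm])]
      rw [sum_comm (s := univ (α := Fin q))]
      refine sum_congr rfl fun k _ => ?_
      rw [sum_comm (s := univ (α := Fin q))]
      refine sum_congr rfl fun k' _ => sum_congr rfl fun m _ => ?_
      rw [Fintype.sum_eq_single m (fun j hj => by simp [hj.symm])]
      have hs := zmod_two_sq (S m i : ZMod 2)
      by_cases hk : k < k'
      · simp only [hk, and_self, if_true, Int.cast_mul]
        linear_combination (R₁ i k * R₂ k m * (R₁ i k' * R₂ k' m) : ZMod 2) * hs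
      · simp [hk]
    rw [e1, e2, e3]
    simp only [mul_apply, binomTwo_sum, binomTwo_mul, sum_add_distrib, add_mul, sum_mul]
  rw [sgc2_eq, sgc2_eq, sgc2_eq, hbin]
  have f1 : (∑ i, ∑ j, ∑ m, ∑ m', if i < j ∧ m' < m then
      ((R₁ * R₂) i m : ZMod 2) * S m i * ((R₁ * R₂) j m' : ℤ) * S m' j else 0) =
      ∑ i, ∑ j, ∑ k, ∑ k', ∑ m, ∑ m', if i < j ∧ m' < m then
        (R₁ i k : ZMod 2) * R₂ k m * S m i * (R₁ j k' * R₂ k' m') * S m' j else 0 := by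
    simp only [mul_apply, Int.cast_sum, Int.cast_mul]
    refine sum_congr rfl fun i _ => sum_congr rfl fun j _ => ?_
    exact sum_ite_left_expand (fun m m' => i < j ∧ m' < m) _ _ _ _
  have f2 : (∑ i, ∑ j, ∑ m, ∑ m', if i < j ∧ m' ≤ m then
      ((R₁ * R₂) i m : ZMod 2) * S m j * ((R₁ * R₂) j m' : ℤ) * S m' i else 0) =
      ∑ i, ∑ j, ∑ k, ∑ k', ∑ m, ∑ m', if i < j ∧ m' ≤ m then
        (R₁ i k : ZMod 2) * R₂ k m * S m j * (R₁ j k' * R₂ k' m') * S m' i else 0 := by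
    simp only [mul_apply, Int.cast_sum, Int.cast_mul]
    refine sum_congr rfl fun i _ => sum_congr rfl fun j _ => ?_
    exact sum_ite_left_expand (fun m m' => i < j ∧ m' ≤ m) _ _ _ _
  have f3 : (∑ i, ∑ j, ∑ k, ∑ k', if i < j ∧ k' < k then
      (R₁ i k : ZMod 2) * ((R₂ * S) k i : ℤ) * R₁ j k' * ((R₂ * S) k' j : ℤ) else 0) =
      ∑ i, ∑ j, ∑ k, ∑ k', ∑ m, ∑ m', if i < j ∧ k' < k then
        (R₁ i k : ZMod 2) * (R₂ k m * S m i) * R₁ j k' * (R₂ k' m' * S m' j) else 0 := by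
    simp only [mul_apply, Int.cast_sum, Int.cast_mul]
    refine sum_congr rfl fun i _ => sum_congr rfl fun j _ => ?_
    exact sum_ite_right_expand (fun k k' => i < j ∧ k' < k) _ _ _ _
  have f4 : (∑ i, ∑ j, ∑ k, ∑ k', if i < j ∧ k' ≤ k then
      (R₁ i k : ZMod 2) * ((R₂ * S) k j : ℤ) * R₁ j k' * ((R₂ * S) k' i : ℤ) else 0) =
      ∑ i, ∑ j, ∑ k, ∑ k', ∑ m, ∑ m', if i < j ∧ k' ≤ k then
        (R₁ i k : ZMod 2) * (R₂ k m * S m j) * R₁ j k' * (R₂ k' m' * S m' i) else 0 := by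
    simp only [mul_apply, Int.cast_sum, Int.cast_mul]
    refine sum_congr rfl fun i _ => sum_congr rfl fun j _ => ?_
    exact sum_ite_right_expand (fun k k' => i < j ∧ k' ≤ k) _ _ _ _
  have f5 : (∑ k, ∑ k', ∑ m, ∑ m', if k < k' ∧ m' < m then
      (R₂ k m : ZMod 2) * ((S * R₁) m k : ℤ) * R₂ k' m' * ((S * R₁) m' k' : ℤ) else 0) =
      ∑ i, ∑ j, ∑ k, ∑ k', ∑ m, ∑ m', if k < k' ∧ m' < m then
        (R₂ k m : ZMod 2) * (S m i * R₁ i k) * R₂ k' m' * (S m' j * R₁ j k') else 0 := by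
    simp only [mul_apply, Int.cast_sum, Int.cast_mul]
    exact sum_ite_outer_expand (fun k k' m m' => k < k' ∧ m' < m)
      (fun k m => (R₂ k m : ZMod 2)) (fun i k _ m _ => (S m i : ZMod 2) * R₁ i k)
      (fun j _ k' _ m' => (S m' j : ZMod 2) * R₁ j k')
  have f6 : (∑ k, ∑ k', ∑ m, ∑ m', if k < k' ∧ m' ≤ m then
      (R₂ k m : ZMod 2) * ((S * R₁) m k' : ℤ) * R₂ k' m' * ((S * R₁) m' k : ℤ) else 0) =
      ∑ i, ∑ j, ∑ k, ∑ k', ∑ m, ∑ m', if k < k' ∧ m' ≤ m then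
        (R₂ k m : ZMod 2) * (S m j * R₁ j k') * R₂ k' m' * (S m' i * R₁ i k) else 0 := by
    simp only [mul_apply, Int.cast_sum, Int.cast_mul]
    rw [sum_comm (s := univ (α := Fin n))]
    exact sum_ite_outer_expand (fun k k' m m' => k < k' ∧ m' ≤ m)
      (fun k m => (R₂ k m : ZMod 2)) (fun j _ k' m _ => (S m j : ZMod 2) * R₁ j k')
      (fun i k _ _ m' => (S m' i : ZMod 2) * R₁ i k)
  rw [f1, f2, f3, f4, f5, f6]
  have two : (2 : ZMod 2) = 0 := rfl
  generalize (∑ i, ∑ j, ∑ k, ∑ k', ∑ m, ∑ m', if i < j ∧ k' < k then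
    (R₁ i k : ZMod 2) * (R₂ k m * S m i) * R₁ j k' * (R₂ k' m' * S m' j) else 0) = x₁ at key ⊢
  generalize (∑ i, ∑ j, ∑ k, ∑ k', ∑ m, ∑ m', if i < j ∧ k' ≤ k then
    (R₁ i k : ZMod 2) * (R₂ k m * S m j) * R₁ j k' * (R₂ k' m' * S m' i) else 0) = x₂ at key ⊢
  generalize (∑ i, ∑ j, ∑ k, ∑ k', ∑ m, ∑ m', if k < k' ∧ m' < m then
    (R₂ k m : ZMod 2) * (S m i * R₁ i k) * R₂ k' m' * (S m' j * R₁ j k') else 0) = x₃ at key ⊢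
  generalize (∑ i, ∑ j, ∑ k, ∑ k', ∑ m, ∑ m', if k < k' ∧ m' ≤ m then
    (R₂ k m : ZMod 2) * (S m j * R₁ j k') * R₂ k' m' * (S m' i * R₁ i k) else 0) = x₄ at key ⊢
  linear_combination key - (x₁ + x₂ + x₃ + x₄) * two

theorem sgc2_one_left {n : ℕ} (A : Matrix (Fin n) (Fin n) ℤ) : sgc2 1 A = 0 := by
  have h := sgc2_triangle (1 : Matrix (Fin n) (Fin n) ℤ) 1 A
  simpa using h

/-- A factorization of an integer matrix through its image: `I` has linearly independent columns
and `M` is split surjective. -/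
structure ImageFac {n p : ℕ} (A : Matrix (Fin n) (Fin p) ℤ) where
  r : ℕ
  I : Matrix (Fin n) (Fin r) ℤ
  M : Matrix (Fin r) (Fin p) ℤ
  Z : Matrix (Fin p) (Fin r) ℤ
  mul_eq : I * M = A
  right_inv : M * Z = 1
  cancel : ∀ {q : ℕ} {X Y : Matrix (Fin r) (Fin q) ℤ}, I * X = I * Y → X = Y

theorem exists_imageFac {n p : ℕ} (A : Matrix (Fin n) (Fin p) ℤ) : Nonempty (ImageFac A) := by
  obtain ⟨r, b⟩ := Submodule.basisOfPid (Pi.basisFun ℤ (Fin n)) (LinearMap.range A.mulVecLin)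
  have hz : ∀ j, ∃ z : Fin p → ℤ, A *ᵥ z = (b j : Fin n → ℤ) := fun j => (b j).2
  choose z hz using hz
  let I : Matrix (Fin n) (Fin r) ℤ := of fun i j => (b j : Fin n → ℤ) i
  let M : Matrix (Fin r) (Fin p) ℤ := of fun k j =>
    b.equivFun ⟨A *ᵥ Pi.single j 1, Pi.single j 1, rfl⟩ k
  let Z : Matrix (Fin p) (Fin r) ℤ := of fun i j => z j i
  have hI : ∀ x : Fin r → ℤ, I *ᵥ x = (b.equivFun.symm x : Fin n → ℤ) := by
    intro x
    ext i
    simp [I, mulVec, dotProduct, Module.Basis.equivFun_symm_apply, mul_comm]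
  have hcancel : ∀ {q : ℕ} {X Y : Matrix (Fin r) (Fin q) ℤ}, I * X = I * Y → X = Y := by
    intro q X Y h
    ext k j
    have h1 : I *ᵥ X.col j = I *ᵥ Y.col j := by
      ext i
      exact congrFun (congrFun h i) j
    rw [hI, hI] at h1
    exact congrFun (b.equivFun.symm.injective (Subtype.ext h1)) k
  have hIM : I * M = A := by
    ext i j
    have h1 : I *ᵥ M.col j = A *ᵥ Pi.single j 1 := by
      rw [hI]
      exact congrArg Subtype.val (b.equivFun.symm_apply_apply _)
    have h2 := congrFun h1 i
    rw [mulVec_single_one] at h2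
    exact h2
  have hAZ : A * Z = I := by
    ext i j
    exact congrFun (hz j) i
  exact ⟨⟨r, I, M, Z, hIM, hcancel (by rw [← Matrix.mul_assoc, hIM, hAZ, Matrix.mul_one]),
    hcancel⟩⟩

/-- An elementary strong shift equivalence restricts to the images, compatibly with `sgc2`. -/
theorem ImageFac.exists_restrict {n p : ℕ} {R : Matrix (Fin n) (Fin p) ℤ}
    {S : Matrix (Fin p) (Fin n) ℤ} (F : ImageFac (R * S)) (F' : ImageFac (S * R)) :
    ∃ (R' : Matrix (Fin F.r) (Fin F'.r) ℤ) (S' : Matrix (Fin F'.r) (Fin F.r) ℤ),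
      F.M * F.I = R' * S' ∧ S' * R' = F'.M * F'.I ∧ F.I * R' = R * F'.I ∧
      sgc2 R S + sgc2 F'.I F'.M = sgc2 F.I F.M + sgc2 R' S' := by
  obtain ⟨r, I, M, Z, hA, hMZ, hI⟩ := F
  obtain ⟨r', I', M', Z', hB, hMZ', hI'⟩ := F'
  obtain ⟨s, J, K, L, hR, hKL, hJ⟩ := (exists_imageFac R).some
  obtain ⟨t, I'', M'', Z'', hW, hMZ'', hI''⟩ := (exists_imageFac (K * S * J)).some
  dsimp only
  have hJH : J * (K * S * Z) = I := by
    rw [← Matrix.mul_assoc, ← Matrix.mul_assoc, hR, ← hA, Matrix.mul_assoc, hMZ, Matrix.mul_one]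
  generalize K * S * Z = H at hJH
  have hHM : H * M = K * S := hJ (by
    rw [← Matrix.mul_assoc, hJH, hA, ← Matrix.mul_assoc, hR])
  have hH : ∀ {q : ℕ} {X Y : Matrix (Fin r) (Fin q) ℤ}, H * X = H * Y → X = Y := by
    intro q X Y h
    apply hI
    rw [← hJH, Matrix.mul_assoc, h, Matrix.mul_assoc]
  have hHG : H * (M * J * Z'') = I'' := by
    rw [← Matrix.mul_assoc, ← Matrix.mul_assoc, hHM, ← hW, Matrix.mul_assoc, hMZ'', Matrix.mul_one]
  generalize M * J * Z'' = G at hHG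
  have hGM : G * M'' = M * J := hH (by
    rw [← Matrix.mul_assoc, hHG, hW, ← Matrix.mul_assoc, hHM])
  have hID : I'' * (M'' * K * Z') = K * I' := by
    rw [← Matrix.mul_assoc, ← Matrix.mul_assoc, hW, Matrix.mul_assoc (K * S), hR,
      Matrix.mul_assoc K, ← hB, Matrix.mul_assoc, Matrix.mul_assoc, hMZ', Matrix.mul_one]
  generalize M'' * K * Z' = D at hID
  have hIP : I' * (M' * L) = S * J := by
    rw [← Matrix.mul_assoc, hB, ← hR, Matrix.mul_assoc, Matrix.mul_assoc, hKL, Matrix.mul_one]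
  generalize M' * L = P at hIP
  have hPK : P * K = M' := hI' (by rw [← Matrix.mul_assoc, hIP, hB, Matrix.mul_assoc, hR])
  have hDP : D * P = M'' := hI'' (by
    rw [← Matrix.mul_assoc, hID, hW, Matrix.mul_assoc, hIP, ← Matrix.mul_assoc])
  have h₁ : M * I = G * D * (P * H) := by
    rw [← hJH, ← Matrix.mul_assoc, ← hGM, ← hDP]
    simp only [Matrix.mul_assoc]
  have h₂ : P * H * (G * D) = M' * I' := by
    rw [← hPK, Matrix.mul_assoc P K, ← hID, ← hHG]
    simp only [Matrix.mul_assoc]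
  have h₃ : I * (G * D) = R * I' := by
    rw [← hR, Matrix.mul_assoc J K, ← hID, ← hHG, ← hJH]
    simp only [Matrix.mul_assoc]
  have h₄ : sgc2 R S + sgc2 I' M' = sgc2 I M + sgc2 (G * D) (P * H) := by
    have t₁ := sgc2_triangle J H M
    have t₂ := sgc2_triangle H G M''
    have t₃ := sgc2_triangle K I' P
    have t₄ := sgc2_triangle I'' D P
    have t₅ := sgc2_triangle J K S
    have t₆ := sgc2_triangle G D (P * H)
    rw [hJH, hHM] at t₁
    rw [hHG, hGM] at t₂
    rw [hIP, hPK] at t₃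
    rw [hID, hDP] at t₄
    rw [hR] at t₅
    rw [← Matrix.mul_assoc, hDP, Matrix.mul_assoc, hHG] at t₆
    rw [t₁, t₅, t₆]
    linear_combination -t₃ + t₄ + t₂
  exact ⟨G * D, P * H, h₁, h₂, h₃, h₄⟩

/-- `SSEPath k A C Q z` says that there is a chain of `k` elementary strong shift equivalences from
`A` to a matrix isomorphic to `C` such that `Q` is the product of its left factors (and the
isomorphism) and `z` the sum of its `sgc2` values. -/
def SSEPath : ℕ → ∀ {n m : ℕ}, Matrix (Fin n) (Fin n) ℤ → Matrix (Fin m) (Fin m) ℤ →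
    Matrix (Fin n) (Fin m) ℤ → ZMod 2 → Prop
  | 0, n, m, A, C, Q, z => ∃ U V : Matrix (Fin m) (Fin n) ℤ,
      Q * U = A ∧ U * Q = C ∧ Q * V = 1 ∧ z = sgc2 Q U
  | k + 1, n, m, A, C, Q, z => ∃ (p : ℕ) (R : Matrix (Fin n) (Fin p) ℤ)
      (S : Matrix (Fin p) (Fin n) ℤ) (Q' : Matrix (Fin p) (Fin m) ℤ) (z' : ZMod 2),
      R * S = A ∧ Q = R * Q' ∧ z = sgc2 R S + z' ∧ SSEPath k (S * R) C Q' z'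

theorem SSEPath.restrict {k n m : ℕ} {A : Matrix (Fin n) (Fin n) ℤ}
    {C C' : Matrix (Fin m) (Fin m) ℤ} {Q : Matrix (Fin n) (Fin m) ℤ} {z : ZMod 2}
    (h : SSEPath k A C Q z) (hC : C * C' = 1) (F : ImageFac A) :
    ∃ Q' z', SSEPath k (F.M * F.I) C Q' z' ∧ F.I * Q' = Q ∧ z = sgc2 F.I F.M + z' := by
  induction k generalizing n z with
  | zero =>
    obtain ⟨U, V, hA, hUQ, hQV, rfl⟩ := h
    have hC' : C' * C = 1 := mul_eq_one_comm.1 hC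
    have h1 : F.I * (F.M * Q * C') = Q := by
      rw [← Matrix.mul_assoc, ← Matrix.mul_assoc, F.mul_eq, ← hA, Matrix.mul_assoc Q, hUQ,
        Matrix.mul_assoc, hC, Matrix.mul_one]
    have h2 : Q * (C' * U) = 1 := by
      calc Q * (C' * U) = Q * (C' * (U * (Q * V))) := by rw [hQV, Matrix.mul_one]
        _ = Q * ((C' * (U * Q)) * V) := by simp only [Matrix.mul_assoc]
        _ = 1 := by rw [hUQ, hC', Matrix.one_mul, hQV]
    have h3 : F.M * Q * C' * U = F.M := by
      rw [Matrix.mul_assoc, Matrix.mul_assoc, h2, Matrix.mul_one]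
    refine ⟨F.M * Q * C', _, ⟨U * F.I, V * F.I, ?_, ?_, ?_, rfl⟩, h1, ?_⟩
    · rw [← Matrix.mul_assoc, h3]
    · rw [Matrix.mul_assoc, h1, hUQ]
    · apply F.cancel
      rw [← Matrix.mul_assoc, h1, ← Matrix.mul_assoc, hQV, Matrix.one_mul, Matrix.mul_one]
    · have t := sgc2_triangle F.I (F.M * Q * C') U
      rwa [h1, h3] at t
  | succ k ih =>
    obtain ⟨p, R, S, Q₁, z₁, rfl, rfl, rfl, h⟩ := h
    obtain ⟨F'⟩ := exists_imageFac (S * R)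
    obtain ⟨Q', z', h', hQ, rfl⟩ := ih h F'
    obtain ⟨R', S', h1, h2, h3, h4⟩ := F.exists_restrict F'
    refine ⟨R' * Q', sgc2 R' S' + z', ⟨_, R', S', Q', z', h1.symm, rfl, rfl, h2 ▸ h'⟩, ?_, ?_⟩
    · rw [← Matrix.mul_assoc, h3, Matrix.mul_assoc, hQ]
    · linear_combination h4

theorem SSEPath.exists_eq_sgc2 {k n m : ℕ} {A A' : Matrix (Fin n) (Fin n) ℤ}
    {C C' : Matrix (Fin m) (Fin m) ℤ} {Q : Matrix (Fin n) (Fin m) ℤ} {z : ZMod 2}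
    (h : SSEPath k A C Q z) (hA : A * A' = 1) (hC : C * C' = 1) :
    ∃ U, Q * U = A ∧ U * Q = C ∧ z = sgc2 Q U := by
  induction k generalizing n z with
  | zero =>
    obtain ⟨U, V, h1, h2, -, h3⟩ := h
    exact ⟨U, h1, h2, h3⟩
  | succ k ih =>
    obtain ⟨p, R, S, Q₁, z₁, hRS, rfl, rfl, h⟩ := h
    obtain ⟨F⟩ := exists_imageFac (S * R)
    obtain ⟨Q', z', h', rfl, rfl⟩ := h.restrict hC F
    obtain ⟨r, I, M, Z, hIM, hMZ, hI⟩ := F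
    dsimp only at Q' h' ⊢
    have hA' : A' * A = 1 := mul_eq_one_comm.1 hA
    have hIT : I * (M * S * A') = S := by
      rw [← Matrix.mul_assoc, ← Matrix.mul_assoc, hIM, Matrix.mul_assoc S, hRS, Matrix.mul_assoc,
        hA, Matrix.mul_one]
    generalize M * S * A' = T at hIT
    have hTR : T * R = M := hI (by rw [← Matrix.mul_assoc, hIT, hIM])
    have hXT : R * I * T = A := by rw [Matrix.mul_assoc, hIT, hRS]
    have hTX : T * (R * I) = M * I := by rw [← Matrix.mul_assoc, hTR]
    have hTY : T * (R * Z) = 1 := by rw [← Matrix.mul_assoc, hTR, hMZ]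
    have hTAX : T * A' * (R * I) = 1 := by
      calc T * A' * (R * I) = T * A' * (R * I) * (T * (R * Z)) := by rw [hTY, Matrix.mul_one]
        _ = T * (A' * (R * I * T)) * (R * Z) := by simp only [Matrix.mul_assoc]
        _ = 1 := by rw [hXT, hA', Matrix.mul_one, hTY]
    have hW : M * I * (T * A' * A' * (R * I)) = 1 := by
      calc _ = T * (R * I * T * A') * A' * (R * I) := by
            rw [← hTX]
            simp only [Matrix.mul_assoc]
        _ = 1 := by rw [hXT, hA, Matrix.mul_one, hTAX]
    generalize T * A' * A' * (R * I) = W at hW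
    have hW' : W * (M * I) = 1 := mul_eq_one_comm.1 hW
    obtain ⟨U, hQU, hUQ, rfl⟩ := ih h' hW
    have h1 : Q' * (U * W * T) = T := by
      rw [← Matrix.mul_assoc, ← Matrix.mul_assoc, hQU, hW, Matrix.one_mul]
    have h2 : U * W * T * (R * I) = U := by
      rw [Matrix.mul_assoc, hTX, Matrix.mul_assoc, hW', Matrix.mul_one]
    have h3 : R * (I * Q') = R * I * Q' := by rw [Matrix.mul_assoc]
    refine ⟨U * W * T, ?_, ?_, ?_⟩
    · rw [h3, Matrix.mul_assoc, h1, hXT]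
    · rw [h3, ← Matrix.mul_assoc, h2, hUQ]
    · have t₁ := sgc2_triangle R I T
      have t₂ := sgc2_triangle (R * I) Q' (U * W * T)
      rw [hIT, hTR] at t₁
      rw [h1, h2] at t₂
      rw [h3, t₂, t₁]
      ring

theorem exists_SSEPath {k : ℕ} (c : SSEChain ℤ k) :
    ∃ Q, SSEPath k (c.mat 0) (c.mat (Fin.last k)) Q (∑ i, sgc2 (c.R i) (c.S i)) := by
  induction k with
  | zero =>
    change ∃ Q, SSEPath 0 (c.mat 0) (c.mat 0) Q 0
    refine ⟨1, c.mat 0, 1, ?_, ?_, ?_, ?_⟩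
    · exact Matrix.one_mul _
    · exact Matrix.mul_one _
    · exact Matrix.one_mul _
    · exact (sgc2_one_left _).symm
  | succ k ih =>
    let c' : SSEChain ℤ k :=
      { size := fun i => c.size i.succ
        mat := fun i => c.mat i.succ
        R := fun i => c.R i.succ
        S := fun i => c.S i.succ
        hR := fun i => c.hR i.succ
        hS := fun i => c.hS i.succ }
    obtain ⟨Q, h⟩ := ih c'
    refine ⟨c.R 0 * Q, _, c.R 0, c.S 0, Q, _, (c.hR 0).symm, rfl, Fin.sum_univ_succ _, ?_⟩
    exact (congrArg (fun B => SSEPath k B _ Q _) (c.hS 0)).mp h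

/-- A chain between unimodular matrices has the same total `sgc2` as a single elementary strong
shift equivalence. -/
theorem SSEChain.From.exists_sgc2_eq {k n m : ℕ} {c : SSEChain ℤ k}
    {A A' : Matrix (Fin n) (Fin n) ℤ} {C C' : Matrix (Fin m) (Fin m) ℤ} (hc : c.From A C)
    (hA : A * A' = 1) (hC : C * C' = 1) :
    ∃ Q U, Q * U = A ∧ U * Q = C ∧ ∑ i, sgc2 (c.R i) (c.S i) = sgc2 Q U := by
  obtain ⟨Q, h⟩ := exists_SSEPath c
  obtain ⟨h0, h1, hA0, hC0⟩ := hc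
  revert Q
  generalize ∑ i, sgc2 (c.R i) (c.S i) = z
  generalize c.mat 0 = A₀ at *
  generalize c.mat (Fin.last k) = C₀ at *
  generalize c.size 0 = n₀ at *
  generalize c.size (Fin.last k) = m₀ at *
  subst h0 h1
  intro Q h
  simp at hA0 hC0
  subst hA0 hC0
  obtain ⟨U, hU⟩ := h.exists_eq_sgc2 hA hC
  exact ⟨Q, U, hU⟩

/-- A cyclic vector of the matrix `Amat`. -/
def cyclicVec : Fin 7 → ℤ := ![-1, 0, 0, 1, 0, -1, 0]

/-- The columns of this unimodular matrix are the vectors `Amat ^ i *ᵥ cyclicVec`. -/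
def krylov : Matrix (Fin 7) (Fin 7) ℤ :=
  !![-1, 1, 0, -4, -6, -5, -76;
    0, -1, 1, -3, -4, -6, -74;
    0, 0, -1, -2, -3, -4, -75;
    1, 0, 0, -4, -2, -3, -73;
    0, 0, -1, 0, 0, -23, -28;
    -1, 0, 0, -10, -13, -15, -248;
    0, -1, 0, 0, -23, -28, -33]

def krylovInv : Matrix (Fin 7) (Fin 7) ℤ :=
  !![-127001, -133386, -133725, -6742, 339, 120258, 6385;
    -232980, -244694, -245316, -12369, 622, 220611, 11713;
    -197038, -206944, -207471, -10461, 526, 186577, 9906;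
    -155088, -162885, -163299, -8234, 414, 146854, 7797;
    19, 20, 20, 1, 0, -18, -1;
    358, 376, 377, 19, -1, -339, -18;
    6743, 7082, 7100, 358, -18, -6385, -339]

theorem krylov_mul_inv : krylov * krylovInv = 1 := by decide +kernel

theorem krylovInv_mul : krylovInv * krylov = 1 := mul_eq_one_comm.1 krylov_mul_inv

theorem Amat_pow_mulVec (i : Fin 7) : Amat ^ (i : ℕ) *ᵥ cyclicVec = krylov.col i := by
  induction i using Fin.induction with
  | zero => decide +kernel
  | succ i ih =>
    rw [Fin.val_succ, pow_succ', ← mulVec_mulVec]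
    rw [Fin.val_castSucc] at ih
    rw [ih]
    revert i
    decide +kernel

theorem eq_zero_of_commute {R : Matrix (Fin 7) (Fin 7) ℤ} (h : Commute R Amat)
    (hv : R *ᵥ cyclicVec = 0) : R = 0 := by
  have h1 : R * krylov = 0 := by
    ext i j
    change (R *ᵥ krylov.col j) i = 0
    rw [← Amat_pow_mulVec, mulVec_mulVec, (h.pow_right _).eq, ← mulVec_mulVec, hv, mulVec_zero]
    rfl
  rw [← Matrix.mul_one R, ← krylov_mul_inv, ← Matrix.mul_assoc, h1, Matrix.zero_mul]

open Polynomial in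
/-- The polynomial with given coefficients of degree less than seven. -/
noncomputable def ofCoeffs (c : Fin 7 → ℤ) : ℤ[X] := ∑ i, C (c i) * X ^ (i : ℕ)

open Polynomial in
theorem aeval_commute (g : ℤ[X]) : Commute (aeval Amat g) Amat := by
  simpa using (Commute.all g X).map (aeval Amat)

open Polynomial in
theorem aeval_ofCoeffs_mulVec (c : Fin 7 → ℤ) :
    aeval Amat (ofCoeffs c) *ᵥ cyclicVec = krylov *ᵥ c := by
  have h : ∀ i : Fin 7, (algebraMap ℤ (Matrix (Fin 7) (Fin 7) ℤ) (c i) * Amat ^ (i : ℕ)) *ᵥ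
      cyclicVec = c i • krylov.col i := by
    intro i
    rw [← Amat_pow_mulVec, ← Algebra.smul_def, smul_mulVec]
  simp only [ofCoeffs, map_sum, map_mul, aeval_C, map_pow, aeval_X, sum_mulVec, h]
  ext i
  simp [mulVec, dotProduct, mul_comm]

open Polynomial in
theorem eq_aeval_ofCoeffs {R : Matrix (Fin 7) (Fin 7) ℤ} (h : Commute R Amat)
    (c : Fin 7 → ℤ) (hc : R *ᵥ cyclicVec = krylov *ᵥ c) : R = aeval Amat (ofCoeffs c) := by
  rw [← sub_eq_zero]
  refine eq_zero_of_commute (h.sub_left (aeval_commute _)) ?_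
  rw [sub_mulVec, aeval_ofCoeffs_mulVec, hc, sub_self]

open Polynomial in
theorem exists_eq_aeval {R : Matrix (Fin 7) (Fin 7) ℤ} (h : Commute R Amat) :
    ∃ g : ℤ[X], R = aeval Amat g :=
  ⟨_, eq_aeval_ofCoeffs h (krylovInv *ᵥ R *ᵥ cyclicVec) (by
    rw [mulVec_mulVec, krylov_mul_inv, one_mulVec])⟩

open Polynomial in
/-- The characteristic polynomial of `Amat`. -/
noncomputable def charP : ℤ[X] := X ^ 7 - 23 * X ^ 4 - 28 * X ^ 3 - 33 * X ^ 2 - 17 * X + 1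

theorem charP_monic : charP.Monic := by
  unfold charP
  monicity!

theorem charP_natDegree : charP.natDegree = 7 := by
  unfold charP
  compute_degree!

open Polynomial in
theorem charP_eq : charP = X ^ 7 - ofCoeffs ![-1, 17, 33, 28, 23, 0, 0] := by
  simp [charP, ofCoeffs, Fin.sum_univ_succ]
  ring

open Polynomial in
theorem aeval_charP : aeval Amat charP = 0 := by
  refine eq_zero_of_commute (aeval_commute _) ?_
  rw [charP_eq, map_sub, sub_mulVec, aeval_ofCoeffs_mulVec, map_pow, aeval_X, pow_succ',
    ← mulVec_mulVec, show Amat ^ 6 *ᵥ cyclicVec = krylov.col 6 from Amat_pow_mulVec 6]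
  decide +kernel

open Polynomial in
theorem charP_dvd_of_aeval_eq_zero {g : ℤ[X]} (hg : aeval Amat g = 0) : charP ∣ g := by
  rw [← modByMonic_eq_zero_iff_dvd charP_monic]
  have h1 : aeval Amat (g %ₘ charP) = 0 := by
    rw [aeval_modByMonic_eq_self_of_root aeval_charP, hg]
  have hd : (g %ₘ charP).natDegree < 7 := by
    have := natDegree_modByMonic_lt g charP_monic (fun h => by
      simpa [h] using charP_natDegree)
    rwa [charP_natDegree] at this
  have h2 : g %ₘ charP = ofCoeffs fun i => (g %ₘ charP).coeff i := by
    conv_lhs => rw [as_sum_range' _ 7 hd]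
    rw [Finset.sum_range]
    simp only [ofCoeffs, C_mul_X_pow_eq_monomial]
  rw [h2] at h1
  have h3 := aeval_ofCoeffs_mulVec fun i => (g %ₘ charP).coeff i
  rw [h1, zero_mulVec] at h3
  have h4 := congrArg (krylovInv *ᵥ ·) h3
  simp only [mulVec_mulVec, krylovInv_mul, one_mulVec, mulVec_zero] at h4
  rw [h2, ← h4]
  simp [ofCoeffs]

/-- The order generated by an eigenvalue of `Amat`, isomorphic to the centralizer of `Amat`. -/
abbrev Order : Type := AdjoinRoot charP

/-- The representation of `Order` on `ℤ⁷` in which the root of `charP` acts as `Amat`. -/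
noncomputable def toMatrix : Order →+* Matrix (Fin 7) (Fin 7) ℤ :=
  Ideal.Quotient.lift _ (Polynomial.aeval Amat).toRingHom fun g hg => by
    obtain ⟨q, rfl⟩ := Ideal.mem_span_singleton.1 hg
    simp [aeval_charP]

theorem toMatrix_mk (g : Polynomial ℤ) :
    toMatrix (AdjoinRoot.mk charP g) = Polynomial.aeval Amat g := rfl

theorem toMatrix_root : toMatrix (AdjoinRoot.root charP) = Amat := by
  rw [AdjoinRoot.root, toMatrix_mk, Polynomial.aeval_X]

theorem toMatrix_injective : Function.Injective toMatrix := by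
  rw [injective_iff_map_eq_zero]
  intro x hx
  obtain ⟨g, rfl⟩ := AdjoinRoot.mk_surjective x
  exact AdjoinRoot.mk_eq_zero.2 (charP_dvd_of_aeval_eq_zero hx)

theorem exists_toMatrix_eq {R : Matrix (Fin 7) (Fin 7) ℤ} (h : Commute R Amat) :
    ∃ x, toMatrix x = R := by
  obtain ⟨g, rfl⟩ := exists_eq_aeval h
  exact ⟨_, toMatrix_mk g⟩

theorem commute_of_mul_eq {R S A : Matrix (Fin 7) (Fin 7) ℤ} (h : R * S = A) (h' : S * R = A) :
    Commute R A := by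
  rw [Commute, SemiconjBy, ← h, Matrix.mul_assoc, h', h]

theorem isUnit_root : IsUnit (AdjoinRoot.root charP) := by
  refine IsUnit.of_mul_eq_one (AdjoinRoot.mk charP
    (ofCoeffs ![17, 33, 28, 23, 0, 0, -1])) (toMatrix_injective ?_)
  rw [map_mul, toMatrix_root, toMatrix_mk, map_one]
  refine sub_eq_zero.1 (eq_zero_of_commute ?_ ?_)
  · exact ((Commute.refl _).mul_left (aeval_commute _)).sub_left (Commute.one_left _)
  · rw [sub_mulVec, ← mulVec_mulVec, aeval_ofCoeffs_mulVec]
    decide +kernel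

theorem exists_unit_toMatrix_eq {R S : Matrix (Fin 7) (Fin 7) ℤ} (h : R * S = Amat)
    (h' : S * R = Amat) : ∃ u : Orderˣ, toMatrix u = R := by
  obtain ⟨x, hx⟩ := exists_toMatrix_eq (commute_of_mul_eq h h')
  obtain ⟨y, hy⟩ := exists_toMatrix_eq (commute_of_mul_eq h' h)
  have hxy : x * y = AdjoinRoot.root charP := toMatrix_injective (by
    rw [map_mul, hx, hy, h, toMatrix_root])
  obtain ⟨u, hu⟩ := isUnit_of_mul_isUnit_left (hxy ▸ isUnit_root)
  exact ⟨u, hu ▸ hx⟩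

/-- The homomorphism on the units of the centralizer of `Amat` induced by `sgc2`. -/
noncomputable def sgcHom : Orderˣ →* Multiplicative (ZMod 2) where
  toFun u := .ofAdd (sgc2 (toMatrix u) (toMatrix (↑u⁻¹ * AdjoinRoot.root charP)))
  map_one' := by simp [sgc2_one_left]
  map_mul' u v := by
    rw [← ofAdd_add, Units.val_mul, map_mul, sgc2_triangle, ← map_mul, ← map_mul]
    congr 4
    · rw [mul_inv, Units.val_mul]
      linear_combination (↑u⁻¹ * AdjoinRoot.root charP) * v.mul_inv
    · rw [mul_inv, Units.val_mul]
      linear_combination (↑v⁻¹ * AdjoinRoot.root charP) * u.mul_inv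

theorem sgcHom_eq {u : Orderˣ} {S : Matrix (Fin 7) (Fin 7) ℤ} (h : toMatrix u * S = Amat) :
    sgcHom u = .ofAdd (sgc2 (toMatrix u) S) := by
  have hS : S = toMatrix (↑u⁻¹ * AdjoinRoot.root charP) := by
    rw [map_mul, toMatrix_root, ← h, ← Matrix.mul_assoc, ← map_mul, Units.inv_mul, map_one,
      Matrix.one_mul]
  rw [hS]
  rfl

theorem exists_unit_of_mul_eq {R S : Matrix (Fin 7) (Fin 7) ℤ} {c : Fin 7 → ℤ}
    (h : R * S = Amat) (h' : S * R = Amat) (hc : R *ᵥ cyclicVec = krylov *ᵥ c)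
    (hs : sgc2 R S = 0) :
    ∃ u : Orderˣ, (u : Order) = AdjoinRoot.mk charP (ofCoeffs c) ∧ sgcHom u = 1 := by
  obtain ⟨u, hu⟩ := exists_unit_toMatrix_eq h h'
  refine ⟨u, toMatrix_injective ?_, ?_⟩
  · rw [hu, toMatrix_mk, ← eq_aeval_ofCoeffs (commute_of_mul_eq h h') c hc]
  · rw [sgcHom_eq (hu ▸ h), hu, hs]
    rfl

/-- Coefficients of four units of `Order` that together with `-1` are independent modulo squares. -/
def unitCoeffs : Fin 4 → Fin 7 → ℤ := ![
  ![0, 1, 0, 0, 0, 0, 0],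
  ![67573, -1128220, -2572499, -2673762, -2369231, -723446, -221045],
  ![16305416, 29911947, 25297297, 19911342, -2518, -46016, -865694],
  ![-131231, 2123742, 6314315, 4462422, 256387, -44528, -197901]]

theorem exists_units : ∃ e : Fin 4 → Orderˣ, ∀ i,
    (e i : Order) = AdjoinRoot.mk charP (ofCoeffs (unitCoeffs i)) ∧ sgcHom (e i) = 1 := by
  suffices h : ∀ i, ∃ u : Orderˣ,
      (u : Order) = AdjoinRoot.mk charP (ofCoeffs (unitCoeffs i)) ∧ sgcHom u = 1 by
    choose e he using h
    exact ⟨e, he⟩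
  intro i
  fin_cases i
  · exact exists_unit_of_mul_eq (R := Amat) (S := 1) (mul_one _) (one_mul _) (by decide +kernel)
      (by decide +kernel)
  · exact exists_unit_of_mul_eq
      (R := !![-82220952, -87596027, -105193364, -80582249, -455575095, -42492588, -139135557;
        -68470745, -72942921, -87596027, -67103703, -379372044, -35384895, -115862166;
        -64270230, -68470745, -82220952, -62984912, -356098653, -33214557, -108754473;
        -62984912, -67103703, -80582249, -61728628, -348990960, -32551422, -106584135;
        -47323010, -50415687, -60542715, -46378519, -262204681, -24456526, -80078829;
        -229414741, -244406998, -293500325, -224835060, -1271124621, -118561219, -388208722;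
        -154951042, -165078070, -198236884, -151858365, -858545053, -80078829, -262204681])
      (S := !![-183107, -164540, -104344, -168517, 1011084, -260256, 358182;
        -207496, -174989, -164540, -196083, 108840, -197730, 594891;
        -243180, -207496, -183107, -228713, 345549, -252138, 657417;
        -228713, -196083, -168517, -214650, 408075, -244827, 603009;
        135093, 132387, 32642, 119394, -1739236, 285049, -83114;
        -725277, -622820, -530492, -680065, 1382359, -784285, 1895539;
        334322, 234577, 456422, 337028, 4109038, -83114, -1739236])
      (by decide +kernel) (by decide +kernel) (by decide +kernel) (by decide +kernel)
  · exact exists_unit_of_mul_eq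
      (R := !![3050102, 3203497, 3211236, 162051, -15243, -2887146, -152385;
        3042783, 3195704, 3203497, 162039, -13734, -2879592, -153525;
        2897169, 3042783, 3050102, 154312, -14874, -2741544, -145971;
        154312, 162039, 162051, 8644, -7320, -144462, -7923;
        -962505, -1011039, -1013177, -50795, 10464, 911207, 46217;
        -9143438, -9603218, -9628901, -483980, 2366, 8663208, 459326;
        -53615, -55753, -55876, -5081, -478, 46217, 10464])
      (S := !![-619777335257, 487903645012, -324236230518, 890993396101, -67474232028,
        -125517903906, 92028387888;
        932627486941, -734186819417, 487903645012, -1340747530525, 101533760439, 188876618421,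
        -138482321373;
        -1184703955525, 932627486941, -619777335257, 1703133271631, -128976948822,
        -239927388066, 175912200954;
        1703133271631, -1340747530525, 890993396101, -2448428510794, 185417573505, 344920193421,
        -252891805533;
        -21338395704, 16798099016, -11163172006, 30676129296, -2323079243, -4321472489,
        3168457517;
        -842750276494, 663433314883, -440884423696, 1211539835905, -91748962894, -170674599113,
        125136794980;
        15645084044, -12316186978, 8184718620, -22491410676, 1703256916, 3168457517,
        -2323079243])
      (by decide +kernel) (by decide +kernel) (by decide +kernel) (by decide +kernel)
  · exact exists_unit_of_mul_eq
      (R := !![-994690, 3037347, -897976, -2455063, -543609, 409548, 115761;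
        -2363353, -1630267, 3037347, 1966635, 209562, -359613, 383664;
        2693922, -2363353, -994690, 1480260, 477465, -226029, -385497;
        1480260, 1966635, -2455063, -2065402, -291696, 367674, -251913;
        -203842, 8017, 175103, 38587, -7145, -8628, 31267;
        -594275, -1128856, 1183957, 1128348, 174685, -198725, 105300;
        30656, 197742, -142616, -181203, -32685, 31267, -7145])
      (S := !![83266447995, -65549353362, 43560804336, -119704047127, 9065093502, 16863201372,
        -12363919404;
        -125297544430, 98637244629, -65549353362, 180128052835, -13640956560, -25375379598,
        18604957497;
        159163758898, -125297544430, 83266447995, -228814204825, 17327920341, 32233998006,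
        -23633623473;
        -228814204825, 180128052835, -119704047127, 328943854192, -24910660629, -46339673535,
        33975754131;
        2866791511, -2256807367, 1499760656, -4121306468, 312103178, 580585375, -425679052;
        113222633467, -89131584180, 59232369074, -162769131993, 12326378231, 22929956933,
        -16812000005;
        -2101901044, 1654666979, -1099608634, 3021697834, -228831254, -425679052, 312103178])
      (by decide +kernel) (by decide +kernel) (by decide +kernel) (by decide +kernel)

theorem sgcHom_neg_one : sgcHom (-1) = 1 := by
  have h : toMatrix ((-1 : Orderˣ) : Order) = -1 := by simp
  rw [sgcHom_eq (S := -Amat) (by simp), h]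
  decide +kernel

open Polynomial in
theorem charP_map {R : Type*} [CommRing R] (f : ℤ →+* R) :
    charP.map f = X ^ 7 - 23 * X ^ 4 - 28 * X ^ 3 - 33 * X ^ 2 - 17 * X + 1 := by
  simp [charP, Polynomial.map_sub]

section Irreducible

open Polynomial

instance : Fact (Nat.Prime 5) := ⟨by norm_num⟩

theorem eq_zero_of_dvd_of_dvd_sub {p q r : (ZMod 5)[X]} (h : q ∣ p) (h' : q ∣ p - r)
    (hd : r.natDegree < q.natDegree) : r = 0 := by
  by_contra hr
  exact absurd (natDegree_le_of_dvd ((dvd_sub_right h).1 h') hr) hd.not_ge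

theorem not_dvd_of_natDegree_eq_one {q : (ZMod 5)[X]} (hq : q.Monic) (hd : q.natDegree = 1) :
    ¬ q ∣ charP.map (Int.castRingHom (ZMod 5)) := by
  intro h
  have hr : q.IsRoot (-q.coeff 0) := by
    rw [hq.eq_X_add_C hd]
    simp
  have h1 := hr.dvd h
  generalize -q.coeff 0 = x at h1
  rw [IsRoot, charP_map] at h1
  simp only [eval_add, eval_sub, eval_mul, eval_pow, eval_X, eval_ofNat, eval_one] at h1
  revert x
  decide

theorem not_dvd_of_natDegree_eq_two {q : (ZMod 5)[X]} (hq : q.Monic) (hd : q.natDegree = 2) :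
    ¬ q ∣ charP.map (Int.castRingHom (ZMod 5)) := by
  intro h
  have hq' : q = X ^ 2 + C (q.coeff 1) * X + C (q.coeff 0) := by
    have h2 : q.coeff 2 = 1 := hd ▸ hq.coeff_natDegree
    conv_lhs => rw [q.as_sum_range_C_mul_X_pow, hd]
    simp [sum_range_succ, h2]
    ring
  generalize q.coeff 1 = a, q.coeff 0 = b at hq'
  have key : ∃ s₄ s₃ s₂ s₁ s₀ : ZMod 5, s₄ = -a ∧ s₃ = -a * s₄ - b ∧
      s₂ = -23 - a * s₃ - b * s₄ ∧ s₁ = -28 - a * s₂ - b * s₃ ∧ s₀ = -33 - a * s₁ - b * s₂ ∧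
      charP.map (Int.castRingHom (ZMod 5)) -
        (C (-17 - a * s₀ - b * s₁) * X + C (1 - b * s₀)) =
        q * (X ^ 5 + C s₄ * X ^ 4 + C s₃ * X ^ 3 + C s₂ * X ^ 2 + C s₁ * X + C s₀) := by
    refine ⟨_, _, _, _, _, rfl, rfl, rfl, rfl, rfl, ?_⟩
    rw [charP_map, hq']
    simp only [map_sub, map_mul, map_neg, map_one, map_ofNat]
    ring
  obtain ⟨s₄, s₃, s₂, s₁, s₀, h₄, h₃, h₂, h₁, h₀, e⟩ := key
  have hr := eq_zero_of_dvd_of_dvd_sub h ⟨_, e⟩ (by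
    rw [hd]
    exact natDegree_linear_le.trans_lt one_lt_two)
  have hr1 := congrArg (coeff · 1) hr
  have hr0 := congrArg (coeff · 0) hr
  simp [-map_sub, -map_mul, coeff_X, coeff_C] at hr1 hr0
  clear hr e hq' h hd hq
  subst h₄ h₃ h₂ h₁ h₀
  revert a b
  decide +kernel

theorem not_dvd_of_natDegree_eq_three {q : (ZMod 5)[X]} (hq : q.Monic) (hd : q.natDegree = 3) :
    ¬ q ∣ charP.map (Int.castRingHom (ZMod 5)) := by
  intro h
  have hq' : q = X ^ 3 + C (q.coeff 2) * X ^ 2 + C (q.coeff 1) * X + C (q.coeff 0) := by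
    have h2 : q.coeff 3 = 1 := hd ▸ hq.coeff_natDegree
    conv_lhs => rw [q.as_sum_range_C_mul_X_pow, hd]
    simp [sum_range_succ, h2]
    ring
  generalize q.coeff 2 = a, q.coeff 1 = b, q.coeff 0 = c at hq'
  have key : ∃ s₃ s₂ s₁ s₀ : ZMod 5, s₃ = -a ∧ s₂ = -a * s₃ - b ∧
      s₁ = -23 - a * s₂ - b * s₃ - c ∧ s₀ = -28 - a * s₁ - b * s₂ - c * s₃ ∧
      charP.map (Int.castRingHom (ZMod 5)) -
        (C (-33 - a * s₀ - b * s₁ - c * s₂) * X ^ 2 + C (-17 - b * s₀ - c * s₁) * X +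
          C (1 - c * s₀)) =
        q * (X ^ 4 + C s₃ * X ^ 3 + C s₂ * X ^ 2 + C s₁ * X + C s₀) := by
    refine ⟨_, _, _, _, rfl, rfl, rfl, rfl, ?_⟩
    rw [charP_map, hq']
    simp only [map_sub, map_mul, map_neg, map_one, map_ofNat]
    ring
  obtain ⟨s₃, s₂, s₁, s₀, h₃, h₂, h₁, h₀, e⟩ := key
  have hr := eq_zero_of_dvd_of_dvd_sub h ⟨_, e⟩ (by
    rw [hd]
    exact natDegree_quadratic_le.trans_lt (by norm_num))
  have hr2 := congrArg (coeff · 2) hr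
  have hr1 := congrArg (coeff · 1) hr
  have hr0 := congrArg (coeff · 0) hr
  simp [-map_sub, -map_mul, coeff_X, coeff_C] at hr2 hr1 hr0
  clear hr e hq' h hd hq
  subst h₃ h₂ h₁ h₀
  revert a b c
  decide +kernel

theorem charP_map_zmod_irreducible : Irreducible (charP.map (Int.castRingHom (ZMod 5))) := by
  have hm : (charP.map (Int.castRingHom (ZMod 5))).Monic := charP_monic.map _
  have hd : (charP.map (Int.castRingHom (ZMod 5))).natDegree = 7 := by
    rw [charP_monic.natDegree_map, charP_natDegree]
  rw [hm.irreducible_iff_lt_natDegree_lt (fun h => by simp [h] at hd), hd]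
  intro q hq hq'
  obtain ⟨h0, h3⟩ := Finset.mem_Ioc.1 hq'
  have : q.natDegree = 1 ∨ q.natDegree = 2 ∨ q.natDegree = 3 := by lia
  rcases this with h | h | h
  · exact not_dvd_of_natDegree_eq_one hq h
  · exact not_dvd_of_natDegree_eq_two hq h
  · exact not_dvd_of_natDegree_eq_three hq h

theorem charP_irreducible : Irreducible charP :=
  charP_monic.irreducible_of_irreducible_map (Int.castRingHom (ZMod 5)) _
    charP_map_zmod_irreducible

theorem charP_map_rat_irreducible : Irreducible (charP.map (algebraMap ℤ ℚ)) :=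
  (charP_monic.irreducible_iff_irreducible_map_fraction_map (K := ℚ)).1 charP_irreducible

end Irreducible

section RealRoots

open Polynomial

theorem card_real_roots_le : (charP.map (Int.castRingHom ℝ)).roots.toFinset.card ≤ 3 := by
  have h1 := card_roots_toFinset_le_derivative (charP.map (Int.castRingHom ℝ))
  have h2 := card_roots_toFinset_le_derivative (charP.map (Int.castRingHom ℝ)).derivative
  have h3 : (charP.map (Int.castRingHom ℝ)).derivative.derivative.roots.toFinset.card ≤ 1 := by
    rw [Finset.card_le_one]
    have key : ∀ x ∈ (charP.map (Int.castRingHom ℝ)).derivative.derivative.roots.toFinset,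
        7 * x ^ 5 - 46 * x ^ 2 - 28 * x - 11 = 0 := by
      intro x hx
      rw [Multiset.mem_toFinset, mem_roots', IsRoot.def, charP_map] at hx
      have := hx.2
      simp [derivative_pow] at this
      linarith
    have hpos : ∀ x : ℝ, 7 * x ^ 5 - 46 * x ^ 2 - 28 * x - 11 = 0 → 0 < x := by
      intro x hx
      by_contra! h
      have : x ^ 5 ≤ 0 := by
        have : 0 ≤ (-x) ^ 5 := pow_nonneg (by linarith) 5
        nlinarith
      nlinarith [sq_nonneg (46 * x + 14)]
    have hlt : ∀ x y : ℝ, 7 * x ^ 5 - 46 * x ^ 2 - 28 * x - 11 = 0 →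
        7 * y ^ 5 - 46 * y ^ 2 - 28 * y - 11 = 0 → ¬ x < y := by
      intro x y hx hy h
      have hx0 := hpos x hx
      have hy0 := hpos y hy
      have e : 7 * x ^ 2 * y ^ 2 * (y ^ 3 - x ^ 3) + 28 * x * y * (y - x) +
          11 * (y ^ 2 - x ^ 2) = 0 := by
        linear_combination x ^ 2 * hy - y ^ 2 * hx
      have a1 : 0 < y ^ 3 - x ^ 3 := sub_pos.2 (pow_lt_pow_left₀ h hx0.le (by norm_num))
      have a2 : 0 < y ^ 2 - x ^ 2 := sub_pos.2 (pow_lt_pow_left₀ h hx0.le (by norm_num))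
      have a3 : 0 < y - x := sub_pos.2 h
      have : 0 < 7 * x ^ 2 * y ^ 2 * (y ^ 3 - x ^ 3) + 28 * x * y * (y - x) +
          11 * (y ^ 2 - x ^ 2) := by positivity
      exact this.ne' e
    intro x hx y hy
    exact le_antisymm (not_lt.1 (hlt y x (key y hy) (key x hx)))
      (not_lt.1 (hlt x y (key x hx) (key y hy)))
  lia

end RealRoots

section Units

open NumberField

theorem units_rank_le {K : Type*} [Field K] [NumberField K]
    (h : InfinitePlace.nrRealPlaces K ≤ 3) (hd : Module.finrank ℚ K = 7) :
    Units.rank K ≤ 4 := by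
  have h1 := InfinitePlace.card_add_two_mul_card_eq_rank K
  have h2 := InfinitePlace.card_eq_nrRealPlaces_add_nrComplexPlaces K
  rw [Units.rank]
  lia

theorem exists_prod_zpow_mem_torsion {K : Type*} [Field K] [NumberField K] {n : ℕ}
    (h : Units.rank K < n) (u : Fin n → (𝓞 K)ˣ) :
    ∃ c : Fin n → ℤ, (∃ i, ¬ Even (c i)) ∧ ∏ i, u i ^ c i ∈ Units.torsion K := by
  have hli : ¬ LinearIndependent ℤ fun i => Additive.ofMul (u i) := by
    intro hl
    have := hl.fintype_card_le_finrank
    rw [Units.finrank_eq, Fintype.card_fin] at this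
    lia
  obtain ⟨g, hg, i, hi⟩ := Fintype.not_linearIndependent_iff.1 hli
  obtain ⟨c, hc, hgcd⟩ := Finset.extract_gcd g ⟨i, Finset.mem_univ i⟩
  have hd : Finset.univ.gcd g ≠ 0 := fun h0 => hi (by
    rw [hc i (Finset.mem_univ i), h0, zero_mul])
  refine ⟨c, ?_, ?_⟩
  · by_contra! hev
    have : (2 : ℤ) ∣ Finset.univ.gcd c := Finset.dvd_gcd fun i _ => (hev i).two_dvd
    rw [hgcd] at this
    norm_num at this
  · have h1 : ∏ i, u i ^ g i = 1 := hg
    have h2 : (∏ i, u i ^ c i) ^ Finset.univ.gcd g = 1 := by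
      rw [← h1, ← Finset.prod_zpow]
      refine Finset.prod_congr rfl fun i hi => ?_
      rw [← _root_.zpow_mul, mul_comm, ← hc i hi]
    exact isOfFinOrder_iff_zpow_eq_one.2 ⟨_, hd, h2⟩

end Units

section NumberField

open NumberField

instance : Fact (Irreducible (charP.map (algebraMap ℤ ℚ))) := ⟨charP_map_rat_irreducible⟩

/-- The field generated by an eigenvalue of `Amat`. -/
abbrev EigenField : Type := AdjoinRoot (charP.map (algebraMap ℤ ℚ))

theorem charP_map_rat_natDegree : (charP.map (algebraMap ℤ ℚ)).natDegree = 7 := by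
  rw [charP_monic.natDegree_map, charP_natDegree]

instance : FiniteDimensional ℚ EigenField :=
  (AdjoinRoot.powerBasis charP_map_rat_irreducible.ne_zero).finite

instance : CharZero EigenField := charZero_of_injective_algebraMap (algebraMap ℚ _).injective

instance : NumberField EigenField where

theorem finrank_eigenField : Module.finrank ℚ EigenField = 7 := by
  rw [(AdjoinRoot.powerBasis charP_map_rat_irreducible.ne_zero).finrank,
    AdjoinRoot.powerBasis_dim, charP_map_rat_natDegree]

theorem eval₂_charP_root {R : Type*} [CommRing R] (f : EigenField →+* R) (i : ℤ →+* R) :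
    charP.eval₂ i (f (AdjoinRoot.root _)) = 0 := by
  have h := congrArg f (AdjoinRoot.eval₂_root (charP.map (algebraMap ℤ ℚ)))
  rw [Polynomial.eval₂_map, Polynomial.hom_eval₂, map_zero] at h
  rwa [Subsingleton.elim i]

theorem nrRealPlaces_le : InfinitePlace.nrRealPlaces EigenField ≤ 3 := by
  classical
  rw [← InfinitePlace.card_real_embeddings]
  refine le_trans ?_ card_real_roots_le
  rw [← Fintype.card_coe]
  refine Fintype.card_le_of_injective (fun φ => ⟨φ.2.embedding (AdjoinRoot.root _), ?_⟩) ?_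
  · rw [Multiset.mem_toFinset, Polynomial.mem_roots (charP_monic.map _).ne_zero,
      Polynomial.IsRoot.def, Polynomial.eval_map]
    exact eval₂_charP_root _ _
  · intro φ ψ h
    have h1 : φ.1 (AdjoinRoot.root _) = ψ.1 (AdjoinRoot.root _) := by
      rw [← ComplexEmbedding.IsReal.coe_embedding_apply φ.2,
        ← ComplexEmbedding.IsReal.coe_embedding_apply ψ.2]
      exact congrArg Complex.ofReal (congrArg Subtype.val h)
    have h2 : φ.1.toRatAlgHom = ψ.1.toRatAlgHom := AdjoinRoot.algHom_ext h1
    exact Subtype.ext (RingHom.ext fun x => DFunLike.congr_fun h2 x)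

theorem isIntegral_root :
    IsIntegral ℤ (AdjoinRoot.root (charP.map (algebraMap ℤ ℚ)) : EigenField) :=
  ⟨charP, charP_monic, eval₂_charP_root (RingHom.id _) _⟩

/-- The eigenvalue, as an algebraic integer. -/
noncomputable def rootInt : 𝓞 EigenField := ⟨AdjoinRoot.root _, isIntegral_root⟩

/-- The inclusion of `Order` in the maximal order. -/
noncomputable def toRingOfIntegers : Order →+* 𝓞 EigenField :=
  AdjoinRoot.lift (Int.castRingHom _) rootInt (by
    apply RingOfIntegers.coe_injective
    rw [Polynomial.hom_eval₂, map_zero]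
    exact eval₂_charP_root (RingHom.id _) _)

theorem toRingOfIntegers_injective : Function.Injective toRingOfIntegers := by
  rw [injective_iff_map_eq_zero]
  intro x hx
  obtain ⟨g, rfl⟩ := AdjoinRoot.mk_surjective x
  have h := congrArg (algebraMap (𝓞 EigenField) EigenField) hx
  rw [toRingOfIntegers, AdjoinRoot.lift_mk, Polynomial.hom_eval₂, map_zero] at h
  have h1 : AdjoinRoot.mk (charP.map (algebraMap ℤ ℚ)) (g.map (algebraMap ℤ ℚ)) = 0 := by
    rw [← AdjoinRoot.aeval_eq, Polynomial.aeval_def, Polynomial.eval₂_map, ← h]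
    exact congrArg (fun i => Polynomial.eval₂ i _ g) (Subsingleton.elim _ _)
  rw [AdjoinRoot.mk_eq_zero] at h1 ⊢
  exact (Polynomial.map_dvd_map _ (algebraMap ℤ ℚ).injective_int charP_monic).1 h1

theorem exists_prod_zpow_eq (u : Fin 5 → Orderˣ) :
    ∃ c : Fin 5 → ℤ, (∃ i, ¬ Even (c i)) ∧ (∏ i, u i ^ c i = 1 ∨ ∏ i, u i ^ c i = -1) := by
  let ι : Orderˣ →* (𝓞 EigenField)ˣ := Units.map toRingOfIntegers.toMonoidHom
  have hι : Function.Injective ι := Units.map_injective toRingOfIntegers_injective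
  obtain ⟨c, hc, h⟩ := exists_prod_zpow_mem_torsion
    ((units_rank_le nrRealPlaces_le finrank_eigenField).trans_lt (by norm_num : 4 < 5))
    fun i => ι (u i)
  refine ⟨c, hc, ?_⟩
  have hodd : Odd (Module.finrank ℚ EigenField) := by
    rw [finrank_eigenField]
    decide
  have h1 := Units.torsion_eq_one_or_neg_one_of_odd_finrank hodd ⟨_, h⟩
  simp only [← map_zpow, ← map_prod] at h1
  refine h1.imp (fun h => hι (h.trans (map_one ι).symm)) fun h => hι (h.trans ?_)
  ext
  simp [ι]

end NumberField

/-- The quadratic character of `ZMod p`, written additively. -/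
def quadSign (p : ℕ) (x : ZMod p) : ZMod 2 := if x ^ (p / 2) = 1 then 0 else 1

/-- The quadratic character on units, as a homomorphism. -/
def quadSignHom (p : ℕ) [Fact p.Prime] (hp : p ≠ 2) : (ZMod p)ˣ →* Multiplicative (ZMod 2) where
  toFun x := .ofAdd (quadSign p x)
  map_one' := by simp [quadSign]
  map_mul' x y := by
    have : Fact (2 < p) := ⟨(Fact.out : p.Prime).two_le.lt_of_ne' hp⟩
    have hn := ZMod.neg_one_ne_one (n := p)
    rw [← ofAdd_add]
    congr 1
    simp only [quadSign, Units.val_mul, mul_pow]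
    rcases ZMod.pow_div_two_eq_neg_one_or_one p x.ne_zero with h | h <;>
    rcases ZMod.pow_div_two_eq_neg_one_or_one p y.ne_zero with h' | h' <;>
    simp [h, h', hn, CharTwo.add_self_eq_zero]

/-- The reduction of `Order` at a root of `charP` modulo `p`. -/
noncomputable def residueHom {p : ℕ} {r : ZMod p}
    (hr : r ^ 7 - 23 * r ^ 4 - 28 * r ^ 3 - 33 * r ^ 2 - 17 * r + 1 = 0) : Order →+* ZMod p :=
  AdjoinRoot.lift (Int.castRingHom _) r (by simp [charP, Polynomial.eval₂_sub, hr])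

theorem residueHom_mk {p : ℕ} {r : ZMod p}
    (hr : r ^ 7 - 23 * r ^ 4 - 28 * r ^ 3 - 33 * r ^ 2 - 17 * r + 1 = 0) (c : Fin 7 → ℤ) :
    residueHom hr (AdjoinRoot.mk charP (ofCoeffs c)) = ∑ i, (c i : ZMod p) * r ^ (i : ℕ) := by
  simp [residueHom, ofCoeffs]

instance : Fact (Nat.Prime 11) := ⟨by norm_num⟩

instance : Fact (Nat.Prime 17) := ⟨by norm_num⟩

instance : Fact (Nat.Prime 41) := ⟨by norm_num⟩

theorem sgcHom_eq_one (u : Orderˣ) : sgcHom u = 1 := by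
  obtain ⟨e, he⟩ := exists_units
  obtain ⟨c, ⟨i, hi⟩, hc⟩ := exists_prod_zpow_eq (Fin.cons u e)
  by_contra hu
  obtain ⟨t, ht⟩ : ∃ t : ZMod 2, ∀ χ : Orderˣ →* Multiplicative (ZMod 2),
      (c 0 : ZMod 2) * (χ u).toAdd + ∑ i : Fin 4, (c i.succ : ZMod 2) * (χ (e i)).toAdd =
        t * (χ (-1)).toAdd := by
    have h : ∀ χ : Orderˣ →* Multiplicative (ZMod 2),
        (c 0 : ZMod 2) * (χ u).toAdd + ∑ i : Fin 4, (c i.succ : ZMod 2) * (χ (e i)).toAdd =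
          (χ (∏ i, Fin.cons (α := fun _ => Orderˣ) u e i ^ c i)).toAdd := by
      intro χ
      simp [Fin.prod_univ_succ (n := 4), map_prod]
    simp only [h]
    rcases hc with hc | hc
    · exact ⟨0, fun χ => by simp [hc]⟩
    · exact ⟨1, fun χ => by simp [hc]⟩
  have h0 : (c 0 : ZMod 2) = 0 := by
    have h := ht sgcHom
    simp only [(he _).2, sgcHom_neg_one] at h
    have hu' : (sgcHom u).toAdd = 1 := by
      have : ∀ x : ZMod 2, x ≠ 0 → x = 1 := by decide
      exact this _ hu
    simpa [hu'] using h
  have hrel : ∀ (p : ℕ) [Fact p.Prime] (_ : p ≠ 2) (r : ZMod p)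
      (_ : r ^ 7 - 23 * r ^ 4 - 28 * r ^ 3 - 33 * r ^ 2 - 17 * r + 1 = 0),
      ∑ i : Fin 4, (c i.succ : ZMod 2) *
        quadSign p (∑ j, (unitCoeffs i j : ZMod p) * r ^ (j : ℕ)) = t * quadSign p (-1) := by
    intro p _ hp r hr
    have h := ht ((quadSignHom p hp).comp (Units.map (residueHom hr).toMonoidHom))
    rw [h0, zero_mul, zero_add] at h
    have h1 : residueHom hr (-1) = -1 := by simp
    simp only [← residueHom_mk hr, ← (he _).1, ← h1]
    exact h
  have e₁ := hrel 11 (by decide) 1 (by decide)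
  have e₂ := hrel 11 (by decide) 10 (by decide)
  have e₃ := hrel 17 (by decide) 4 (by decide)
  have e₄ := hrel 17 (by decide) 2 (by decide)
  have e₅ := hrel 41 (by decide) 3 (by decide)
  have v₁ : ∀ i, quadSign 11 (∑ j, (unitCoeffs i j : ZMod 11) * 1 ^ (j : ℕ)) =
    ![0, 0, 0, 1] i := by decide +kernel
  have v₂ : ∀ i, quadSign 11 (∑ j, (unitCoeffs i j : ZMod 11) * 10 ^ (j : ℕ)) =
    ![1, 0, 0, 0] i := by decide +kernel
  have v₃ : ∀ i, quadSign 17 (∑ j, (unitCoeffs i j : ZMod 17) * 4 ^ (j : ℕ)) =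
    ![0, 1, 0, 0] i := by decide +kernel
  have v₄ : ∀ i, quadSign 17 (∑ j, (unitCoeffs i j : ZMod 17) * 2 ^ (j : ℕ)) =
    ![0, 1, 1, 0] i := by decide +kernel
  have v₅ : ∀ i, quadSign 41 (∑ j, (unitCoeffs i j : ZMod 41) * 3 ^ (j : ℕ)) =
    ![1, 1, 1, 0] i := by decide +kernel
  have w₁ : quadSign 11 (-1) = 1 := by decide +kernel
  have w₂ : quadSign 17 (-1) = 0 := by decide +kernel
  have w₃ : quadSign 41 (-1) = 0 := by decide +kernel
  simp only [v₁, v₂, v₃, v₄, v₅, w₁, w₂, w₃] at e₁ e₂ e₃ e₄ e₅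
  clear ht hrel hc
  have hall : ∀ i, (c i : ZMod 2) = 0 := by
    simp [Fin.sum_univ_four] at e₁ e₂ e₃ e₄ e₅
    rw [e₃, zero_add] at e₄
    rw [e₃, e₄, add_zero, add_zero] at e₅
    rw [← e₂, e₅] at e₁
    intro i
    fin_cases i
    exacts [h0, e₅, e₃, e₄, e₁]
  exact hi (ZMod.intCast_eq_zero_iff_even.1 (hall i))

theorem sgc2_eq_zero_of_mul_eq {Q U : Matrix (Fin 7) (Fin 7) ℤ} (h : Q * U = Amat)
    (h' : U * Q = Amat) : sgc2 Q U = 0 := by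
  obtain ⟨u, rfl⟩ := exists_unit_toMatrix_eq h h'
  exact Multiplicative.ofAdd.injective ((sgcHom_eq h).symm.trans (sgcHom_eq_one u))

theorem Amat_mul_inv : Amat * !![3, 4, 3, 0, 0, -3, 0; 3, 3, 4, 0, 0, -3, 0; 3, 3, 3, 1, 0, -3, 0;
    1, 0, 0, -1, 0, 0, 0; -1, -1, -1, 0, 0, 1, 0; -10, -10, -10, 0, 0, 9, 1;
    0, 0, 0, 0, 1, 0, 0] = 1 := by decide +kernel

end SgcTwo

/-- `sgc₂` vanishes on `Aut(s_A)` for the Kim–Roush matrix `A`: every strong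
shift equivalence over `ℤ` from `A` to itself has total `sgc₂` equal to `0`. -/
theorem sum_sgc2_self_SSE_eq_zero (k : ℕ) (c : SSEChain ℤ k) (hc : c.From Amat Amat) :
    ∑ i : Fin k, sgc2 (c.R i) (c.S i) = 0 := by
  obtain ⟨Q, U, h, h', hs⟩ :=
    SgcTwo.SSEChain.From.exists_sgc2_eq hc SgcTwo.Amat_mul_inv SgcTwo.Amat_mul_inv
  rw [hs]
  exact SgcTwo.sgc2_eq_zero_of_mul_eq h h'
end
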